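/- Let n ≥ 2, let ℓ : (0,∞)×ℝ^{n-2} → [0,∞) be measurable with ℓ(r,x') ≤ 2πr for H^{n-1}-a.e. (r,x'), and let E ⊂ ℝⁿ be a circularly ℓ-distributed set of finite perimeter and finite volume. Then ℓ ∈ BV_loc((0,∞)×ℝ^{n-2}), the circular symmetral F^ℓ is a set of finite perimeter, and P(F^ℓ; Φ₁₂(B × S¹)) ≤ P(E; Φ₁₂(B × S¹)) for every Borel set B ⊂ (0,∞)×ℝ^{n-2}. -/

import Mathlib

/- Common definitions: geometric measure theory notions (density points, essential
boundary, perimeter, reduced boundary and measure-theoretic outer unit normal),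
spherical and circular symmetrisation, BV and Sobolev-type notions. -/

open MeasureTheory Metric Set Filter
open scoped ENNReal NNReal Topology RealInnerProductSpace

noncomputable section

/-- Euclidean space `ℝⁿ`. -/
abbrev Euc (n : ℕ) : Type := EuclideanSpace ℝ (Fin n)

/-- `ω_k`: the volume of the unit ball of `ℝ^k`. -/
def omegaBall (k : ℕ) : ℝ := (volume (ball (0 : Euc k) 1)).toReal

/-- The radial unit vector `x̂ = x/|x|`. -/
def hatv {n : ℕ} (x : Euc n) : Euc n := ‖x‖⁻¹ • x

/-- The first vector of the canonical basis. -/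
def e1 (n : ℕ) (hn : 0 < n) : Euc n := EuclideanSpace.single ⟨0, hn⟩ 1

/-- `E` has `n`-dimensional density `t` at `x`. -/
def DensityAt {n : ℕ} (E : Set (Euc n)) (x : Euc n) (t : ℝ≥0∞) : Prop :=
  Tendsto (fun ρ : ℝ => volume (E ∩ ball x ρ) / volume (ball x ρ)) (𝓝[>] (0:ℝ)) (𝓝 t)

/-- The essential boundary `∂ᵉE`: points of density neither `0` nor `1`. -/
def essBoundary {n : ℕ} (E : Set (Euc n)) : Set (Euc n) :=
  {x | ¬ DensityAt E x 0 ∧ ¬ DensityAt E x 1}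

/-- The perimeter of `E` relative to `A`: `P(E;A) = H^{n-1}(∂ᵉE ∩ A)`. -/
def perim {n : ℕ} (E A : Set (Euc n)) : ℝ≥0∞ := μH[(n : ℝ) - 1] (essBoundary E ∩ A)

/-- `ν` is the measure-theoretic outer unit normal of `E` at `x`: the blow-up of `E`
at `x` is the half space `{y : (y-x)·ν ≤ 0}` in density. -/
def HasMTNormal {n : ℕ} (E : Set (Euc n)) (x ν : Euc n) : Prop :=
  ‖ν‖ = 1 ∧
    Tendsto (fun ρ : ℝ =>
        volume ({y | y ∈ E ∧ 0 < ⟪y - x, ν⟫} ∩ ball x ρ) / volume (ball x ρ))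
      (𝓝[>] (0:ℝ)) (𝓝 0) ∧
    Tendsto (fun ρ : ℝ =>
        volume ({y | y ∉ E ∧ ⟪y - x, ν⟫ < 0} ∩ ball x ρ) / volume (ball x ρ))
      (𝓝[>] (0:ℝ)) (𝓝 0)

/-- The reduced boundary `∂*E`. -/
def redBoundary {n : ℕ} (E : Set (Euc n)) : Set (Euc n) := {x | ∃ ν, HasMTNormal E x ν}

/-- The measure-theoretic outer unit normal `ν^E`. -/
def mtNormal {n : ℕ} (E : Set (Euc n)) (x : Euc n) : Euc n :=
  haveI := Classical.propDecidable (∃ ν, HasMTNormal E x ν)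
  if h : ∃ ν, HasMTNormal E x ν then h.choose else 0

/-- The tangential component `ν∥^E(x) = ν^E(x) - (ν^E(x)·x̂)x̂` of the normal along
the sphere `∂B(|x|)`. -/
def nuPar {n : ℕ} (E : Set (Euc n)) (x : Euc n) : Euc n :=
  mtNormal E x - ⟪mtNormal E x, hatv x⟫ • hatv x

/-- The open geodesic ball (spherical cap) `B_β(r p)` in the sphere `∂B(0,r)`. -/
def capSet {n : ℕ} (p : Euc n) (r β : ℝ) : Set (Euc n) :=
  {x | x ∈ sphere (0 : Euc n) r ∧ Real.arccos ⟪hatv x, p⟫ < β}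

/-- The geodesic sphere `S_β(r p)` in the sphere `∂B(0,r)`. -/
def capSphere {n : ℕ} (p : Euc n) (r β : ℝ) : Set (Euc n) :=
  {x | x ∈ sphere (0 : Euc n) r ∧ Real.arccos ⟪hatv x, p⟫ = β}

/-- `E ⊆ ℝⁿ` is spherically `v`-distributed: `H^{n-1}(E ∩ ∂B(0,r)) = v r` for a.e. `r > 0`. -/
def SphDistrib {n : ℕ} (v : ℝ → ℝ) (E : Set (Euc n)) : Prop :=
  ∀ᵐ r ∂(volume.restrict (Ioi (0:ℝ))),
    μH[(n : ℝ) - 1] (E ∩ sphere (0 : Euc n) r) = ENNReal.ofReal (v r)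

/-- The spherical symmetral `F_v` (determined by the angle function `α = α_v` and the
direction `p`). -/
def sphSymm (n : ℕ) (α : ℝ → ℝ) (p : Euc n) : Set (Euc n) :=
  {x : Euc n | x ≠ 0 ∧ Real.arccos ⟪hatv x, p⟫ < α ‖x‖}

/-- `Φ(B × S^{n-1})`, for `B ⊆ (0,∞)`. -/
def sphShell (n : ℕ) (B : Set ℝ) : Set (Euc n) := {x : Euc n | x ≠ 0 ∧ ‖x‖ ∈ B}

/-- `v ∈ BV(0,∞)`: `v` is integrable on `(0,∞)` and has a representative of bounded
pointwise variation there. -/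
def BVIoi (v : ℝ → ℝ) : Prop :=
  IntegrableOn v (Ioi (0:ℝ)) volume ∧
    ∃ w : ℝ → ℝ, (∀ᵐ r ∂(volume.restrict (Ioi (0:ℝ))), w r = v r) ∧
      BoundedVariationOn w (Ioi (0:ℝ))

/-- `f ∈ W^{1,1}_loc(I)` for `I ⊆ ℝ`: `f` has a representative `w` which is locally
absolutely continuous on `I`, i.e. `w b - w a = ∫_a^b g` with `g` locally integrable on `I`. -/
def W11locOn (f : ℝ → ℝ) (I : Set ℝ) : Prop :=
  ∃ w g : ℝ → ℝ, (∀ᵐ r ∂(volume.restrict I), w r = f r) ∧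
    LocallyIntegrableOn g I volume ∧
    ∀ a b : ℝ, uIcc a b ⊆ I → w b - w a = ∫ t in a..b, g t

/-- `S ⊆ ℝ` has one-dimensional density `0` at `x`. -/
def RDensity0 (S : Set ℝ) (x : ℝ) : Prop :=
  Tendsto (fun ρ : ℝ => volume (S ∩ ball x ρ) / volume (ball x ρ)) (𝓝[>] (0:ℝ)) (𝓝 0)

/-- The approximate upper limit `f^∨(x)` (for bounded `f`). -/
def apSup (f : ℝ → ℝ) (x : ℝ) : ℝ := sInf {t : ℝ | RDensity0 {y | t < f y} x}

/-- The approximate lower limit `f^∧(x)` (for bounded `f`). -/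
def apInf (f : ℝ → ℝ) (x : ℝ) : ℝ := sSup {t : ℝ | RDensity0 {y | f y < t} x}

/-- `t` is the approximate limit of `f` at `x` with respect to `A`. -/
def apLimOn (f : ℝ → ℝ) (A : Set ℝ) (x t : ℝ) : Prop :=
  ∀ ε : ℝ, 0 < ε → RDensity0 ({y | ε < |f y - t|} ∩ A) x

/-- Density (with value `t`) at `x` of a subset `A` of the sphere `∂B(0,r)`,
with respect to the measure `H^{n-1}` on the sphere. -/
def SphDensityAt {n : ℕ} (A : Set (Euc n)) (r : ℝ) (x : Euc n) (t : ℝ≥0∞) : Prop :=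
  Tendsto (fun ρ : ℝ =>
      μH[(n : ℝ) - 1] (A ∩ ball x ρ) / μH[(n : ℝ) - 1] (sphere (0 : Euc n) r ∩ ball x ρ))
    (𝓝[>] (0:ℝ)) (𝓝 t)

/-- The essential boundary, within the sphere `∂B(0,r)`, of a subset `A` of that sphere. -/
def sphEssBoundary {n : ℕ} (A : Set (Euc n)) (r : ℝ) : Set (Euc n) :=
  {x | x ∈ sphere (0 : Euc n) r ∧ ¬ SphDensityAt A r x 0 ∧ ¬ SphDensityAt A r x 1}

/-- A pair of mutually singular measures `(σp, σm)` supported in `(0,∞)`, locally finite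
there, representing the distributional derivative `Dξ = σp - σm` of `ξ` on `(0,∞)`. -/
def RepDeriv (ξ : ℝ → ℝ) (σp σm : Measure ℝ) : Prop :=
  σp (Iic (0:ℝ)) = 0 ∧ σm (Iic (0:ℝ)) = 0 ∧
    (∀ K : Set ℝ, K ⊆ Ioi (0:ℝ) → IsCompact K → σp K < ⊤ ∧ σm K < ⊤) ∧
    σp.MutuallySingular σm ∧
    ∀ φ : ℝ → ℝ, ContDiff ℝ 1 φ → HasCompactSupport φ → tsupport φ ⊆ Ioi (0:ℝ) →
      (∫ r in Ioi (0:ℝ), ξ r * deriv φ r) = (∫ r, φ r ∂σm) - ∫ r, φ r ∂σp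

/-- The density `ξ'` of the absolutely continuous part of `Dξ = σp - σm`. -/
def acDeriv (σp σm : Measure ℝ) (r : ℝ) : ℝ :=
  (σp.rnDeriv volume r).toReal - (σm.rnDeriv volume r).toReal

/-- `p_E(r) = H^{n-2}(∂*E ∩ ∂B(0,r))` (as a real number). -/
def pSlice {n : ℕ} (E : Set (Euc n)) (r : ℝ) : ℝ :=
  (μH[(n : ℝ) - 2] (redBoundary E ∩ sphere (0 : Euc n) r)).toReal

/-- The projection `x ↦ x₁₂` onto the plane of the first two coordinates. -/
def pr12 {n : ℕ} (hn : 2 ≤ n) (x : Euc n) : Euc 2 :=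
  (EuclideanSpace.equiv (Fin 2) ℝ).symm fun i => x ⟨i.1, lt_of_lt_of_le i.2 hn⟩

/-- The projection `x ↦ x'` onto the remaining `n - 2` coordinates. -/
def prC {n : ℕ} (hn : 2 ≤ n) (x : Euc n) : Euc (n - 2) :=
  (EuclideanSpace.equiv (Fin (n - 2)) ℝ).symm fun i => x ⟨i.1 + 2, by have := i.2; omega⟩

/-- The circle `∂B((0,x'),r) ∩ Π_{x'}`, for `p = (r, x')`. -/
def circFiber {n : ℕ} (hn : 2 ≤ n) (p : ℝ × Euc (n - 2)) : Set (Euc n) :=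
  {y : Euc n | prC hn y = p.2 ∧ ‖pr12 hn y‖ = p.1}

/-- The circular slice `E_{(r,x')}`, for `p = (r, x')`. -/
def cslice {n : ℕ} (hn : 2 ≤ n) (E : Set (Euc n)) (p : ℝ × Euc (n - 2)) : Set (Euc n) :=
  E ∩ circFiber hn p

/-- `E` is circularly `ℓ`-distributed. -/
def CircDistrib {n : ℕ} (hn : 2 ≤ n) (ℓ : ℝ × Euc (n - 2) → ℝ) (E : Set (Euc n)) : Prop :=
  ∀ᵐ p ∂(volume.restrict ((Ioi (0:ℝ)) ×ˢ (univ : Set (Euc (n - 2))))),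
    μH[(1:ℝ)] (cslice hn E p) = ENNReal.ofReal (ℓ p)

/-- The circular symmetral `F^ℓ`. -/
def circSymm {n : ℕ} (hn : 2 ≤ n) (ℓ : ℝ × Euc (n - 2) → ℝ) : Set (Euc n) :=
  {x : Euc n | pr12 hn x ≠ 0 ∧
    Real.arccos ⟪hatv (pr12 hn x), e1 2 (by norm_num)⟫
      < ℓ (‖pr12 hn x‖, prC hn x) / (2 * ‖pr12 hn x‖)}

/-- `Φ₁₂(B × S¹)`, for `B ⊆ (0,∞) × ℝ^{n-2}`. -/
def cylSet {n : ℕ} (hn : 2 ≤ n) (B : Set (ℝ × Euc (n - 2))) : Set (Euc n) :=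
  {x : Euc n | pr12 hn x ≠ 0 ∧ (‖pr12 hn x‖, prC hn x) ∈ B}

/-- The component `ν₁₂∥^E(x) = ν₁₂^E(x) - (ν^E(x)·x̂₁₂)x̂₁₂` of the normal. -/
def nu12par {n : ℕ} (hn : 2 ≤ n) (E : Set (Euc n)) (x : Euc n) : Euc 2 :=
  pr12 hn (mtNormal E x) - ⟪pr12 hn (mtNormal E x), hatv (pr12 hn x)⟫ • hatv (pr12 hn x)

/-- Density (with value `t`) at `x` of a subset `A` of the circle `circFiber hn p`,
with respect to the measure `H¹` on that circle. -/
def CircDensityAt {n : ℕ} (hn : 2 ≤ n) (A : Set (Euc n)) (p : ℝ × Euc (n - 2)) (x : Euc n)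
    (t : ℝ≥0∞) : Prop :=
  Tendsto (fun ρ : ℝ => μH[(1:ℝ)] (A ∩ ball x ρ) / μH[(1:ℝ)] (circFiber hn p ∩ ball x ρ))
    (𝓝[>] (0:ℝ)) (𝓝 t)

/-- The essential boundary, within the circle `circFiber hn p`, of a subset `A`. -/
def circEssBoundary {n : ℕ} (hn : 2 ≤ n) (A : Set (Euc n)) (p : ℝ × Euc (n - 2)) :
    Set (Euc n) :=
  {x | x ∈ circFiber hn p ∧ ¬ CircDensityAt hn A p x 0 ∧ ¬ CircDensityAt hn A p x 1}

/-- `f` has locally bounded variation on the open set `Ω`: on every open `U` compactly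
contained in `Ω` the distributional gradient of `f` has finite total variation. -/
def BVlocOn {W : Type*} [NormedAddCommGroup W] [NormedSpace ℝ W] [MeasureSpace W]
    (f : W → ℝ) (Ω : Set W) : Prop :=
  LocallyIntegrableOn f Ω volume ∧
    ∀ U : Set W, IsOpen U → IsCompact (closure U) → closure U ⊆ Ω →
      ∃ C : ℝ, ∀ g : W → W, ContDiff ℝ 1 g → HasCompactSupport g → tsupport g ⊆ U →
        (∀ x, ‖g x‖ ≤ 1) →
        (∫ x in U, f x * LinearMap.trace ℝ W (fderiv ℝ g x).toLinearMap) ≤ C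

/-- `f ∈ W^{1,1}_loc(Ω)` for `Ω ⊆ (0,∞) × ℝ^m`: `f` has a locally integrable weak
gradient `(g1, g2)` on `Ω`. -/
def W11locProd {m : ℕ} (f : ℝ × Euc m → ℝ) (Ω : Set (ℝ × Euc m)) : Prop :=
  ∃ (g1 : ℝ × Euc m → ℝ) (g2 : ℝ × Euc m → Euc m),
    LocallyIntegrableOn f Ω volume ∧ LocallyIntegrableOn g1 Ω volume ∧
      LocallyIntegrableOn g2 Ω volume ∧
      ∀ φ : ℝ × Euc m → ℝ, ContDiff ℝ 1 φ → HasCompactSupport φ → tsupport φ ⊆ Ω →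
        ∀ y : ℝ × Euc m,
          (∫ x in Ω, f x * fderiv ℝ φ x y) = -∫ x in Ω, φ x * (g1 x * y.1 + ⟪g2 x, y.2⟫)

/-- A pair of mutually singular measures `(σp, σm)` supported in `Ω₀ = (0,∞) × ℝ^m`,
locally finite there, representing the partial distributional derivative
`D_r ξ = σp - σm` of `ξ` in the radial variable. -/
def RepDerivR {m : ℕ} (ξ : ℝ × Euc m → ℝ) (σp σm : Measure (ℝ × Euc m)) : Prop :=
  σp ((Ioi (0:ℝ)) ×ˢ (univ : Set (Euc m)))ᶜ = 0 ∧
    σm ((Ioi (0:ℝ)) ×ˢ (univ : Set (Euc m)))ᶜ = 0 ∧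
    (∀ K : Set (ℝ × Euc m), K ⊆ (Ioi (0:ℝ)) ×ˢ univ → IsCompact K → σp K < ⊤ ∧ σm K < ⊤) ∧
    σp.MutuallySingular σm ∧
    ∀ φ : ℝ × Euc m → ℝ, ContDiff ℝ 1 φ → HasCompactSupport φ →
      tsupport φ ⊆ (Ioi (0:ℝ)) ×ˢ (univ : Set (Euc m)) →
      (∫ x in (Ioi (0:ℝ)) ×ˢ (univ : Set (Euc m)), ξ x * fderiv ℝ φ x ((1:ℝ), (0 : Euc m)))
        = (∫ x, φ x ∂σm) - ∫ x, φ x ∂σp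

/-- A polar representation `(τ, h)` (with `‖h‖ = 1` `τ`-a.e.) of the distributional
gradient `D_{x'} f = h τ` of `f` in the `x'` variables, on `Ω₀ = (0,∞) × ℝ^m`. -/
def RepDerivX {m : ℕ} (f : ℝ × Euc m → ℝ) (τ : Measure (ℝ × Euc m))
    (h : ℝ × Euc m → Euc m) : Prop :=
  τ ((Ioi (0:ℝ)) ×ˢ (univ : Set (Euc m)))ᶜ = 0 ∧
    (∀ K : Set (ℝ × Euc m), K ⊆ (Ioi (0:ℝ)) ×ˢ univ → IsCompact K → τ K < ⊤) ∧
    (∀ᵐ x ∂τ, ‖h x‖ = 1) ∧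
    ∀ φ : ℝ × Euc m → ℝ, ContDiff ℝ 1 φ → HasCompactSupport φ →
      tsupport φ ⊆ (Ioi (0:ℝ)) ×ˢ (univ : Set (Euc m)) →
      ∀ y : Euc m,
        (∫ x in (Ioi (0:ℝ)) ×ˢ (univ : Set (Euc m)), f x * fderiv ℝ φ x ((0:ℝ), y))
          = -∫ x, φ x * ⟪h x, y⟫ ∂τ

/-- The barycentre function `b_E(r) = r^{1-n} ∫_{E_r} x̂ dH^{n-1}`. -/
def bary (n : ℕ) (E : Set (Euc n)) (r : ℝ) : Euc n :=
  (r ^ (n - 1))⁻¹ • ∫ x in E ∩ sphere (0 : Euc n) r, hatv x ∂μH[(n : ℝ) - 1]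

/-- The average direction `d_E(r)` of the slice `E_r`. -/
def avgDir (n : ℕ) (α : ℝ → ℝ) (E : Set (Euc n)) (r : ℝ) : Euc n :=
  (omegaBall (n - 1) * Real.sin (α r) ^ (n - 1) * r ^ (n - 1))⁻¹ •
    ∫ x in E ∩ sphere (0 : Euc n) r, hatv x ∂μH[(n : ℝ) - 1]

end

open MeasureTheory Metric Set Filter
open scoped ENNReal NNReal Topology RealInnerProductSpace

/-- zero density, in a convenient form -/
def zeroDens {n : ℕ} (E : Set (Euc n)) (x : Euc n) : Prop :=
  ∀ ε : ℝ, 0 < ε → ∀ᶠ ρ in 𝓝[>] (0:ℝ), volume (E ∩ ball x ρ) ≤ ENNReal.ofReal (ε * ρ ^ n)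

lemma vol_ball {n : ℕ} (x : Euc n) {r : ℝ} (hr : 0 < r) :
    volume (ball x r) = ENNReal.ofReal (r ^ n) * volume (ball (0 : Euc n) 1) := by
  have := Measure.addHaar_ball_of_pos (volume : Measure (Euc n)) x hr
  simpa using this

lemma omega_pos (n : ℕ) : 0 < omegaBall n := by
  unfold omegaBall
  exact ENNReal.toReal_pos (measure_ball_pos _ _ one_pos).ne' measure_ball_lt_top.ne

lemma vol_ball_real {n : ℕ} (x : Euc n) {r : ℝ} (hr : 0 < r) :
    volume (ball x r) = ENNReal.ofReal (omegaBall n * r ^ n) := by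
  rw [vol_ball x hr, mul_comm (omegaBall n), ENNReal.ofReal_mul (by positivity), omegaBall,
    ENNReal.ofReal_toReal measure_ball_lt_top.ne]

lemma densityAt_zero_iff {n : ℕ} (E : Set (Euc n)) (x : Euc n) :
    DensityAt E x 0 ↔ zeroDens E x := by
  unfold DensityAt zeroDens
  rw [ENNReal.tendsto_nhds_zero]
  constructor
  · intro h ε hε
    have hω := omega_pos n
    filter_upwards [h (ENNReal.ofReal (ε / omegaBall n)) (by simpa using by positivity),
      self_mem_nhdsWithin] with ρ h1 hρ
    have hρ' : 0 < ρ := hρ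
    rw [ENNReal.div_le_iff (measure_ball_pos _ _ hρ').ne' measure_ball_lt_top.ne,
      vol_ball_real x hρ', ← ENNReal.ofReal_mul (by positivity)] at h1
    refine h1.trans (le_of_eq ?_)
    congr 1
    field_simp
  · intro h ε hε
    have hω := omega_pos n
    by_cases htop : ε = ⊤
    · simp [htop]
    have hε' : 0 < ε.toReal := ENNReal.toReal_pos hε.ne' htop
    filter_upwards [h (ε.toReal * omegaBall n) (by positivity),
      self_mem_nhdsWithin] with ρ h1 hρ
    have hρ' : 0 < ρ := hρ
    rw [ENNReal.div_le_iff (measure_ball_pos _ _ hρ').ne' measure_ball_lt_top.ne]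
    refine h1.trans (le_of_eq ?_)
    rw [mul_assoc, ENNReal.ofReal_mul hε'.le, ENNReal.ofReal_toReal htop, vol_ball_real x hρ']

lemma densityAt_one_iff {n : ℕ} {E : Set (Euc n)} (hE : MeasurableSet E) (x : Euc n) :
    DensityAt E x 1 ↔ zeroDens Eᶜ x := by
  rw [← densityAt_zero_iff]
  have key : ∀ ρ : ℝ, 0 < ρ → volume (E ∩ ball x ρ) / volume (ball x ρ)
      + volume (Eᶜ ∩ ball x ρ) / volume (ball x ρ) = 1 := by
    intro ρ hρ
    rw [← ENNReal.add_div, inter_comm E, inter_comm Eᶜ, ← sdiff_eq, measure_inter_add_sdiff _ hE]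
    exact ENNReal.div_self (measure_ball_pos _ _ hρ).ne' measure_ball_lt_top.ne
  unfold DensityAt
  constructor
  · intro h
    have h2 := ENNReal.Tendsto.sub (tendsto_const_nhds (x := (1:ℝ≥0∞)) (f := 𝓝[>] (0:ℝ))) h
      (Or.inl ENNReal.one_ne_top)
    simp only [tsub_self] at h2
    refine h2.congr' ?_
    filter_upwards [self_mem_nhdsWithin] with ρ hρ
    rw [← key ρ hρ]
    refine ENNReal.add_sub_cancel_left ?_
    intro h3
    have := key ρ hρ
    rw [h3] at this
    simp at this
  · intro h
    have h2 := ENNReal.Tendsto.sub (tendsto_const_nhds (x := (1:ℝ≥0∞)) (f := 𝓝[>] (0:ℝ))) h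
      (Or.inl ENNReal.one_ne_top)
    simp only [tsub_zero] at h2
    refine h2.congr' ?_
    filter_upwards [self_mem_nhdsWithin] with ρ hρ
    rw [← key ρ hρ]
    refine ENNReal.add_sub_cancel_right ?_
    intro h3
    have := key ρ hρ
    rw [h3] at this
    simp at this

lemma mem_essBoundary_iff {n : ℕ} {E : Set (Euc n)} (hE : MeasurableSet E) (x : Euc n) :
    x ∈ essBoundary E ↔ ¬ zeroDens E x ∧ ¬ zeroDens Eᶜ x := by
  unfold essBoundary
  rw [mem_ofPred_eq, densityAt_zero_iff, densityAt_one_iff hE]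

lemma zeroDens.mono {n : ℕ} {E E' : Set (Euc n)} {x : Euc n} (h : zeroDens E x)
    (hs : E' ⊆ E) : zeroDens E' x := by
  intro ε hε
  filter_upwards [h ε hε] with ρ h1
  exact (measure_mono (inter_subset_inter_left _ hs)).trans h1

lemma zeroDens.union {n : ℕ} {E E' : Set (Euc n)} {x : Euc n} (h : zeroDens E x)
    (h' : zeroDens E' x) : zeroDens (E ∪ E') x := by
  intro ε hε
  filter_upwards [h (ε/2) (by positivity), h' (ε/2) (by positivity), self_mem_nhdsWithin]
    with ρ h1 h2 hρ
  have hρ' : 0 < ρ := hρ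
  rw [union_inter_distrib_right]
  refine (measure_union_le _ _).trans ((add_le_add h1 h2).trans ?_)
  rw [← ENNReal.ofReal_add (by positivity) (by positivity)]
  apply le_of_eq; congr 1; ring

lemma not_zeroDens_both {n : ℕ} {E : Set (Euc n)} {x : Euc n} (h : zeroDens E x)
    (h' : zeroDens Eᶜ x) : False := by
  have h3 := h.union h'
  rw [union_compl_self] at h3
  have hω := omega_pos n
  obtain ⟨ρ, h4, hρ⟩ := ((h3 (omegaBall n / 2) (by positivity)).and self_mem_nhdsWithin).exists
  have hρ' : 0 < ρ := hρ
  rw [univ_inter, vol_ball_real x hρ', ENNReal.ofReal_le_ofReal_iff (by positivity)] at h4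
  have : 0 < omegaBall n * ρ ^ n := by positivity
  nlinarith

lemma ae_zeroDens_compl {n : ℕ} {E : Set (Euc n)} (hE : MeasurableSet E) :
    ∀ᵐ x, x ∈ E → zeroDens Eᶜ x := by
  have h := Besicovitch.ae_tendsto_measure_inter_div (volume : Measure (Euc n)) E
  rw [ae_restrict_iff' hE] at h
  filter_upwards [h] with x hx hxE
  rw [← densityAt_one_iff hE]
  refine (hx hxE).congr' ?_
  filter_upwards [self_mem_nhdsWithin] with ρ hρ
  have hρ' : ρ ≠ 0 := (show (0:ℝ) < ρ from hρ).ne'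
  have h0 : volume (sphere x ρ) = 0 := Measure.addHaar_sphere_of_ne_zero _ x hρ'
  congr 1
  · apply measure_congr
    refine EventuallyEq.inter (ae_eq_refl _) ?_
    rw [← ball_union_sphere]
    exact union_ae_eq_left_of_ae_eq_empty (ae_eq_empty.2 h0)
  · apply measure_congr
    rw [← ball_union_sphere]
    exact union_ae_eq_left_of_ae_eq_empty (ae_eq_empty.2 h0)

lemma zeroDens_iff_dyadic {n : ℕ} (E : Set (Euc n)) (x : Euc n) :
    zeroDens E x ↔ ∀ j : ℕ, ∃ N : ℕ, ∀ k : ℕ, N ≤ k →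
      volume (E ∩ ball x ((1/2 : ℝ) ^ k)) ≤ ENNReal.ofReal ((1 / ((j:ℝ) + 1)) * ((1/2 : ℝ) ^ k) ^ n) := by
  constructor
  · intro h j
    have h1 := h (1 / ((j:ℝ) + 1)) (by positivity)
    have ht : Tendsto (fun k : ℕ => (1/2 : ℝ) ^ k) atTop (𝓝[>] 0) :=
      tendsto_pow_atTop_nhdsWithin_zero_of_lt_one (by norm_num) (by norm_num)
    have := ht.eventually h1
    exact eventually_atTop.1 this
  · intro h ε hε
    obtain ⟨j, hj⟩ := exists_nat_gt ((2:ℝ) ^ n / ε)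
    obtain ⟨N, hN⟩ := h j
    have hmem : Ioo (0:ℝ) ((1/2)^N) ∈ 𝓝[>] (0:ℝ) := Ioo_mem_nhdsGT (by positivity)
    filter_upwards [hmem] with ρ hρ
    obtain ⟨k, hk1, hk2⟩ := exists_nat_pow_near_of_lt_one hρ.1
      (hρ.2.le.trans (pow_le_one₀ (by norm_num) (by norm_num))) (by norm_num : (0:ℝ) < 1/2)
      (by norm_num)
    have hNk : N ≤ k := by
      by_contra hlt
      push Not at hlt
      have : (1/2:ℝ)^N ≤ (1/2)^(k+1) := pow_le_pow_of_le_one (by norm_num) (by norm_num) hlt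
      linarith [hρ.2]
    refine (measure_mono (inter_subset_inter_right _ (ball_subset_ball hk2))).trans
      ((hN k hNk).trans (ENNReal.ofReal_le_ofReal ?_))
    have h2 : ((1/2:ℝ)^k) ≤ 2 * ρ := by rw [pow_succ] at hk1; linarith
    calc 1 / ((j:ℝ) + 1) * ((1/2:ℝ)^k)^n ≤ 1 / ((j:ℝ) + 1) * (2 * ρ)^n := by gcongr
      _ = (2^n / ((j:ℝ)+1)) * ρ^n := by rw [mul_pow]; ring
      _ ≤ ε * ρ^n := by
        have := hρ.1
        gcongr
        rw [div_le_iff₀ (by positivity)]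
        rw [div_lt_iff₀ hε] at hj
        nlinarith

lemma measurable_vol_ball {n : ℕ} {E : Set (Euc n)} (hE : MeasurableSet E) (r : ℝ) :
    Measurable (fun x : Euc n => volume (E ∩ ball x r)) := by
  have hs : MeasurableSet {p : Euc n × Euc n | p.2 ∈ E ∧ dist p.2 p.1 < r} := by
    apply MeasurableSet.inter
    · exact measurable_snd hE
    · exact measurableSet_lt (measurable_snd.dist measurable_fst) measurable_const
  exact measurable_measure_prodMk_left hs

lemma measurableSet_zeroDens {n : ℕ} {E : Set (Euc n)} (hE : MeasurableSet E) :
    MeasurableSet {x | zeroDens E x} := by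
  simp only [zeroDens_iff_dyadic, ofPred_forall, ofPred_exists]
  refine MeasurableSet.iInter fun j => MeasurableSet.iUnion fun N => MeasurableSet.iInter fun k =>
    MeasurableSet.iInter fun _ => ?_
  exact measurableSet_le (measurable_vol_ball hE _) measurable_const

lemma measurableSet_essBoundary {n : ℕ} {E : Set (Euc n)} (hE : MeasurableSet E) :
    MeasurableSet (essBoundary E) := by
  have : essBoundary E = {x | zeroDens E x}ᶜ ∩ {x | zeroDens Eᶜ x}ᶜ := by
    ext x; rw [mem_essBoundary_iff hE]; rfl
  rw [this]
  exact (measurableSet_zeroDens hE).compl.inter (measurableSet_zeroDens hE.compl).compl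

lemma zeroDens_congr {n : ℕ} {E E' : Set (Euc n)} (h : E =ᵐ[volume] E') (x : Euc n) :
    zeroDens E x ↔ zeroDens E' x := by
  have : ∀ ρ, volume (E ∩ ball x ρ) = volume (E' ∩ ball x ρ) := fun ρ =>
    measure_congr (h.inter (ae_eq_refl _))
  simp [zeroDens, this]

lemma zeroDens_preimage {n : ℕ} {E : Set (Euc n)} (σ : Euc n ≃ₗᵢ[ℝ] Euc n) (x : Euc n) :
    zeroDens (σ ⁻¹' E) x ↔ zeroDens E (σ x) := by
  have : ∀ ρ, volume (σ ⁻¹' E ∩ ball x ρ) = volume (E ∩ ball (σ x) ρ) := fun ρ => by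
    have h1 : σ ⁻¹' E ∩ ball x ρ = σ.toMeasurableEquiv ⁻¹' (E ∩ ball (σ x) ρ) := by
      ext y; simp [dist_comm]
    rw [h1]
    exact σ.measurePreserving.measure_preimage_equiv (f := σ.toMeasurableEquiv) _
  simp [zeroDens, this]

/-- continuity lemma: if at all small scales `F` or its complement nearly fills nothing, then `x`
is not in the essential boundary -/
lemma zeroDens_or_of_min {n : ℕ} {F : Set (Euc n)} (hF : MeasurableSet F) (x : Euc n)
    (h : ∀ ε : ℝ, 0 < ε → ∀ᶠ r in 𝓝[>] (0:ℝ), volume (F ∩ ball x r) ≤ ENNReal.ofReal (ε * r ^ n) ∨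
      volume (Fᶜ ∩ ball x r) ≤ ENNReal.ofReal (ε * r ^ n)) : x ∉ essBoundary F := by
  rw [mem_essBoundary_iff hF]
  rintro ⟨h0, h1⟩
  have hω := omega_pos n
  have e0 := h (omegaBall n / 4) (by positivity)
  obtain ⟨r0, hr0, hall⟩ := mem_nhdsGT_iff_exists_Ioo_subset.1 e0
  have hr0' : (0:ℝ) < r0 := hr0
  set d : ℝ → ℝ := fun r => volume.real (F ∩ ball x r) / r ^ n with hd
  have hfin : ∀ (A : Set (Euc n)) r, volume (A ∩ ball x r) ≠ ⊤ := fun A r =>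
    ((measure_mono inter_subset_right).trans_lt measure_ball_lt_top).ne
  have hsum : ∀ r, 0 < r → volume.real (F ∩ ball x r) + volume.real (Fᶜ ∩ ball x r)
      = omegaBall n * r ^ n := by
    intro r hr
    have : volume.real (ball x r ∩ F) + volume.real (ball x r \ F) = volume.real (ball x r) :=
      measureReal_inter_add_sdiff hF measure_ball_lt_top.ne
    rw [inter_comm, sdiff_eq, inter_comm (ball x r) Fᶜ] at this
    rw [this, Measure.real, vol_ball_real x hr, ENNReal.toReal_ofReal (by positivity)]
  have hcont : ContinuousOn d (Ioo 0 r0) := by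
    refine ContinuousOn.div ?_ (by fun_prop) (fun r hr => (pow_pos hr.1 n).ne')
    -- Lipschitz-type control
    have hmono : ∀ a b, 0 < a → a ≤ b → |volume.real (F ∩ ball x b) - volume.real (F ∩ ball x a)|
        ≤ |omegaBall n * b ^ n - omegaBall n * a ^ n| := by
      intro a b ha hab
      have m1 : volume.real (F ∩ ball x a) ≤ volume.real (F ∩ ball x b) :=
        measureReal_mono (inter_subset_inter_right _ (ball_subset_ball hab)) (hfin _ _)
      have m2 : volume.real (Fᶜ ∩ ball x a) ≤ volume.real (Fᶜ ∩ ball x b) :=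
        measureReal_mono (inter_subset_inter_right _ (ball_subset_ball hab)) (hfin _ _)
      have s1 := hsum a ha
      have s2 := hsum b (ha.trans_le hab)
      rw [abs_of_nonneg (by linarith), abs_of_nonneg (by linarith)]
      linarith
    intro a ha
    have hc : Tendsto (fun b => |omegaBall n * b ^ n - omegaBall n * a ^ n|) (𝓝[Ioo 0 r0] a)
        (𝓝 0) := by
      have : ContinuousAt (fun b => |omegaBall n * b ^ n - omegaBall n * a ^ n|) a := by fun_prop
      have h2 := this.tendsto
      simp only [sub_self, abs_zero] at h2
      exact h2.mono_left nhdsWithin_le_nhds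
    rw [ContinuousWithinAt, tendsto_iff_dist_tendsto_zero]
    refine squeeze_zero' (Eventually.of_forall fun _ => dist_nonneg) ?_ hc
    filter_upwards [self_mem_nhdsWithin] with b hb
    rw [Real.dist_eq]
    rcases le_total a b with hab | hab
    · exact hmono a b ha.1 hab
    · rw [abs_sub_comm, abs_sub_comm (omegaBall n * b ^ n)]
      exact hmono b a hb.1 hab
  have toR : ∀ (A : Set (Euc n)) (ε r : ℝ), 0 < ε → 0 < r →
      (volume (A ∩ ball x r) ≤ ENNReal.ofReal (ε * r ^ n) ↔ volume.real (A ∩ ball x r) ≤ ε * r ^ n) := by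
    intro A ε r hε hr
    rw [Measure.real, ENNReal.le_ofReal_iff_toReal_le (hfin _ _) (by positivity)]
  have hside : (∀ r ∈ Ioo 0 r0, d r < omegaBall n / 2) ∨ (∀ r ∈ Ioo 0 r0, omegaBall n / 2 < d r) := by
    have hne : ∀ r ∈ Ioo 0 r0, d r ≠ omegaBall n / 2 := by
      intro r hr heq
      have hp : 0 < r ^ n := pow_pos hr.1 n
      have hs := hsum r hr.1
      have heq' : volume.real (F ∩ ball x r) = omegaBall n / 2 * r ^ n := by
        rw [hd] at heq
        simp only at heq
        rwa [div_eq_iff hp.ne'] at heq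
      rcases hall hr with h2 | h2
      · rw [toR _ _ _ (by positivity) hr.1] at h2
        nlinarith [mul_pos hω hp]
      · rw [toR _ _ _ (by positivity) hr.1] at h2
        nlinarith [mul_pos hω hp]
    by_contra hcon
    push Not at hcon
    obtain ⟨⟨a, ha, hda⟩, b, hb, hdb⟩ := hcon
    have := isPreconnected_Ioo.intermediate_value hb ha hcont ⟨hdb, hda⟩
    obtain ⟨r, hr, hr2⟩ := this
    exact hne r hr hr2
  have hmem : Ioo 0 r0 ∈ 𝓝[>] (0:ℝ) := Ioo_mem_nhdsGT hr0'
  rcases hside with hs | hs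
  · apply h0
    intro ε hε
    filter_upwards [h (min ε (omegaBall n / 4)) (by positivity), hmem] with r h2 hr
    have hp : 0 < r ^ n := pow_pos hr.1 n
    rcases h2 with h2 | h2
    · exact h2.trans (ENNReal.ofReal_le_ofReal (by gcongr; exact min_le_left _ _))
    · exfalso
      rw [toR _ _ _ (by positivity) hr.1] at h2
      have h3 := hs r hr
      rw [hd] at h3
      simp only at h3
      rw [div_lt_iff₀ hp] at h3
      have hs := hsum r hr.1
      have h4 : min ε (omegaBall n / 4) * r ^ n ≤ omegaBall n / 4 * r ^ n := by
        gcongr; exact min_le_right _ _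
      nlinarith [mul_pos hω hp]
  · apply h1
    intro ε hε
    filter_upwards [h (min ε (omegaBall n / 4)) (by positivity), hmem] with r h2 hr
    have hp : 0 < r ^ n := pow_pos hr.1 n
    rcases h2 with h2 | h2
    · exfalso
      rw [toR _ _ _ (by positivity) hr.1] at h2
      have h3 := hs r hr
      rw [hd] at h3
      simp only at h3
      rw [lt_div_iff₀ hp] at h3
      have h4 : min ε (omegaBall n / 4) * r ^ n ≤ omegaBall n / 4 * r ^ n := by
        gcongr; exact min_le_right _ _
      nlinarith [mul_pos hω hp]
    · exact h2.trans (ENNReal.ofReal_le_ofReal (by gcongr; exact min_le_left _ _))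

open MeasureTheory Metric Set Filter
open scoped ENNReal NNReal Topology RealInnerProductSpace

/-- the constant with `μH[m] = cH m • volume` on `Euc m`. -/
noncomputable def cH (m : ℕ) : ℝ≥0 :=
  Measure.addHaarScalarFactor (μH[(m:ℝ)] : Measure (Euc m)) volume

lemma hausdorff_eq (m : ℕ) : (μH[(m:ℝ)] : Measure (Euc m)) = cH m • volume :=
  Measure.isAddLeftInvariant_eq_smul _ _

lemma cH_pos (m : ℕ) : 0 < cH m := by
  rw [pos_iff_ne_zero]
  intro h
  have h1 := hausdorff_eq m
  rw [h, zero_smul] at h1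
  have h2 : (μH[(m:ℝ)] : Measure (Euc m)) (ball 0 1) ≠ 0 := (measure_ball_pos _ _ one_pos).ne'
  rw [h1] at h2
  exact h2 rfl

/-- splitting of space along a unit direction -/
structure Split (m : ℕ) (ν : Euc (m+1)) where
  e : Euc (m+1) ≃L[ℝ] ℝ × Euc m
  e_nu : e ν = (1, 0)
  norm_sq : ∀ x, ‖x‖ ^ 2 = (e x).1 ^ 2 + ‖(e x).2‖ ^ 2
  mp : MeasurePreserving e volume volume

noncomputable def splitAux (m : ℕ) : Euc (m+1) ≃ₗ[ℝ] ℝ × Euc m where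
  toFun x := (x 0, WithLp.toLp 2 fun i => x i.succ)
  invFun p := WithLp.toLp 2 (Fin.cons p.1 p.2)
  left_inv x := by
    ext i
    refine Fin.cases ?_ (fun i => ?_) i <;> simp
  right_inv p := by ext <;> simp
  map_add' x y := by ext <;> simp
  map_smul' c x := by ext <;> simp

lemma splitAux_mp (m : ℕ) : MeasurePreserving (splitAux m) volume volume := by
  have h1 := PiLp.volume_preserving_ofLp (Fin (m+1))
  have h2 := volume_preserving_piFinSuccAbove (fun _ : Fin (m+1) => ℝ) 0
  have h3 := (MeasurePreserving.id (volume : Measure ℝ)).prod (PiLp.volume_preserving_toLp (Fin m))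
  have h4 := h3.comp (h2.comp h1)
  have h5 : ⇑(splitAux m) = Prod.map id (WithLp.toLp 2) ∘
      ⇑(MeasurableEquiv.piFinSuccAbove (fun _ : Fin (m+1) => ℝ) 0) ∘ WithLp.ofLp := by
    funext x
    ext
    · rfl
    · simp [splitAux, MeasurableEquiv.piFinSuccAbove]
      rfl
  rw [h5]
  exact h4

lemma splitAux_norm (m : ℕ) (x : Euc (m+1)) :
    ‖x‖ ^ 2 = (splitAux m x).1 ^ 2 + ‖(splitAux m x).2‖ ^ 2 := by
  rw [EuclideanSpace.norm_sq_eq, EuclideanSpace.norm_sq_eq, Fin.sum_univ_succ]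
  simp [splitAux]

lemma exists_split {m : ℕ} (ν : Euc (m+1)) (hν : ‖ν‖ = 1) : Nonempty (Split m ν) := by
  have hor : Orthonormal ℝ (({0} : Set (Fin (m+1))).domRestrict (fun _ => ν)) := by
    constructor
    · rintro ⟨i, hi⟩; simpa using hν
    · rintro ⟨i, hi⟩ ⟨j, hj⟩ hij
      simp only [mem_singleton_iff] at hi hj
      subst hi; subst hj; exact absurd rfl hij
  obtain ⟨b, hb⟩ := hor.exists_orthonormalBasis_extension_of_card_eq (by simp)
  have hb0 : b 0 = ν := hb 0 (by simp)
  refine ⟨⟨b.repr.toContinuousLinearEquiv.trans (splitAux m).toContinuousLinearEquiv, ?_, ?_, ?_⟩⟩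
  · show splitAux m (b.repr ν) = (1, 0)
    rw [← hb0, b.repr_self]
    ext <;> simp [splitAux]
  · intro x
    have := splitAux_norm m (b.repr x)
    rwa [b.repr.norm_map] at this
  · exact (splitAux_mp m).comp b.repr.measurePreserving

namespace Split
variable {m : ℕ} {ν : Euc (m+1)} (S : Split m ν)

/-- the coordinate along the direction -/
noncomputable def τ : Euc (m+1) →L[ℝ] ℝ := (ContinuousLinearMap.fst ℝ ℝ (Euc m)).comp (S.e : Euc (m+1) →L[ℝ] ℝ × Euc m)
/-- the orthogonal coordinates -/
noncomputable def q : Euc (m+1) →L[ℝ] Euc m := (ContinuousLinearMap.snd ℝ ℝ (Euc m)).comp (S.e : Euc (m+1) →L[ℝ] ℝ × Euc m)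

lemma e_eq (x) : S.e x = (S.τ x, S.q x) := rfl
lemma norm_sq' (x) : ‖x‖ ^ 2 = (S.τ x) ^ 2 + ‖S.q x‖ ^ 2 := S.norm_sq x
@[simp] lemma τ_nu : S.τ ν = 1 := by have := S.e_nu; rw [e_eq] at this; exact congrArg Prod.fst this
@[simp] lemma q_nu : S.q ν = 0 := by have := S.e_nu; rw [e_eq] at this; exact congrArg Prod.snd this
lemma q_le (x) : ‖S.q x‖ ≤ ‖x‖ := by
  have := S.norm_sq' x
  exact le_of_sq_le_sq (by nlinarith [sq_nonneg (S.τ x)]) (norm_nonneg _)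
lemma τ_le (x) : |S.τ x| ≤ ‖x‖ := by
  have := S.norm_sq' x
  exact abs_le_of_sq_le_sq (by nlinarith [sq_nonneg (‖S.q x‖)]) (norm_nonneg _)
lemma norm_le (x) : ‖x‖ ≤ |S.τ x| + ‖S.q x‖ := by
  have := S.norm_sq' x
  refine le_of_sq_le_sq ?_ (by positivity)
  rw [this, ← sq_abs (S.τ x)]
  nlinarith [mul_nonneg (abs_nonneg (S.τ x)) (norm_nonneg (S.q x))]
lemma lipschitz_q : LipschitzWith 1 S.q :=
  LipschitzWith.of_dist_le_mul fun x y => by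
    rw [dist_eq_norm, dist_eq_norm, ← map_sub]; simpa using S.q_le (x - y)
lemma symm_τ (p) : S.τ (S.e.symm p) = p.1 := by
  have := congrArg Prod.fst (S.e.apply_symm_apply p); exact this
lemma symm_q (p) : S.q (S.e.symm p) = p.2 := by
  have := congrArg Prod.snd (S.e.apply_symm_apply p); exact this
lemma norm_nu {m : ℕ} {ν : Euc (m+1)} (S : Split m ν) : ‖ν‖ = 1 := by
  have := S.norm_sq' ν
  simp at this
  rcases this with h | h
  · exact h
  · linarith [norm_nonneg ν]
lemma vol_preimage (A : Set (ℝ × Euc m)) : volume (S.e ⁻¹' A) = volume A :=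
  S.mp.measure_preimage_equiv (f := S.e.toHomeomorph.toMeasurableEquiv) A
end Split

open MeasureTheory Metric Set Filter
open scoped ENNReal NNReal Topology RealInnerProductSpace

lemma baire_right {I O : Set ℝ} (hR : ∀ t ∈ I, ∀ δ > 0, ∃ s ∈ Ioo (0:ℝ) δ, t + s ∉ O)
    (hdisj : ∀ t, t ∈ I → t ∉ O)
    {z t : ℝ} (hzt : z ≤ t) (hz : z ∈ I) (h : ∀ s ∈ Icc z t, s ∈ I ∨ s ∈ interior O) : t ∈ I := by
  by_contra htI
  have hcl : IsClosed {s ∈ Icc z t | s ∉ interior O} :=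
    isClosed_Icc.inter isOpen_interior.isClosed_compl
  have hne : {s ∈ Icc z t | s ∉ interior O}.Nonempty :=
    ⟨z, ⟨le_refl _, hzt⟩, fun h => hdisj z hz (interior_subset h)⟩
  have hbdd : BddAbove {s ∈ Icc z t | s ∉ interior O} := ⟨t, fun s hs => hs.1.2⟩
  have hp := hcl.csSup_mem hne hbdd
  set p := sSup {s ∈ Icc z t | s ∉ interior O}
  have hpI : p ∈ I := (h p hp.1).resolve_right hp.2
  have hpt : p < t := lt_of_le_of_ne hp.1.2 (fun h => htI (h ▸ hpI))
  obtain ⟨s, hs, hsO⟩ := hR p hpI (t - p) (by linarith)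
  apply hsO
  by_contra hno
  have : p + s ≤ p := le_csSup hbdd ⟨⟨by linarith [hp.1.1, hs.1], by linarith [hs.2]⟩,
    fun h => hno (interior_subset h)⟩
  linarith [hs.1]

lemma baire_left {I O : Set ℝ} (hL : ∀ t ∈ I, ∀ δ > 0, ∃ s ∈ Ioo (0:ℝ) δ, t - s ∉ O)
    (hdisj : ∀ t, t ∈ I → t ∉ O)
    {z t : ℝ} (hzt : t ≤ z) (hz : z ∈ I) (h : ∀ s ∈ Icc t z, s ∈ I ∨ s ∈ interior O) : t ∈ I := by
  have hInteg : interior ((fun x : ℝ => -x) ⁻¹' O) = (fun x : ℝ => -x) ⁻¹' interior O :=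
    ((Homeomorph.neg ℝ).preimage_interior O).symm
  have := baire_right (I := (fun x : ℝ => -x) ⁻¹' I) (O := (fun x : ℝ => -x) ⁻¹' O) (z := -z) (t := -t)
    (by
      intro u hu δ hδ
      obtain ⟨s, hs, h2⟩ := hL (-u) hu δ hδ
      refine ⟨s, hs, ?_⟩
      simpa [sub_eq_add_neg, add_comm] using h2)
    (fun u hu => hdisj _ hu) (by linarith) (by simpa using hz)
    (by
      intro s hs
      rw [hInteg]
      exact h (-s) ⟨by linarith [hs.2], by linarith [hs.1]⟩)
  simpa using this

lemma baire_aux {I O : Set ℝ}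
    (hIR : ∀ t ∈ I, ∀ δ > 0, ∃ s ∈ Ioo (0:ℝ) δ, t + s ∉ O)
    (hIL : ∀ t ∈ I, ∀ δ > 0, ∃ s ∈ Ioo (0:ℝ) δ, t - s ∉ O)
    (hdisj : ∀ t, t ∈ I → t ∉ O) {z δ : ℝ} (hδ : 0 < δ) (hz : z ∈ (interior I ∪ interior O)ᶜ)
    (hU : ∀ s ∈ Ioo (z - δ) (z + δ), s ∈ (interior I ∪ interior O)ᶜ → s ∈ I) : False := by
  have hzI : z ∈ I := hU z ⟨by linarith, by linarith⟩ hz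
  have key : ∀ s ∈ Ioo (z - δ) (z + δ), s ∈ I ∨ s ∈ interior O := by
    intro s hs
    by_cases h : s ∈ interior I ∪ interior O
    · exact h.imp (fun h => interior_subset h) id
    · exact Or.inl (hU s hs h)
  apply hz
  left
  rw [mem_interior]
  refine ⟨Ioo (z - δ) (z + δ), ?_, isOpen_Ioo, by linarith, by linarith⟩
  intro t ht
  rcases le_total z t with h | h
  · exact baire_right hIR hdisj h hzI fun s hs => key s ⟨by linarith [hs.1], by linarith [hs.2, ht.2]⟩
  · exact baire_left hIL hdisj h hzI fun s hs => key s ⟨by linarith [hs.1, ht.1], by linarith [hs.2]⟩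

lemma baire_line {A B : ℕ → Set ℝ} (hA : ∀ k, IsClosed (A k)) (hB : ∀ k, IsClosed (B k))
    {I O : Set ℝ} (hI : I = ⋃ k, A k) (hO : O = ⋃ k, B k) (hcov : ∀ t, t ∈ I ∨ t ∈ O)
    (hdisj : ∀ t, t ∈ I → t ∉ O)
    (hIR : ∀ t ∈ I, ∀ δ > 0, ∃ s ∈ Ioo (0:ℝ) δ, t + s ∉ O)
    (hIL : ∀ t ∈ I, ∀ δ > 0, ∃ s ∈ Ioo (0:ℝ) δ, t - s ∉ O)
    (hOR : ∀ t ∈ O, ∀ δ > 0, ∃ s ∈ Ioo (0:ℝ) δ, t + s ∉ I)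
    (hOL : ∀ t ∈ O, ∀ δ > 0, ∃ s ∈ Ioo (0:ℝ) δ, t - s ∉ I)
    (hIne : I.Nonempty) (hOne : O.Nonempty) : False := by
  set Z : Set ℝ := (interior I ∪ interior O)ᶜ with hZ
  have hZc : IsClosed Z := (isOpen_interior.union isOpen_interior).isClosed_compl
  rcases Z.eq_empty_or_nonempty with hemp | hne
  · have hall : ∀ t, t ∈ interior I ∨ t ∈ interior O := by
      intro t
      by_contra h
      have : t ∈ Z := h
      rw [hemp] at this; exact this
    have hpre : IsPreconnected (univ : Set ℝ) := isPreconnected_univ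
    obtain ⟨t, -, h1, h2⟩ := hpre (interior I) (interior O) isOpen_interior isOpen_interior
      (fun t _ => hall t)
      (by
        obtain ⟨t, ht⟩ := hIne
        refine ⟨t, trivial, (hall t).resolve_right fun h => hdisj t ht (interior_subset h)⟩)
      (by
        obtain ⟨t, ht⟩ := hOne
        refine ⟨t, trivial, (hall t).resolve_left fun h => hdisj t (interior_subset h) ht⟩)
    exact hdisj t (interior_subset h1) (interior_subset h2)
  · have : Nonempty Z := hne.to_subtype
    have : CompleteSpace Z := hZc.completeSpace_coe
    let f : ℕ ⊕ ℕ → Set Z := Sum.elim (fun k => Subtype.val ⁻¹' A k) (fun k => Subtype.val ⁻¹' B k)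
    have hf : ∀ i, IsClosed (f i) := by
      rintro (k | k)
      · exact (hA k).preimage continuous_subtype_val
      · exact (hB k).preimage continuous_subtype_val
    have hfU : ⋃ i, f i = univ := by
      rw [eq_univ_iff_forall]
      intro t
      rcases hcov t with h | h
      · rw [hI] at h
        obtain ⟨k, hk⟩ := mem_iUnion.1 h
        exact mem_iUnion.2 ⟨Sum.inl k, hk⟩
      · rw [hO] at h
        obtain ⟨k, hk⟩ := mem_iUnion.1 h
        exact mem_iUnion.2 ⟨Sum.inr k, hk⟩
    obtain ⟨i, x, hx⟩ := nonempty_interior_of_iUnion_of_closed hf hfU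
    rw [mem_interior_iff_mem_nhds, Metric.mem_nhds_iff] at hx
    obtain ⟨δ, hδ, hball⟩ := hx
    have hU : ∀ s ∈ Ioo ((x:ℝ) - δ) (x + δ), ∀ hs : s ∈ Z, (⟨s, hs⟩ : Z) ∈ f i := by
      intro s hs hsZ
      apply hball
      rw [mem_ball, Subtype.dist_eq, Real.dist_eq, abs_lt]
      exact ⟨by show -δ < s - x; linarith [hs.1], by show s - x < δ; linarith [hs.2]⟩
    rcases i with k | k
    · refine baire_aux hIR hIL hdisj hδ x.2 fun s hs hsZ => ?_
      rw [hI]; exact mem_iUnion.2 ⟨k, hU s hs hsZ⟩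
    · refine baire_aux hOR hOL (fun t h h' => hdisj t h' h) hδ (by rw [union_comm]; exact x.2)
        fun s hs hsZ => ?_
      rw [hO]; exact mem_iUnion.2 ⟨k, hU s hs (by rw [hZ, union_comm]; exact hsZ)⟩

/-- segment version -/
lemma baire_segment {A B : ℕ → Set ℝ} (hA : ∀ k, IsClosed (A k)) (hB : ∀ k, IsClosed (B k))
    {I O : Set ℝ} {a b : ℝ} (hab : a < b) (hI : ∀ t ∈ Icc a b, t ∈ I ↔ ∃ k, t ∈ A k)
    (hO : ∀ t ∈ Icc a b, t ∈ O ↔ ∃ k, t ∈ B k)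
    (hcov : ∀ t ∈ Icc a b, t ∈ I ∨ t ∈ O)
    (hdisj : ∀ t, t ∈ I → t ∉ O)
    (hIR : ∀ t ∈ I, ∀ δ > 0, ∃ s ∈ Ioo (0:ℝ) δ, t + s ∉ O)
    (hIL : ∀ t ∈ I, ∀ δ > 0, ∃ s ∈ Ioo (0:ℝ) δ, t - s ∉ O)
    (hOR : ∀ t ∈ O, ∀ δ > 0, ∃ s ∈ Ioo (0:ℝ) δ, t + s ∉ I)
    (hOL : ∀ t ∈ O, ∀ δ > 0, ∃ s ∈ Ioo (0:ℝ) δ, t - s ∉ I)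
    (ha : a ∈ I) (hb : b ∈ O) : False := by
  have haO := hdisj a ha
  have hbI : b ∉ I := fun h => hdisj b h hb
  refine baire_line (A := fun k => (A k ∩ Icc a b) ∪ Iic a) (B := fun k => (B k ∩ Icc a b) ∪ Ici b)
    (I := (I ∩ Icc a b) ∪ Iic a) (O := (O ∩ Icc a b) ∪ Ici b)
    (fun k => ((hA k).inter isClosed_Icc).union isClosed_Iic)
    (fun k => ((hB k).inter isClosed_Icc).union isClosed_Ici) ?_ ?_ ?_ ?_ ?_ ?_ ?_ ?_
    ⟨a, Or.inr (mem_Iic.2 le_rfl)⟩ ⟨b, Or.inr (mem_Ici.2 le_rfl)⟩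
  · ext t
    simp only [mem_union, mem_inter_iff, mem_iUnion, mem_Iic]
    constructor
    · rintro (⟨h1, h2⟩ | h)
      · obtain ⟨k, hk⟩ := (hI t h2).1 h1
        exact ⟨k, Or.inl ⟨hk, h2⟩⟩
      · exact ⟨0, Or.inr h⟩
    · rintro ⟨k, ⟨h1, h2⟩ | h⟩
      · exact Or.inl ⟨(hI t h2).2 ⟨k, h1⟩, h2⟩
      · exact Or.inr h
  · ext t
    simp only [mem_union, mem_inter_iff, mem_iUnion, mem_Ici]
    constructor
    · rintro (⟨h1, h2⟩ | h)
      · obtain ⟨k, hk⟩ := (hO t h2).1 h1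
        exact ⟨k, Or.inl ⟨hk, h2⟩⟩
      · exact ⟨0, Or.inr h⟩
    · rintro ⟨k, ⟨h1, h2⟩ | h⟩
      · exact Or.inl ⟨(hO t h2).2 ⟨k, h1⟩, h2⟩
      · exact Or.inr h
  · intro t
    rcases lt_or_ge t a with h | h
    · exact Or.inl (Or.inr h.le)
    rcases lt_or_ge b t with h' | h'
    · exact Or.inr (Or.inr h'.le)
    · exact (hcov t ⟨h, h'⟩).imp (fun h2 => Or.inl ⟨h2, h, h'⟩) (fun h2 => Or.inl ⟨h2, h, h'⟩)
  · rintro t (⟨h1, h2⟩ | h) (⟨h3, h4⟩ | h')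
    · exact hdisj t h1 h3
    · have : t = b := le_antisymm h2.2 h'
      exact hbI (this ▸ h1)
    · have : t = a := le_antisymm h h4.1
      exact haO (this ▸ h3)
    · have h1 : t ≤ a := h
      have h2 : b ≤ t := h'
      linarith
  · -- I right
    intro t ht δ hδ
    have htI : t < a ∨ (t ∈ I ∧ t < b ∧ a ≤ t) := by
      rcases ht with ⟨h1, h2⟩ | h
      · right
        refine ⟨h1, lt_of_le_of_ne h2.2 (fun h => hbI (h ▸ h1)), h2.1⟩
      · rcases lt_or_eq_of_le (show t ≤ a from h) with h | h
        · exact Or.inl h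
        · right; subst h; exact ⟨ha, hab, le_rfl⟩
    rcases htI with h | ⟨h1, h2, h3⟩
    · refine ⟨min δ (a - t) / 2, ⟨by have := lt_min hδ (sub_pos.2 h); linarith, ?_⟩, ?_⟩
      · linarith [min_le_left δ (a - t), lt_min hδ (sub_pos.2 h)]
      · have := min_le_right δ (a - t)
        have h5 := lt_min hδ (sub_pos.2 h)
        rintro (⟨-, h6⟩ | h6)
        · linarith [h6.1]
        · have : b ≤ _ := h6
          linarith
    · obtain ⟨s, hs, hsO⟩ := hIR t h1 (min δ (b - t)) (lt_min hδ (sub_pos.2 h2))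
      refine ⟨s, ⟨hs.1, hs.2.trans_le (min_le_left _ _)⟩, ?_⟩
      have h5 := hs.2.trans_le (min_le_right _ _)
      rintro (⟨h6, -⟩ | h6)
      · exact hsO h6
      · have : b ≤ _ := h6
        linarith
  · -- I left
    intro t ht δ hδ
    rcases ht with ⟨h1, h2⟩ | h
    · obtain ⟨s, hs, hsO⟩ := hIL t h1 δ hδ
      refine ⟨s, hs, ?_⟩
      rintro (⟨h6, -⟩ | h6)
      · exact hsO h6
      · have : b ≤ _ := h6
        have := h2.2
        linarith [hs.1]
    · refine ⟨δ / 2, ⟨by linarith, by linarith⟩, ?_⟩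
      have h' : t ≤ a := h
      rintro (⟨-, h6⟩ | h6)
      · linarith [h6.1]
      · have : b ≤ _ := h6
        linarith
  · -- O right
    intro t ht δ hδ
    rcases ht with ⟨h1, h2⟩ | h
    · obtain ⟨s, hs, hsO⟩ := hOR t h1 δ hδ
      refine ⟨s, hs, ?_⟩
      rintro (⟨h6, -⟩ | h6)
      · exact hsO h6
      · have : _ ≤ a := h6
        have := h2.1
        linarith [hs.1]
    · refine ⟨δ / 2, ⟨by linarith, by linarith⟩, ?_⟩
      have h' : b ≤ t := h
      rintro (⟨-, h6⟩ | h6)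
      · linarith [h6.2]
      · have : _ ≤ a := h6
        linarith
  · -- O left
    intro t ht δ hδ
    have htO : b < t ∨ (t ∈ O ∧ a < t ∧ t ≤ b) := by
      rcases ht with ⟨h1, h2⟩ | h
      · right
        refine ⟨h1, lt_of_le_of_ne h2.1 (fun h => haO (h ▸ h1)), h2.2⟩
      · rcases lt_or_eq_of_le (show b ≤ t from h) with h | h
        · exact Or.inl h
        · right; subst h; exact ⟨hb, hab, le_rfl⟩
    rcases htO with h | ⟨h1, h2, h3⟩
    · refine ⟨min δ (t - b) / 2, ⟨by have := lt_min hδ (sub_pos.2 h); linarith, ?_⟩, ?_⟩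
      · linarith [min_le_left δ (t - b), lt_min hδ (sub_pos.2 h)]
      · have := min_le_right δ (t - b)
        have h5 := lt_min hδ (sub_pos.2 h)
        rintro (⟨-, h6⟩ | h6)
        · linarith [h6.2]
        · have : _ ≤ a := h6
          linarith
    · obtain ⟨s, hs, hsO⟩ := hOL t h1 (min δ (t - a)) (lt_min hδ (sub_pos.2 h2))
      refine ⟨s, ⟨hs.1, hs.2.trans_le (min_le_left _ _)⟩, ?_⟩
      have h5 := hs.2.trans_le (min_le_right _ _)
      rintro (⟨h6, -⟩ | h6)
      · exact hsO h6
      · have : _ ≤ a := h6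
        linarith

open MeasureTheory Metric Set Filter
open scoped ENNReal NNReal Topology RealInnerProductSpace

/-- reversed splitting -/
noncomputable def Split.neg {m : ℕ} {ν : Euc (m+1)} (S : Split m ν) : Split m (-ν) where
  e := S.e.trans ((ContinuousLinearEquiv.neg ℝ (M := ℝ)).prodCongr (ContinuousLinearEquiv.refl ℝ (Euc m)))
  e_nu := by
    show ((-(S.e (-ν)).1 : ℝ), (S.e (-ν)).2) = (1, 0)
    rw [map_neg, S.e_nu]; simp
  norm_sq x := by
    show ‖x‖ ^ 2 = (-(S.e x).1) ^ 2 + ‖(S.e x).2‖ ^ 2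
    rw [neg_sq]; exact S.norm_sq x
  mp := by
    have h : MeasurePreserving (Prod.map (fun x : ℝ => -x) (id : Euc m → Euc m)) volume volume :=
      (Measure.measurePreserving_neg (volume : Measure ℝ)).prod (MeasurePreserving.id _)
    exact h.comp S.mp

lemma Split.neg_q {m : ℕ} {ν : Euc (m+1)} (S : Split m ν) (x) : S.neg.q x = S.q x := rfl

lemma vol_zeroDens_inter {n : ℕ} {E : Set (Euc n)} (hE : MeasurableSet E) :
    volume ({x | zeroDens E x} ∩ E) = 0 := by
  have h := ae_zeroDens_compl hE
  refine measure_mono_null ?_ h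
  rintro x ⟨h1, h2⟩ h3
  exact not_zeroDens_both h1 (h3 h2)

/-- key density argument -/
lemma null_piece {m : ℕ} {ν : Euc (m+1)} (S : Split m ν) {E : Set (Euc (m+1))}
    (hE : MeasurableSet E) {G : Set (Euc (m+1))} {ρ κ : ℝ} (hρ : 0 < ρ)
    (hκ : κ * 3 ^ (m+2) ≤ omegaBall m)
    (h1 : ∀ x ∈ G, ∀ r ∈ Ioo 0 (3 * ρ), volume (Eᶜ ∩ ball x r) ≤ ENNReal.ofReal (κ * r ^ (m+1)))
    (h2 : ∀ x ∈ G, ∀ s ∈ Ioo 0 (3 * ρ), zeroDens E (x + s • ν))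
    (h3 : ∀ x ∈ G, ∀ y ∈ G, S.τ x ≤ S.τ y + ρ) : volume (S.q '' G) = 0 := by
  by_contra hne
  have hne' : (volume : Measure (Euc m)).restrict (S.q '' G) ≠ 0 := by
    rwa [Ne, Measure.restrict_eq_zero]
  have : (ae ((volume : Measure (Euc m)).restrict (S.q '' G))).NeBot := ae_neBot.2 hne'
  obtain ⟨z, hz⟩ := (Besicovitch.ae_tendsto_measure_inter_div (volume : Measure (Euc m))
    (S.q '' G)).exists
  have hω := omega_pos m
  have e1 := hz.eventually (lt_mem_nhds (show ENNReal.ofReal (2/3) < 1 by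
    rw [ENNReal.ofReal_lt_one]; norm_num))
  obtain ⟨r, hr1, hr2⟩ := (e1.and (Ioo_mem_nhdsGT hρ)).exists
  have hr0 : 0 < r := hr2.1
  set W := S.q '' G ∩ closedBall z r with hW
  have hWvol : ENNReal.ofReal (2/3 * (omegaBall m * r ^ m)) < volume W := by
    have hb0 : volume (closedBall z r) ≠ 0 := (measure_closedBall_pos _ _ hr0).ne'
    rw [ENNReal.lt_div_iff_mul_lt (Or.inl hb0) (Or.inl measure_closedBall_lt_top.ne)] at hr1
    refine lt_of_le_of_lt ?_ hr1
    rw [ENNReal.ofReal_mul (by norm_num), ← vol_ball_real z hr0]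
    gcongr
    exact ball_subset_closedBall
  have hWne : W.Nonempty := by
    by_contra h
    rw [not_nonempty_iff_eq_empty] at h
    rw [h] at hWvol; simp at hWvol
  set P := {t : ℝ | ∃ x ∈ G, S.q x ∈ closedBall z r ∧ S.τ x = t} with hP
  have hPne : P.Nonempty := by
    obtain ⟨w, ⟨x, hx, rfl⟩, hw⟩ := hWne
    exact ⟨S.τ x, x, hx, hw, rfl⟩
  have hPb : BddAbove P := by
    obtain ⟨t, x, hx, hxw, rfl⟩ := hPne
    refine ⟨S.τ x + ρ, ?_⟩
    rintro _ ⟨y, hy, -, rfl⟩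
    exact h3 y hy x hx
  obtain ⟨_, ⟨b, hb, hbz, rfl⟩, hbt⟩ := exists_lt_of_lt_csSup hPne
    (show sSup P - r/2 < sSup P by linarith)
  have hsub : S.e ⁻¹' (Ico (S.τ b + r/2) (S.τ b + r) ×ˢ W) ⊆
      {x | zeroDens E x} ∩ ball b (3 * r) := by
    rintro y ⟨hy1, hy2⟩
    have hy1' : S.τ y ∈ Ico (S.τ b + r/2) (S.τ b + r) := hy1
    have hy2' : S.q y ∈ W := hy2
    obtain ⟨⟨x, hx, hxy⟩, hyz⟩ := hy2'
    constructor
    · have hxs : S.τ x ≤ sSup P := le_csSup hPb ⟨x, hx, hxy ▸ hyz, rfl⟩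
      have heq : y = x + (S.τ y - S.τ x) • ν := by
        apply S.e.injective
        rw [S.e_eq, S.e_eq]
        simp [hxy]
      have := h2 x hx (S.τ y - S.τ x) ⟨by linarith [hy1'.1], by linarith [hy1'.2, hr2.2, h3 b hb x hx]⟩
      rw [← heq] at this
      exact this
    · rw [mem_ball, dist_eq_norm]
      refine (S.norm_le _).trans_lt ?_
      rw [map_sub, map_sub, abs_of_nonneg (by linarith [hy1'.1])]
      have : ‖S.q y - S.q b‖ ≤ 2 * r := by
        rw [← dist_eq_norm]
        have h4 : dist (S.q y) z ≤ r := hyz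
        have h5 : dist (S.q b) z ≤ r := hbz
        linarith [dist_triangle_right (S.q y) (S.q b) z]
      linarith [hy1'.2]
  have hvol1 : volume (S.e ⁻¹' (Ico (S.τ b + r/2) (S.τ b + r) ×ˢ W)) =
      ENNReal.ofReal (r/2) * volume W := by
    rw [S.vol_preimage]
    rw [Measure.volume_eq_prod, Measure.prod_prod, Real.volume_Ico]
    congr 2; ring
  have hvol2 : volume ({x | zeroDens E x} ∩ ball b (3 * r)) ≤ ENNReal.ofReal (κ * (3 * r) ^ (m+1)) := by
    refine le_trans ?_ (h1 b hb (3 * r) ⟨by linarith, by linarith [hr2.2]⟩)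
    have hsub2 : {x | zeroDens E x} ∩ ball b (3 * r) ⊆
        (Eᶜ ∩ ball b (3 * r)) ∪ ({x | zeroDens E x} ∩ E) := by
      rintro y ⟨hy1, hy2⟩
      by_cases h : y ∈ E
      · exact Or.inr ⟨hy1, h⟩
      · exact Or.inl ⟨h, hy2⟩
    refine (measure_mono hsub2).trans ((measure_union_le _ _).trans ?_)
    rw [vol_zeroDens_inter hE, add_zero]
  have hfin := hvol1 ▸ (measure_mono hsub).trans hvol2
  have hlt : ENNReal.ofReal (r/2) * ENNReal.ofReal (2/3 * (omegaBall m * r ^ m)) <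
      ENNReal.ofReal (r/2) * volume W :=
    ENNReal.mul_lt_mul_right (by simpa using hr0) (by simp) hWvol
  have hcon := hlt.trans_le hfin
  rw [← ENNReal.ofReal_mul (by positivity)] at hcon
  apply absurd hcon
  rw [not_lt]
  apply ENNReal.ofReal_le_ofReal
  have : κ * (3 * r) ^ (m+1) = (κ * 3 ^ (m+2)) * r ^ (m+1) / 3 := by rw [mul_pow]; ring
  rw [this]
  have : r / 2 * (2/3 * (omegaBall m * r ^ m)) = omegaBall m * r ^ (m+1) / 3 := by ring
  rw [this]
  gcongr

lemma null_onesided {m : ℕ} {ν : Euc (m+1)} (S : Split m ν) {E : Set (Euc (m+1))}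
    (hE : MeasurableSet E) :
    volume (S.q '' {x | zeroDens Eᶜ x ∧ ∃ δ > 0, ∀ s ∈ Ioo (0:ℝ) δ, zeroDens E (x + s • ν)}) = 0 := by
  have hω := omega_pos m
  set κ : ℝ := omegaBall m / 3 ^ (m+2) with hκ
  let G : ℕ → ℤ → Set (Euc (m+1)) := fun k j => {x |
    (∀ r ∈ Ioo (0:ℝ) (3 * (1/((k:ℝ)+1))), volume (Eᶜ ∩ ball x r) ≤ ENNReal.ofReal (κ * r ^ (m+1))) ∧
    (∀ s ∈ Ioo (0:ℝ) (3 * (1/((k:ℝ)+1))), zeroDens E (x + s • ν)) ∧ ⌊S.τ x * ((k:ℝ)+1)⌋ = j}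
  have hG : ∀ k j, volume (S.q '' G k j) = 0 := by
    intro k j
    refine null_piece S hE (ρ := 1/((k:ℝ)+1)) (κ := κ) (by positivity) ?_ (fun x hx => hx.1)
      (fun x hx => hx.2.1) ?_
    · rw [hκ, div_mul_cancel₀]; positivity
    · intro x hx y hy
      have hx1 : S.τ x * ((k:ℝ)+1) < j + 1 := by
        have := Int.lt_floor_add_one (S.τ x * ((k:ℝ)+1)); rwa [hx.2.2] at this
      have hy1 : (j:ℝ) ≤ S.τ y * ((k:ℝ)+1) := by
        have := Int.floor_le (S.τ y * ((k:ℝ)+1)); rwa [hy.2.2] at this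
      have hk : (0:ℝ) < (k:ℝ)+1 := by positivity
      rw [← mul_le_mul_iff_left₀ hk, add_mul, one_div, inv_mul_cancel₀ hk.ne']
      linarith
  refine measure_mono_null ?_ (measure_iUnion_null fun k => measure_iUnion_null fun j => hG k j)
  rintro _ ⟨x, ⟨hx1, δ, hδ, hx2⟩, rfl⟩
  obtain ⟨ε, hε, hx3⟩ := mem_nhdsGT_iff_exists_Ioo_subset.1 (hx1 κ (by positivity))
  have hε' : (0:ℝ) < ε := hε
  obtain ⟨k, hk⟩ := exists_nat_one_div_lt (show 0 < min δ ε / 3 by positivity)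
  refine mem_iUnion.2 ⟨k, mem_iUnion.2 ⟨⌊S.τ x * ((k:ℝ)+1)⌋, x, ⟨?_, ?_, rfl⟩, rfl⟩⟩
  · intro r hr
    exact hx3 ⟨hr.1, by linarith [hr.2, min_le_right δ ε]⟩
  · intro s hs
    exact hx2 s ⟨hs.1, by linarith [hs.2, min_le_left δ ε]⟩

lemma isClosed_dens {n : ℕ} (E : Set (Euc n)) {κ δ : ℝ} (hκ : 0 ≤ κ) :
    IsClosed {x : Euc n | ∀ r ∈ Ioo 0 δ, volume (E ∩ ball x r) ≤ ENNReal.ofReal (κ * r ^ n)} := by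
  rw [← isSeqClosed_iff_isClosed]
  intro u x hu hux r hr
  have key : ∀ r' ∈ Ioo r δ, volume (E ∩ ball x r) ≤ ENNReal.ofReal (κ * r' ^ n) := by
    intro r' hr'
    obtain ⟨j, hj⟩ := (Metric.tendsto_nhds.1 hux (r' - r) (by linarith [hr'.1])).exists
    refine le_trans (measure_mono (inter_subset_inter_right _ ?_))
      (hu j r' ⟨hr.1.trans hr'.1, hr'.2⟩)
    intro y hy
    rw [mem_ball] at hy ⊢
    rw [dist_comm] at hj
    linarith [dist_triangle y x (u j)]
  have hc : ContinuousWithinAt (fun r' : ℝ => ENNReal.ofReal (κ * r' ^ n)) (Ioi r) r := by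
    apply Continuous.continuousWithinAt
    exact ENNReal.continuous_ofReal.comp (by fun_prop)
  refine ge_of_tendsto hc ?_
  filter_upwards [Ioo_mem_nhdsGT hr.2] with r' hr'
  exact key r' hr'

open MeasureTheory Metric Set Filter
open scoped ENNReal NNReal Topology RealInnerProductSpace

/-- the exceptional null set of lines -/
def badLines {m : ℕ} {ν : Euc (m+1)} (S : Split m ν) (E : Set (Euc (m+1))) : Set (Euc m) :=
  (S.q '' {x | zeroDens Eᶜ x ∧ ∃ δ > 0, ∀ s ∈ Ioo (0:ℝ) δ, zeroDens E (x + s • ν)}) ∪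
  (S.q '' {x | zeroDens Eᶜ x ∧ ∃ δ > 0, ∀ s ∈ Ioo (0:ℝ) δ, zeroDens E (x + s • (-ν))}) ∪
  (S.q '' {x | zeroDens E x ∧ ∃ δ > 0, ∀ s ∈ Ioo (0:ℝ) δ, zeroDens Eᶜ (x + s • ν)}) ∪
  (S.q '' {x | zeroDens E x ∧ ∃ δ > 0, ∀ s ∈ Ioo (0:ℝ) δ, zeroDens Eᶜ (x + s • (-ν))})

lemma badLines_null {m : ℕ} {ν : Euc (m+1)} (S : Split m ν) {E : Set (Euc (m+1))}
    (hE : MeasurableSet E) : volume (badLines S E) = 0 := by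
  have h1 := null_onesided S hE
  have h2 := null_onesided S.neg hE
  have h3 := null_onesided S hE.compl
  have h4 := null_onesided S.neg hE.compl
  rw [compl_compl] at h3 h4
  refine measure_union_null (measure_union_null (measure_union_null h1 h2) h3) h4

lemma cross_aux {m : ℕ} {ν : Euc (m+1)} (S : Split m ν) {E : Set (Euc (m+1))}
    (hE : MeasurableSet E) {p : Euc (m+1)} (hp : S.q p ∉ badLines S E) {a b : ℝ} (hab : a < b)
    (hno : ∀ s ∈ Icc a b, p + s • ν ∉ essBoundary E) (ha : zeroDens Eᶜ (p + a • ν))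
    (hb : zeroDens E (p + b • ν)) : False := by
  have hω := omega_pos (m+1)
  set κ := omegaBall (m+1) / 4 with hκ
  have hκ0 : 0 < κ := by positivity
  let A : Set (Euc (m+1)) → ℕ → Set ℝ := fun X k => (fun t : ℝ => p + t • ν) ⁻¹'
    {x | ∀ r ∈ Ioo (0:ℝ) (1/((k:ℝ)+1)), volume (X ∩ ball x r) ≤ ENNReal.ofReal (κ * r ^ (m+1))}
  have hAcl : ∀ X k, IsClosed (A X k) := fun X k =>
    (isClosed_dens X hκ0.le).preimage (by fun_prop)
  have hA1 : ∀ X t, zeroDens X (p + t • ν) → ∃ k, t ∈ A X k := by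
    intro X t h
    obtain ⟨ε, hε, hx3⟩ := mem_nhdsGT_iff_exists_Ioo_subset.1 (h κ hκ0)
    obtain ⟨k, hk⟩ := exists_nat_one_div_lt (show (0:ℝ) < ε from hε)
    exact ⟨k, fun r hr => hx3 ⟨hr.1, hr.2.trans hk⟩⟩
  have hA2 : ∀ X t k, MeasurableSet X → t ∈ A X k → ¬ zeroDens Xᶜ (p + t • ν) := by
    intro X t k hX hk h
    obtain ⟨r, h1, h2⟩ := ((h κ hκ0).and (Ioo_mem_nhdsGT
      (show (0:ℝ) < 1/((k:ℝ)+1) by positivity))).exists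
    have h3 := hk r h2
    have h4 : volume (ball (p + t • ν) r) ≤ _ :=
      (measure_mono (show ball (p + t • ν) r ⊆ (X ∩ ball (p + t • ν) r) ∪ (Xᶜ ∩ ball (p + t • ν) r) by
        rw [← union_inter_distrib_right, union_compl_self, univ_inter])).trans
      ((measure_union_le _ _).trans (add_le_add h3 h1))
    have hrp : 0 < r ^ (m+1) := pow_pos h2.1 _
    rw [vol_ball_real _ h2.1, ← ENNReal.ofReal_add (by positivity) (by positivity),
      ENNReal.ofReal_le_ofReal_iff (by positivity), hκ] at h4
    nlinarith [mul_pos hω hrp]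
  have hcov : ∀ t ∈ Icc a b, zeroDens Eᶜ (p + t • ν) ∨ zeroDens E (p + t • ν) := by
    intro t ht
    have := hno t ht
    rw [mem_essBoundary_iff hE] at this
    tauto
  have hq : ∀ t : ℝ, S.q (p + t • ν) = S.q p := by intro t; simp
  refine baire_segment (A := A Eᶜ) (B := A E) (I := {t | zeroDens Eᶜ (p + t • ν)})
    (O := {t | zeroDens E (p + t • ν)}) (fun k => hAcl _ k) (fun k => hAcl _ k) hab ?_ ?_ hcov
    ?_ ?_ ?_ ?_ ?_ ha hb
  · intro t ht
    refine ⟨hA1 _ t, ?_⟩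
    rintro ⟨k, hk⟩
    refine (hcov t ht).resolve_right ?_
    have := hA2 _ t k hE.compl hk
    rwa [compl_compl] at this
  · intro t ht
    refine ⟨hA1 _ t, ?_⟩
    rintro ⟨k, hk⟩
    exact (hcov t ht).resolve_left (hA2 _ t k hE hk)
  · exact fun t h h' => not_zeroDens_both h' h
  · intro t ht δ hδ
    by_contra hcon
    push Not at hcon
    refine hp (Or.inl (Or.inl (Or.inl ⟨p + t • ν, ⟨ht, δ, hδ, fun s hs => ?_⟩, hq t⟩)))
    have := hcon s hs
    rwa [mem_ofPred_eq, add_smul, ← add_assoc] at this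
  · intro t ht δ hδ
    by_contra hcon
    push Not at hcon
    refine hp (Or.inl (Or.inl (Or.inr ⟨p + t • ν, ⟨ht, δ, hδ, fun s hs => ?_⟩, hq t⟩)))
    have := hcon s hs
    rwa [mem_ofPred_eq, sub_eq_add_neg, add_smul, ← add_assoc, neg_smul, ← smul_neg] at this
  · intro t ht δ hδ
    by_contra hcon
    push Not at hcon
    refine hp (Or.inl (Or.inr ⟨p + t • ν, ⟨ht, δ, hδ, fun s hs => ?_⟩, hq t⟩))
    have := hcon s hs
    rwa [mem_ofPred_eq, add_smul, ← add_assoc] at this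
  · intro t ht δ hδ
    by_contra hcon
    push Not at hcon
    refine hp (Or.inr ⟨p + t • ν, ⟨ht, δ, hδ, fun s hs => ?_⟩, hq t⟩)
    have := hcon s hs
    rwa [mem_ofPred_eq, sub_eq_add_neg, add_smul, ← add_assoc, neg_smul, ← smul_neg] at this

lemma essBoundary_compl {n : ℕ} {E : Set (Euc n)} (hE : MeasurableSet E) :
    essBoundary Eᶜ = essBoundary E := by
  ext x
  rw [mem_essBoundary_iff hE, mem_essBoundary_iff hE.compl, compl_compl]
  tauto

lemma badLines_compl {m : ℕ} {ν : Euc (m+1)} (S : Split m ν) (E : Set (Euc (m+1))) :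
    badLines S Eᶜ = badLines S E := by
  unfold badLines
  rw [compl_compl]
  ext z
  simp only [mem_union]
  tauto

lemma ae_shift {n : ℕ} {P : Euc n → Prop} (h : ∀ᵐ x, P x) (v : Euc n) : ∀ᵐ x, P (x + v) :=
  (measurePreserving_add_right volume v).quasiMeasurePreserving.ae h

lemma ae_cross {m : ℕ} {ν : Euc (m+1)} (S : Split m ν) {E : Set (Euc (m+1))}
    (hE : MeasurableSet E) {h : ℝ} (hh : 0 < h) :
    ∀ᵐ p : Euc (m+1), ¬ (p ∈ E ↔ p + h • ν ∈ E) → ∃ s ∈ Icc 0 h, p + s • ν ∈ essBoundary E := by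
  have hnull : ∀ᵐ p : Euc (m+1), S.q p ∉ badLines S E := by
    rw [ae_iff]
    have : {a | ¬ S.q a ∉ badLines S E} = S.e ⁻¹' (univ ×ˢ badLines S E) := by
      ext x; simp [S.e_eq]
    rw [this, S.vol_preimage, Measure.volume_eq_prod, Measure.prod_prod, badLines_null S hE, mul_zero]
  have g1 := ae_zeroDens_compl hE
  have g2 := ae_zeroDens_compl hE.compl
  rw [compl_compl] at g2
  filter_upwards [hnull, g1, g2, ae_shift g1 (h • ν), ae_shift g2 (h • ν)] with p h0 h1 h2 h3 h4 hne
  by_contra hcon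
  push Not at hcon
  by_cases hpE : p ∈ E
  · have hE2 : p + h • ν ∉ E := fun h' => hne ⟨fun _ => h', fun _ => hpE⟩
    exact cross_aux S hE h0 hh hcon (by simpa using h1 hpE) (h4 hE2)
  · have hE2 : p + h • ν ∈ E := by
      by_contra h'
      exact hne ⟨fun h => absurd h hpE, fun h => absurd h h'⟩
    refine cross_aux S hE.compl (by rwa [badLines_compl]) hh
      (by rwa [essBoundary_compl hE]) (by simpa using h2 hpE) (h3 hE2)

/-- tube estimate for a small piece -/
lemma tube_piece {m : ℕ} {ν : Euc (m+1)} (S : Split m ν) {A : Set (Euc (m+1))}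
    {h δ : ℝ} (hdiam : ∀ x ∈ A, ∀ y ∈ A, dist x y ≤ δ) :
    cH m * volume {p : Euc (m+1) | ∃ s ∈ Icc 0 h, p + s • ν ∈ A} ≤
      ENNReal.ofReal (h + 2 * δ) * μH[(m:ℝ)] A := by
  rcases A.eq_empty_or_nonempty with rfl | ⟨x0, hx0⟩
  · simp
  have hsub : {p : Euc (m+1) | ∃ s ∈ Icc 0 h, p + s • ν ∈ A} ⊆
      S.e ⁻¹' (Icc (S.τ x0 - δ - h) (S.τ x0 + δ) ×ˢ (S.q '' A)) := by
    rintro p ⟨s, hs, hp⟩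
    have h1 : |S.τ (p + s • ν - x0)| ≤ δ := (S.τ_le _).trans (by
      rw [← dist_eq_norm]; exact hdiam _ hp _ hx0)
    rw [map_sub, map_add, map_smul, S.τ_nu, smul_eq_mul, mul_one, abs_le] at h1
    refine ⟨⟨?_, ?_⟩, p + s • ν, hp, ?_⟩
    · show _ ≤ S.τ p; linarith [hs.1, hs.2]
    · show S.τ p ≤ _; linarith [hs.1, hs.2]
    · show S.q _ = S.q p; simp
  have h2 : volume {p : Euc (m+1) | ∃ s ∈ Icc 0 h, p + s • ν ∈ A} ≤
      ENNReal.ofReal (h + 2 * δ) * volume (S.q '' A) := by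
    refine (measure_mono hsub).trans ?_
    rw [S.vol_preimage, Measure.volume_eq_prod, Measure.prod_prod, Real.volume_Icc]
    apply le_of_eq
    congr 2; ring
  have h3 : (cH m : ℝ≥0∞) * volume (S.q '' A) ≤ μH[(m:ℝ)] A := by
    have h4 : μH[(m:ℝ)] (S.q '' A) = cH m * volume (S.q '' A) := by rw [hausdorff_eq]; rfl
    rw [← h4]
    have := S.lipschitz_q.hausdorffMeasure_image_le (d := (m:ℝ)) (by positivity) A
    simpa using this
  calc _ ≤ cH m * (ENNReal.ofReal (h + 2 * δ) * volume (S.q '' A)) := by gcongr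
    _ = ENNReal.ofReal (h + 2 * δ) * (cH m * volume (S.q '' A)) := by ring
    _ ≤ _ := by gcongr

lemma tube_bound {m : ℕ} {ν : Euc (m+1)} (S : Split m ν) {A : Set (Euc (m+1))}
    (hA : MeasurableSet A) {h δ : ℝ} (hh : 0 ≤ h) (hd : 0 < δ) {φ : Euc (m+1) → ℝ} {L : ℝ≥0}
    (hφ : LipschitzWith L φ) {D : Set (Euc (m+1))}
    (hD : ∀ᵐ p, p ∈ D → ∃ s ∈ Icc 0 h, p + s • ν ∈ A) :
    cH m * ∫⁻ p in D, ENNReal.ofReal |φ p| ≤ ENNReal.ofReal (h + 2 * δ) *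
      ∫⁻ x in A, ENNReal.ofReal (|φ x| + L * (h + δ)) ∂μH[(m:ℝ)] := by
  have hν := S.norm_nu
  obtain ⟨P, hPm, hPb, hPd, hPU, hPdisj⟩ :=
    SeparableSpace.exists_measurable_partition_diam_le (Euc (m+1)) hd
  let T : ℕ → Set (Euc (m+1)) := fun i => {p | ∃ s ∈ Icc 0 h, p + s • ν ∈ A ∩ P i}
  have hpiece : ∀ i, cH m * ∫⁻ p in T i, ENNReal.ofReal |φ p| ≤ ENNReal.ofReal (h + 2 * δ) *
      ∫⁻ x in A ∩ P i, ENNReal.ofReal (|φ x| + L * (h + δ)) ∂μH[(m:ℝ)] := by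
    intro i
    have hdi : ∀ x ∈ A ∩ P i, ∀ y ∈ A ∩ P i, dist x y ≤ δ := by
      intro x hx y hy
      exact (dist_le_diam_of_mem (hPb i) hx.2 hy.2).trans (hPd i)
    set K : ℝ≥0∞ := ⨅ x ∈ A ∩ P i, ENNReal.ofReal (|φ x| + L * (h + δ)) with hK
    have hb1 : ∀ p ∈ T i, ENNReal.ofReal |φ p| ≤ K := by
      rintro p ⟨s, hs, hp⟩
      refine le_iInf₂ fun x hx => ENNReal.ofReal_le_ofReal ?_
      have h1 : |φ p - φ x| ≤ L * dist p x := by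
        rw [← Real.dist_eq]; exact hφ.dist_le_mul p x
      have h2 : dist p x ≤ h + δ := by
        have h3 : dist p (p + s • ν) ≤ h := by
          rw [dist_self_add_right, norm_smul, hν, mul_one, Real.norm_eq_abs, abs_of_nonneg hs.1]
          exact hs.2
        linarith [dist_triangle p (p + s • ν) x, hdi _ hp _ hx]
      have h4 : (L:ℝ) * dist p x ≤ L * (h + δ) := by gcongr
      have := abs_sub_abs_le_abs_sub (φ p) (φ x)
      linarith
    have hb2 : ∫⁻ p in T i, ENNReal.ofReal |φ p| ≤ K * volume (T i) := by
      rw [← setLIntegral_const]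
      exact setLIntegral_mono measurable_const hb1
    have hb3 : K * μH[(m:ℝ)] (A ∩ P i) ≤
        ∫⁻ x in A ∩ P i, ENNReal.ofReal (|φ x| + L * (h + δ)) ∂μH[(m:ℝ)] := by
      rw [← setLIntegral_const]
      refine setLIntegral_mono' (hA.inter (hPm i)) fun x hx => ?_
      exact iInf₂_le x hx
    calc cH m * ∫⁻ p in T i, ENNReal.ofReal |φ p| ≤ cH m * (K * volume (T i)) := by gcongr
      _ = K * (cH m * volume (T i)) := by ring
      _ ≤ K * (ENNReal.ofReal (h + 2 * δ) * μH[(m:ℝ)] (A ∩ P i)) := by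
          gcongr K * ?_; exact tube_piece S hdi
      _ = ENNReal.ofReal (h + 2 * δ) * (K * μH[(m:ℝ)] (A ∩ P i)) := by ring
      _ ≤ _ := by gcongr
  have hDT : ∫⁻ p in D, ENNReal.ofReal |φ p| ≤ ∑' i, ∫⁻ p in T i, ENNReal.ofReal |φ p| := by
    refine le_trans ?_ (lintegral_iUnion_le T _)
    refine lintegral_mono' (Measure.restrict_mono_ae ?_) le_rfl
    filter_upwards [hD] with p hp hpD
    obtain ⟨s, hs, hsA⟩ := hp hpD
    have : p + s • ν ∈ ⋃ i, P i := by rw [hPU]; trivial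
    obtain ⟨i, hi⟩ := mem_iUnion.1 this
    exact mem_iUnion.2 ⟨i, s, hs, hsA, hi⟩
  calc cH m * ∫⁻ p in D, ENNReal.ofReal |φ p|
      ≤ cH m * ∑' i, ∫⁻ p in T i, ENNReal.ofReal |φ p| := by gcongr
    _ = ∑' i, cH m * ∫⁻ p in T i, ENNReal.ofReal |φ p| := ENNReal.tsum_mul_left.symm
    _ ≤ ∑' i, ENNReal.ofReal (h + 2 * δ) *
      ∫⁻ x in A ∩ P i, ENNReal.ofReal (|φ x| + L * (h + δ)) ∂μH[(m:ℝ)] :=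
        ENNReal.tsum_le_tsum hpiece
    _ = ENNReal.ofReal (h + 2 * δ) *
      ∑' i, ∫⁻ x in A ∩ P i, ENNReal.ofReal (|φ x| + L * (h + δ)) ∂μH[(m:ℝ)] := ENNReal.tsum_mul_left
    _ = _ := by
      rw [← lintegral_iUnion (fun i => hA.inter (hPm i)), ← inter_iUnion, hPU, inter_univ]
      intro i j hij
      exact (hPdisj hij).mono inter_subset_right inter_subset_right

open MeasureTheory Metric Set Filter
open scoped ENNReal NNReal Topology RealInnerProductSpace

lemma hasDerivAt_shift {n : ℕ} {E : Set (Euc n)} (hE : MeasurableSet E) {φ : Euc n → ℝ}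
    (hφ : ContDiff ℝ 1 φ) (hc : HasCompactSupport φ) (v : Euc n) :
    HasDerivAt (fun t : ℝ => ∫ y in E, φ (y + t • v)) (∫ y in E, fderiv ℝ φ y v) 0 := by
  set f : Euc n → ℝ := E.indicator (fun _ => (1:ℝ)) with hf
  set g : Euc n → ℝ := fun x => φ (-x) with hg
  have hgc : HasCompactSupport g := hc.comp_homeomorph (Homeomorph.neg _)
  have hgd : ContDiff ℝ 1 g := hφ.comp contDiff_neg
  have hfl : LocallyIntegrable f volume :=
    (locallyIntegrable_const (1:ℝ)).indicator hE
  have key := hgc.hasFDerivAt_convolution_right (ContinuousLinearMap.mul ℝ ℝ) hfl hgd (0 : Euc n)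
  have hline : HasDerivAt (fun t : ℝ => t • (-v)) (-v) 0 := by
    simpa using (hasDerivAt_id (0:ℝ)).smul_const (-v)
  have key' : HasFDerivAt (convolution f g (ContinuousLinearMap.mul ℝ ℝ) volume)
      (convolution f (fderiv ℝ g) ((ContinuousLinearMap.mul ℝ ℝ).precompR (Euc n)) volume 0)
      ((0:ℝ) • (-v)) := by rw [zero_smul]; exact key
  have h2 := key'.comp_hasDerivAt (0:ℝ) hline
  have e1 : (fun t : ℝ => ∫ y in E, φ (y + t • v)) =
      (convolution f g (ContinuousLinearMap.mul ℝ ℝ) volume) ∘ (fun t : ℝ => t • (-v)) := by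
    funext t
    simp only [Function.comp, convolution, ContinuousLinearMap.mul_apply', hf, hg]
    rw [← integral_indicator hE]
    congr 1
    funext y
    by_cases hy : y ∈ E <;> simp [hy]
  have e2 : ∫ y in E, fderiv ℝ φ y v =
      convolution f (fderiv ℝ g) ((ContinuousLinearMap.mul ℝ ℝ).precompR (Euc n)) volume 0 (-v) := by
    rw [convolution_precompR_apply _ hfl (hgc.fderiv ℝ) (hgd.continuous_fderiv one_ne_zero)]
    simp only [convolution, ContinuousLinearMap.mul_apply', hf]
    rw [← integral_indicator hE]
    congr 1
    funext y
    have hd : fderiv ℝ g (-y) (-v) = fderiv ℝ φ y v := by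
      have : HasFDerivAt g ((fderiv ℝ φ y).comp (-ContinuousLinearMap.id ℝ (Euc n))) (-y) := by
        have h1 : HasFDerivAt φ (fderiv ℝ φ y) (-(-y)) := by
          rw [neg_neg]; exact (hφ.differentiable one_ne_zero y).hasFDerivAt
        exact h1.comp (-y) (hasFDerivAt_id (-y)).neg
      rw [this.fderiv]; simp
    by_cases hy : y ∈ E <;> simp [hy, hd]
  rw [e1, e2]
  exact h2

lemma diff_bound {m : ℕ} {ν : Euc (m+1)} (S : Split m ν) {E : Set (Euc (m+1))}
    (hE : MeasurableSet E) (hfin : μH[(m:ℝ)] (essBoundary E) < ⊤) {φ : Euc (m+1) → ℝ}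
    (hφc : Continuous φ) (hc : HasCompactSupport φ) {L : ℝ≥0} (hL : LipschitzWith L φ)
    {h : ℝ} (hh : 0 < h) :
    cH m * |(∫ y in E, φ (y + h • (-ν))) - ∫ y in E, φ y| ≤
      (h + 2 * h^2) * ∫ x in essBoundary E, (|φ x| + L * (h + h^2)) ∂μH[(m:ℝ)] := by
  set D : Set (Euc (m+1)) := {p | ¬ (p ∈ E ↔ p + h • ν ∈ E)} with hD
  have hEs : MeasurableSet ((fun p => p + h • ν) ⁻¹' E) := (measurable_add_const _) hE
  have hDm : MeasurableSet D := by
    have : D = (E ∩ ((fun p => p + h • ν) ⁻¹' E)ᶜ) ∪ (Eᶜ ∩ ((fun p => p + h • ν) ⁻¹' E)) := by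
      ext p; simp only [hD, mem_ofPred_eq, mem_union, mem_inter_iff, mem_compl_iff, mem_preimage]
      tauto
    rw [this]
    exact (hE.inter hEs.compl).union (hE.compl.inter hEs)
  have hInteg : Integrable φ := hφc.integrable_of_hasCompactSupport hc
  have e1 : ∫ y in E, φ (y + h • (-ν)) = ∫ y, ((fun p => p + h • ν) ⁻¹' E).indicator φ y := by
    rw [← integral_indicator hE, ← integral_add_right_eq_self _ (h • ν)]
    congr 1; funext y
    by_cases hy : y + h • ν ∈ E <;> simp [hy, indicator]
  have e2 : (∫ y in E, φ (y + h • (-ν))) - ∫ y in E, φ y =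
      ∫ y, (((fun p => p + h • ν) ⁻¹' E).indicator φ y - E.indicator φ y) := by
    rw [e1, ← integral_indicator hE, integral_sub (hInteg.indicator hEs) (hInteg.indicator hE)]
  have e3 : ENNReal.ofReal |(∫ y in E, φ (y + h • (-ν))) - ∫ y in E, φ y| ≤
      ∫⁻ p in D, ENNReal.ofReal |φ p| := by
    rw [e2, ← Real.norm_eq_abs, ofReal_norm]
    refine (enorm_integral_le_lintegral_enorm _).trans ?_
    rw [← lintegral_indicator hDm]
    refine lintegral_mono fun y => ?_
    rw [← ofReal_norm, Real.norm_eq_abs]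
    by_cases h1 : y ∈ E <;> by_cases h2 : y + h • ν ∈ E <;> simp [hD, h1, h2, indicator]
  have e4 := tube_bound S (measurableSet_essBoundary hE) hh.le (show 0 < h^2 by positivity) hL
    (D := D) (ae_cross S hE hh)
  have : IsFiniteMeasure ((μH[(m:ℝ)] : Measure (Euc (m+1))).restrict (essBoundary E)) :=
    ⟨by simpa using hfin⟩
  have hbd : Integrable (fun x => |φ x| + L * (h + h^2))
      ((μH[(m:ℝ)] : Measure (Euc (m+1))).restrict (essBoundary E)) := by
    refine Integrable.add ?_ (integrable_const _)
    exact (hφc.abs).integrable_of_hasCompactSupport (hc.comp_left (g := fun x => |x|) abs_zero)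
  rw [← ofReal_integral_eq_lintegral_ofReal hbd (Eventually.of_forall fun x => by positivity),
    ← ENNReal.ofReal_mul (by positivity)] at e4
  have e5 : ENNReal.ofReal (cH m * |(∫ y in E, φ (y + h • (-ν))) - ∫ y in E, φ y|) ≤
      ENNReal.ofReal ((h + 2 * h^2) * ∫ x in essBoundary E, (|φ x| + L * (h + h^2)) ∂μH[(m:ℝ)]) := by
    rw [ENNReal.ofReal_mul (by positivity), ENNReal.ofReal_coe_nnreal]
    exact (mul_le_mul_right e3 _).trans e4
  rwa [ENNReal.ofReal_le_ofReal_iff] at e5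
  exact mul_nonneg (by positivity) (integral_nonneg fun x => by positivity)

/-- Part I: directional Federer inequality. -/
lemma federer_unit {m : ℕ} {ν : Euc (m+1)} (hν : ‖ν‖ = 1) {E : Set (Euc (m+1))}
    (hE : MeasurableSet E) (hfin : μH[(m:ℝ)] (essBoundary E) < ⊤) {φ : Euc (m+1) → ℝ}
    (hφ : ContDiff ℝ 1 φ) (hc : HasCompactSupport φ) :
    cH m * |∫ y in E, fderiv ℝ φ y ν| ≤ ∫ x in essBoundary E, |φ x| ∂μH[(m:ℝ)] := by
  obtain ⟨S⟩ := exists_split ν hν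
  obtain ⟨L, hL⟩ := hφ.lipschitzWith_of_hasCompactSupport hc one_ne_zero
  have : IsFiniteMeasure ((μH[(m:ℝ)] : Measure (Euc (m+1))).restrict (essBoundary E)) :=
    ⟨by simpa using hfin⟩
  have hder := hasDerivAt_shift hE hφ hc (-ν)
  rw [hasDerivAt_iff_tendsto_slope_zero] at hder
  have h1 := hder.mono_left (nhdsWithin_mono (0:ℝ) (show Ioi (0:ℝ) ⊆ {0}ᶜ from
    fun x hx => (show (0:ℝ) < x from hx).ne'))
  have h2 := (h1.abs).const_mul (cH m : ℝ)
  have e0 : |∫ y in E, fderiv ℝ φ y (-ν)| = |∫ y in E, fderiv ℝ φ y ν| := by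
    simp [integral_neg]
  rw [e0] at h2
  set M := (μH[(m:ℝ)] : Measure (Euc (m+1))).real (essBoundary E)
  have hia : Integrable (fun x => |φ x|)
      ((μH[(m:ℝ)] : Measure (Euc (m+1))).restrict (essBoundary E)) :=
    (hφ.continuous.abs).integrable_of_hasCompactSupport (hc.comp_left (g := fun x => |x|) abs_zero)
  have h3 : Tendsto (fun h : ℝ => (1 + 2 * h) *
      ((∫ x in essBoundary E, |φ x| ∂μH[(m:ℝ)]) + M * (L * (h + h^2)))) (𝓝[>] 0)
      (𝓝 (∫ x in essBoundary E, |φ x| ∂μH[(m:ℝ)])) := by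
    have : ContinuousAt (fun h : ℝ => (1 + 2 * h) *
      ((∫ x in essBoundary E, |φ x| ∂μH[(m:ℝ)]) + M * (L * (h + h^2)))) 0 := by fun_prop
    have h4 := this.tendsto
    simp only [mul_zero, add_zero, one_mul, ne_eq, OfNat.ofNat_ne_zero, not_false_eq_true,
      zero_pow] at h4
    exact h4.mono_left nhdsWithin_le_nhds
  refine le_of_tendsto_of_tendsto h2 h3 ?_
  filter_upwards [self_mem_nhdsWithin] with h hh
  have hh' : (0:ℝ) < h := hh
  have h5 := diff_bound S hE hfin hφ.continuous hc hL hh'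
  rw [integral_add hia (integrable_const _), integral_const, smul_eq_mul] at h5
  simp only [zero_add, zero_smul, add_zero, smul_eq_mul, abs_mul, abs_inv, abs_of_pos hh']
  rw [mul_left_comm, inv_mul_le_iff₀ hh']
  refine h5.trans (le_of_eq ?_)
  simp only [Measure.real, Measure.restrict_apply_univ, M]
  ring

lemma federer {m : ℕ} (v : Euc (m+1)) {E : Set (Euc (m+1))}
    (hE : MeasurableSet E) (hfin : μH[(m:ℝ)] (essBoundary E) < ⊤) {φ : Euc (m+1) → ℝ}
    (hφ : ContDiff ℝ 1 φ) (hc : HasCompactSupport φ) :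
    cH m * |∫ y in E, fderiv ℝ φ y v| ≤ ‖v‖ * ∫ x in essBoundary E, |φ x| ∂μH[(m:ℝ)] := by
  rcases eq_or_ne v 0 with rfl | hv
  · simp
  have hv' : ‖v‖ ≠ 0 := norm_ne_zero_iff.2 hv
  have h1 := federer_unit (ν := ‖v‖⁻¹ • v) (by rw [norm_smul]; simp [hv']) hE hfin hφ hc
  simp only [map_smul, smul_eq_mul, integral_const_mul, abs_mul, abs_inv, abs_norm] at h1
  rw [mul_left_comm, inv_mul_le_iff₀ (by positivity)] at h1
  exact h1

open MeasureTheory Metric Set Filter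
open scoped ENNReal NNReal Topology RealInnerProductSpace

lemma exists_bump {n : ℕ} {K U : Set (Euc n)} (hK : IsCompact K) (hU : IsOpen U) (hKU : K ⊆ U) :
    ∃ φ : Euc n → ℝ, ContDiff ℝ 1 φ ∧ HasCompactSupport φ ∧ tsupport φ ⊆ U ∧
      (∀ x, φ x ∈ Icc (0:ℝ) 1) ∧ ∀ x ∈ K, φ x = 1 := by
  obtain ⟨W, hW, hKW, hWU, hWc⟩ := exists_open_between_and_isCompact_closure hK hU hKU
  obtain ⟨f, hf0, hf1, hf⟩ := exists_contMDiffMap_zero_one_of_isClosed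
    (n := 1) (modelWithCornersSelf ℝ (Euc n)) hW.isClosed_compl hK.isClosed
    (disjoint_left.2 fun x hx hx' => hx (hKW hx'))
  have hs : tsupport f ⊆ closure W := closure_mono fun x hx => by
    by_contra h
    exact hx (hf0 h)
  refine ⟨f, f.contMDiff.contDiff, ?_, hs.trans hWU, hf, fun x hx => hf1 hx⟩
  exact hWc.of_isClosed_subset (isClosed_tsupport _) hs

lemma shift_integral_le {m : ℕ} {F : Set (Euc (m+1))} (hF : MeasurableSet F)
    {x h : Euc (m+1)} {r ω : ℝ} (hh : ‖h‖ < 2 * r)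
    (H : ∀ φ : Euc (m+1) → ℝ, ContDiff ℝ 1 φ → HasCompactSupport φ →
      tsupport φ ⊆ ball x (3 * r) → (∀ y, φ y ∈ Icc (0:ℝ) 1) →
      -(∫ y in F, fderiv ℝ φ y h) ≤ ‖h‖ * ω)
    {φ : Euc (m+1) → ℝ} (hφ : ContDiff ℝ 1 φ) (hc : HasCompactSupport φ)
    (hs : tsupport φ ⊆ ball x r) (h01 : ∀ y, φ y ∈ Icc (0:ℝ) 1) :
    (∫ y in F, φ (y - h)) - ∫ y in F, φ y ≤ ‖h‖ * ω := by
  set G : ℝ → ℝ := fun t => ∫ y in F, φ (y + t • (-h)) with hG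
  have key : ∀ t : ℝ, HasDerivAt G (-(∫ y in F, fderiv ℝ (fun z => φ (z + t • (-h))) y h)) t := by
    intro t
    have hφt : ContDiff ℝ 1 (fun z => φ (z + t • (-h))) := hφ.comp (by fun_prop)
    have hct : HasCompactSupport (fun z => φ (z + t • (-h))) :=
      hc.comp_homeomorph (Homeomorph.addRight (t • (-h)))
    have h1 := hasDerivAt_shift hF hφt hct (-h)
    have h2 : HasDerivAt (fun s : ℝ => s - t) 1 t := (hasDerivAt_id t).sub_const t
    have h1' : HasDerivAt (fun s : ℝ => ∫ y in F, φ (y + s • (-h) + t • (-h)))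
      (∫ y in F, fderiv ℝ (fun z => φ (z + t • (-h))) y (-h)) (t - t) := by
      rw [sub_self]; exact h1
    have h3 := HasDerivAt.comp (h := fun s : ℝ => s - t) t h1' h2
    have e1 : G = (fun s : ℝ => ∫ y in F, φ (y + s • (-h) + t • (-h))) ∘ (fun s : ℝ => s - t) := by
      funext s
      simp only [hG, Function.comp]
      congr 1
      funext y
      congr 1
      rw [add_assoc, ← add_smul, sub_add_cancel]
    rw [e1]
    refine h3.congr_deriv ?_
    rw [mul_one, ← integral_neg]
    congr 1
    funext y
    rw [map_neg]
  have hd : ∀ t ∈ interior (Icc (0:ℝ) 1), deriv G t ≤ ‖h‖ * ω := by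
    intro t ht
    rw [interior_Icc] at ht
    rw [(key t).deriv]
    refine H _ (hφ.comp (by fun_prop)) (hc.comp_homeomorph (Homeomorph.addRight (t • (-h)))) ?_
      (fun y => h01 _)
    have h4 : tsupport (fun z => φ (z + t • (-h))) = (Homeomorph.addRight (t • (-h))) ⁻¹' tsupport φ :=
      tsupport_comp_eq_preimage φ (Homeomorph.addRight (t • (-h)))
    rw [h4]
    intro y hy
    have h5 := hs hy
    simp only [Homeomorph.coe_addRight, mem_ball, dist_eq_norm] at h5 ⊢
    have : y - x = (y + t • (-h) - x) + t • h := by simp; abel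
    rw [this]
    refine (norm_add_le _ _).trans_lt ?_
    rw [norm_smul, Real.norm_eq_abs, abs_of_pos ht.1]
    have : t * ‖h‖ ≤ ‖h‖ := by nlinarith [norm_nonneg h, ht.2]
    linarith
  have h6 := Convex.image_sub_le_mul_sub_of_deriv_le (convex_Icc (0:ℝ) 1)
    (fun t _ => (key t).continuousAt.continuousWithinAt)
    (fun t _ => (key t).differentiableAt.differentiableWithinAt) hd 0 (by simp) 1 (by simp) (by simp)
  simpa [hG, sub_eq_add_neg] using h6

lemma shift_vol_le {m : ℕ} {F : Set (Euc (m+1))} (hF : MeasurableSet F)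
    {x h : Euc (m+1)} {r ω : ℝ} (hh : ‖h‖ < 2 * r)
    (H : ∀ φ : Euc (m+1) → ℝ, ContDiff ℝ 1 φ → HasCompactSupport φ →
      tsupport φ ⊆ ball x (3 * r) → (∀ y, φ y ∈ Icc (0:ℝ) 1) →
      -(∫ y in F, fderiv ℝ φ y h) ≤ ‖h‖ * ω) :
    volume {y | y ∈ ball x r ∧ y ∉ F ∧ y + h ∈ F} ≤ ENNReal.ofReal (‖h‖ * ω) := by
  set Y := {y | y ∈ ball x r ∧ y ∉ F ∧ y + h ∈ F} with hY
  have hYm : MeasurableSet Y :=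
    measurableSet_ball.inter (hF.compl.inter ((measurable_id.add_const h) hF))
  have hYfin : volume Y ≠ ⊤ := ((measure_mono (fun y hy => hy.1)).trans_lt
    (measure_ball_lt_top (x := x) (r := r))).ne
  refine ENNReal.le_of_forall_pos_le_add fun ε hε _ => ?_
  have hε2 : ((ε/3 : ℝ≥0) : ℝ≥0∞) ≠ 0 := by
    simpa using hε.ne'
  obtain ⟨K, hKY, hK, hKv⟩ := hYm.exists_isCompact_lt_add hYfin (ε := (ε/3 : ℝ≥0)) hε2
  obtain ⟨U0, hYU0, hU0, hU0v⟩ := Y.exists_isOpen_lt_add hYfin (ε := (ε/3 : ℝ≥0)) hε2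
  set U := U0 ∩ ball x r
  have hU : IsOpen U := hU0.inter isOpen_ball
  have hYU : Y ⊆ U := fun y hy => ⟨hYU0 hy, hy.1⟩
  obtain ⟨φ, hφ, hc, hs, h01, hφK⟩ := exists_bump hK hU (hKY.trans hYU)
  have h1 := shift_integral_le hF hh H hφ hc (hs.trans inter_subset_right) h01
  have hUfin : volume U ≠ ⊤ := ((measure_mono inter_subset_right).trans_lt
    (measure_ball_lt_top (x := x) (r := r))).ne
  have hKfin : volume K ≠ ⊤ := hK.measure_lt_top.ne
  have hInteg : Integrable φ := hφ.continuous.integrable_of_hasCompactSupport hc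
  have hInteg' : Integrable (fun y => φ (y - h)) := hInteg.comp_sub_right h
  -- lower bound of first term
  have h2 : (volume K).toReal ≤ ∫ y in F, φ (y - h) := by
    set K' := (fun y => y - h) ⁻¹' K
    have hK'm : MeasurableSet K' := (measurable_id.sub_const h) hK.measurableSet
    have hK'F : K' ⊆ F := fun y hy => by simpa using (hKY hy).2.2
    have e : (volume K).toReal = ∫ y in K', φ (y - h) := by
      rw [setIntegral_congr_fun (g := fun _ => (1:ℝ)) hK'm (fun y hy => hφK _ hy)]
      simp only [integral_const, smul_eq_mul, mul_one, Measure.real, Measure.restrict_apply_univ]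
      congr 1
      exact ((measurePreserving_sub_right volume h).measure_preimage
        hK.measurableSet.nullMeasurableSet).symm
    rw [e]
    exact setIntegral_mono_set hInteg'.integrableOn (ae_of_all _ fun y => (h01 _).1)
      (LE.le.eventuallyLE hK'F)
  have h3 : ∫ y in F, φ y ≤ (volume (U \ K)).toReal := by
    have hUK : MeasurableSet (U \ K) := hU.measurableSet.diff hK.measurableSet
    have hb : volume (U \ K) ≠ ⊤ := ((measure_mono sdiff_subset).trans_lt hUfin.lt_top).ne
    have e : (volume (U \ K)).toReal = ∫ y, (U \ K).indicator (fun _ => (1:ℝ)) y := by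
      rw [integral_indicator hUK]; simp [Measure.real]
    rw [e, ← integral_indicator hF]
    refine integral_mono (hInteg.indicator hF) ((integrable_indicator_iff hUK).2
      (integrableOn_const hb)) fun y => ?_
    by_cases hy : y ∈ F
    · rw [indicator_of_mem hy]
      by_cases hyU : y ∈ U
      · rw [indicator_of_mem (show y ∈ U \ K from ⟨hyU, fun hk => (hKY hk).2.1 hy⟩)]
        exact (h01 y).2
      · have : φ y = 0 := image_eq_zero_of_notMem_tsupport fun h' => hyU (hs h')
        rw [this]
        exact indicator_nonneg (fun _ _ => zero_le_one) _
    · rw [indicator_of_notMem hy]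
      exact indicator_nonneg (fun _ _ => zero_le_one) _
  have h4 : volume (U \ K) ≤ (ε/3:ℝ≥0) + (ε/3:ℝ≥0) := by
    rw [measure_sdiff (hKY.trans hYU) hK.measurableSet.nullMeasurableSet hKfin]
    rw [tsub_le_iff_left]
    have : volume U ≤ volume U0 := measure_mono inter_subset_left
    refine (this.trans hU0v.le).trans ?_
    rw [← add_assoc]
    gcongr
  have h5 : (volume K).toReal ≤ ‖h‖ * ω + (volume (U \ K)).toReal := by linarith
  have h6 : volume K ≤ ENNReal.ofReal (‖h‖ * ω) + volume (U \ K) := by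
    have hb : volume (U \ K) ≠ ⊤ := ((measure_mono sdiff_subset).trans_lt hUfin.lt_top).ne
    rw [← ENNReal.ofReal_toReal hKfin]
    refine (ENNReal.ofReal_le_ofReal h5).trans (ENNReal.ofReal_add_le.trans ?_)
    rw [ENNReal.ofReal_toReal hb]
  calc volume Y ≤ volume K + (ε/3:ℝ≥0) := hKv.le
    _ ≤ (ENNReal.ofReal (‖h‖ * ω) + ((ε/3:ℝ≥0) + (ε/3:ℝ≥0))) + (ε/3:ℝ≥0) := by
      gcongr; exact h6.trans (by gcongr)
    _ = _ := by
      rw [add_assoc]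
      congr 1
      norm_cast
      rw [← NNReal.coe_inj]; push_cast; ring

lemma pair_vol_le {m : ℕ} {F C : Set (Euc (m+1))} (hF : MeasurableSet F) (hC : MeasurableSet C)
    {x : Euc (m+1)} {r ω : ℝ} (hω : 0 ≤ ω)
    (H : ∀ h ∈ C, ∀ φ : Euc (m+1) → ℝ, ContDiff ℝ 1 φ → HasCompactSupport φ →
      tsupport φ ⊆ ball x (3 * r) → (∀ y, φ y ∈ Icc (0:ℝ) 1) →
      -(∫ y in F, fderiv ℝ φ y h) ≤ ‖h‖ * ω) :
    (volume.prod volume) {z : Euc (m+1) × Euc (m+1) | (z.1 ∈ ball x r ∧ z.1 ∉ F) ∧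
      (z.2 ∈ ball x r ∧ z.2 ∈ F) ∧ z.2 - z.1 ∈ C}
      ≤ ENNReal.ofReal (2 * r * ω) * volume (ball (0 : Euc (m+1)) (2 * r)) := by
  set P := {z : Euc (m+1) × Euc (m+1) | (z.1 ∈ ball x r ∧ z.1 ∉ F) ∧
      (z.2 ∈ ball x r ∧ z.2 ∈ F) ∧ z.2 - z.1 ∈ C} with hP
  have hPm : MeasurableSet P := by
    refine MeasurableSet.inter (measurable_fst (measurableSet_ball.inter hF.compl))
      (MeasurableSet.inter (measurable_snd (measurableSet_ball.inter hF)) ?_)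
    exact (measurable_snd.sub measurable_fst) hC
  have mp := measurePreserving_prod_add (volume : Measure (Euc (m+1))) (volume : Measure (Euc (m+1)))
  rw [← mp.measure_preimage hPm.nullMeasurableSet,
    Measure.prod_apply_symm (mp.measurable hPm)]
  calc _ ≤ ∫⁻ h, (ball (0 : Euc (m+1)) (2 * r)).indicator
        (fun _ => ENNReal.ofReal (2 * r * ω)) h := by
        refine lintegral_mono fun h => ?_
        by_cases hh : h ∈ ball (0 : Euc (m+1)) (2 * r)
        · rw [indicator_of_mem hh]
          have hh' : ‖h‖ < 2 * r := by simpa using hh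
          by_cases hhC : h ∈ C
          · refine (measure_mono ?_).trans ((shift_vol_le hF hh' (H h hhC)).trans
              (ENNReal.ofReal_le_ofReal (by gcongr)))
            rintro y ⟨⟨h1, h2⟩, ⟨h3, h4⟩, h5⟩
            exact ⟨h1, h2, h4⟩
          · refine le_of_eq_of_le ?_ (zero_le (a := ENNReal.ofReal (2 * r * ω)))
            convert measure_empty (μ := (volume : Measure (Euc (m+1))))
            refine eq_empty_of_forall_notMem fun y hy => hhC ?_
            simpa using hy.2.2
        · refine le_of_eq_of_le ?_ zero_le
          convert measure_empty (μ := (volume : Measure (Euc (m+1))))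
          refine eq_empty_of_forall_notMem fun y hy => hh ?_
          obtain ⟨⟨h1, h2⟩, ⟨h3, h4⟩, h5⟩ := hy
          simp only [mem_ball, dist_eq_norm, sub_zero] at *
          have : h = (y + h - x) - (y - x) := by abel
          rw [this]
          refine (norm_sub_le _ _).trans_lt ?_
          linarith
    _ = _ := by
      rw [lintegral_indicator measurableSet_ball]
      simp

open MeasureTheory Metric Set Filter
open scoped ENNReal NNReal Topology RealInnerProductSpace

/-- `lam` dominates the distributional gradient of the indicator of `F`. -/
def DomBy {m : ℕ} (F : Set (Euc (m+1))) (lam : Measure (Euc (m+1))) : Prop :=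
  ∀ (v : Euc (m+1)) (φ : Euc (m+1) → ℝ), ContDiff ℝ 1 φ → HasCompactSupport φ →
    |∫ y in F, fderiv ℝ φ y v| ≤ ‖v‖ * ∫ x, |φ x| ∂lam

lemma integral_le_of_tsupport {m : ℕ} (lam : Measure (Euc (m+1))) [IsFiniteMeasure lam]
    {U : Set (Euc (m+1))} (hU : MeasurableSet U)
    {φ : Euc (m+1) → ℝ} (hφ : ContDiff ℝ 1 φ) (hc : HasCompactSupport φ)
    (hs : tsupport φ ⊆ U) (h01 : ∀ y, φ y ∈ Icc (0:ℝ) 1) :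
    ∫ x, |φ x| ∂lam ≤ lam.real U := by
  have e : lam.real U = ∫ y, U.indicator (fun _ => (1:ℝ)) y ∂lam := by
    rw [integral_indicator hU]; simp [Measure.real]
  rw [e]
  refine integral_mono ((hφ.continuous.abs).integrable_of_hasCompactSupport
    (hc.comp_left (g := fun x => |x|) abs_zero)) ((integrable_indicator_iff hU).2
      (integrableOn_const (measure_ne_top _ _))) fun y => ?_
  by_cases hy : y ∈ U
  · simp only [indicator_of_mem hy]
    rw [abs_of_nonneg (h01 y).1]; exact (h01 y).2
  · have : φ y = 0 := image_eq_zero_of_notMem_tsupport fun h' => hy (hs h')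
    simp only [this, abs_zero]
    exact indicator_nonneg (fun _ _ => zero_le_one) _

lemma or_of_mul_le {a b c : ℝ≥0∞} (h : a * b ≤ c * c) : a ≤ c ∨ b ≤ c := by
  by_contra hh
  push Not at hh
  exact absurd h (not_le.2 (ENNReal.mul_lt_mul hh.1 hh.2))

lemma dens_lower {m : ℕ} {F : Set (Euc (m+1))} (hF : MeasurableSet F)
    {lam : Measure (Euc (m+1))} [IsFiniteMeasure lam] (hD : DomBy F lam) {x : Euc (m+1)}
    (hx : x ∈ essBoundary F) :
    ∃ k : ℕ, ∃ᶠ r in 𝓝[>] (0:ℝ), ENNReal.ofReal (1/(k+1) * r^m) ≤ lam (closedBall x r) := by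
  by_contra hcon
  push Not at hcon
  refine zeroDens_or_of_min hF x (fun ε hε => ?_) hx
  set c : ℝ := 2 * 3^m * (omegaBall (m+1) * 2^(m+1)) with hc
  have hω := omega_pos (m+1)
  have hcpos : 0 < c := by positivity
  obtain ⟨k, hk⟩ := exists_nat_gt (c / ε^2)
  have hk' : c * (1/((k:ℝ)+1)) ≤ ε^2 := by
    rw [mul_one_div, div_le_iff₀ (by positivity)]
    rw [div_lt_iff₀ (by positivity)] at hk
    nlinarith [sq_nonneg ε]
  have h1 : ∀ᶠ r in 𝓝[>] (0:ℝ), lam (closedBall x r) < ENNReal.ofReal (1/(k+1) * r^m) := by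
    exact hcon k
  have h3 : Tendsto (fun r : ℝ => 3 * r) (𝓝[>] 0) (𝓝[>] 0) := by
    refine tendsto_nhdsWithin_of_tendsto_nhds_of_eventually_within _ ?_ ?_
    · have : Tendsto (fun r : ℝ => 3 * r) (𝓝 0) (𝓝 (3 * 0)) :=
        (continuous_const_mul (3:ℝ)).tendsto 0
      rw [mul_zero] at this
      exact this.mono_left nhdsWithin_le_nhds
    · filter_upwards [self_mem_nhdsWithin] with r hr
      have : (0:ℝ) < r := hr
      simpa using this
  filter_upwards [h3.eventually h1, self_mem_nhdsWithin] with r hr hr0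
  have hr0' : (0:ℝ) < r := hr0
  apply or_of_mul_le
  have hω3 : lam.real (ball x (3*r)) ≤ 1/((k:ℝ)+1) * (3*r)^m := by
    refine ENNReal.toReal_le_of_le_ofReal (by positivity) ?_
    exact (measure_mono ball_subset_closedBall).trans hr.le
  have hp := pair_vol_le hF MeasurableSet.univ (x := x) (r := r)
    (ω := lam.real (ball x (3*r))) (by positivity) (fun h _ φ hφ hcφ hs h01 =>
      (neg_le_abs _).trans ((hD h φ hφ hcφ).trans (by
        gcongr
        exact integral_le_of_tsupport lam measurableSet_ball hφ hcφ hs h01)))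
  have e : {z : Euc (m+1) × Euc (m+1) | (z.1 ∈ ball x r ∧ z.1 ∉ F) ∧
      (z.2 ∈ ball x r ∧ z.2 ∈ F) ∧ z.2 - z.1 ∈ univ} = (Fᶜ ∩ ball x r) ×ˢ (F ∩ ball x r) := by
    ext z
    simp only [mem_ofPred_eq, mem_univ, and_true, mem_prod, mem_inter_iff, mem_compl_iff]
    tauto
  rw [e, Measure.prod_prod, mul_comm, vol_ball_real _ (by positivity)] at hp
  refine hp.trans ?_
  rw [← ENNReal.ofReal_mul (by positivity), ← ENNReal.ofReal_mul (by positivity)]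
  refine ENNReal.ofReal_le_ofReal ?_
  calc 2 * r * lam.real (ball x (3*r)) * (omegaBall (m+1) * (2*r)^(m+1))
      ≤ 2 * r * (1/((k:ℝ)+1) * (3*r)^m) * (omegaBall (m+1) * (2*r)^(m+1)) := by gcongr
    _ = c * (1/((k:ℝ)+1)) * (r^(m+1) * r^(m+1)) := by rw [hc]; ring
    _ ≤ ε^2 * (r^(m+1) * r^(m+1)) := by gcongr
    _ = _ := by ring

lemma hausdorff_cover {m : ℕ} {ι : Type} (T : ι → Set (Euc (m+1))) {d : ℝ} {S : Set (Euc (m+1))}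
    {M : ℝ≥0∞}
    (h : ∀ δ : ℝ, 0 < δ → ∃ u : Set ι, u.Countable ∧ S ⊆ ⋃ i ∈ u, T i ∧
      (∀ i ∈ u, ediam (T i) ≤ ENNReal.ofReal δ) ∧ ∑' i : u, ediam (T i) ^ d ≤ M) :
    μH[d] S ≤ M := by
  have hpos : ∀ k : ℕ, (0:ℝ) < 1 / ((k:ℝ)+1) := fun k => by positivity
  choose u hu hS hdiam hsum using fun k : ℕ => h (1 / ((k:ℝ)+1)) (hpos k)
  have : ∀ k, Countable (u k) := fun k => (hu k).to_subtype
  have h1 := Measure.hausdorffMeasure_le_liminf_tsum (ι := fun k => u k) d S (l := atTop)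
    (fun k : ℕ => ENNReal.ofReal (1 / ((k:ℝ)+1)))
    (by
      have := ENNReal.tendsto_ofReal (tendsto_one_div_add_atTop_nhds_zero_nat (𝕜 := ℝ))
      simpa using this)
    (fun k i => T i) (Eventually.of_forall fun k i => hdiam k i i.2)
    (Eventually.of_forall fun k => by
      have := hS k
      rwa [biUnion_eq_iUnion] at this)
  refine h1.trans ?_
  refine (liminf_le_liminf (Eventually.of_forall hsum)).trans ?_
  simp

lemma ediam_cB_le {n : ℕ} (x : Euc n) {r : ℝ} :
    ediam (closedBall x r) ≤ ENNReal.ofReal (2 * r) := by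
  refine ediam_le fun y hy z hz => ?_
  rw [edist_dist]
  refine ENNReal.ofReal_le_ofReal ((dist_triangle_right y z x).trans ?_)
  rw [mem_closedBall] at hy hz
  linarith

lemma vitali_upper {m : ℕ} {lam : Measure (Euc (m+1))}
    {S U : Set (Euc (m+1))} (hU : IsOpen U) (hSU : S ⊆ U) {t : ℝ} (ht : 0 < t)
    (h : ∀ x ∈ S, ∃ᶠ r in 𝓝[>] (0:ℝ), ENNReal.ofReal (t * r^m) ≤ lam (closedBall x r)) :
    μH[(m:ℝ)] S ≤ ENNReal.ofReal (10^m / t) * lam U := by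
  refine hausdorff_cover (ι := Euc (m+1) × ℝ) (fun p => closedBall p.1 (5 * p.2)) fun δ hδ => ?_
  set I : Set (Euc (m+1) × ℝ) := {p | p.1 ∈ S ∧ 0 < p.2 ∧ p.2 ≤ δ/10 ∧ closedBall p.1 p.2 ⊆ U ∧
    ENNReal.ofReal (t * p.2^m) ≤ lam (closedBall p.1 p.2)} with hI
  obtain ⟨u, huI, hdisj, hcov⟩ := Vitali.exists_disjoint_subfamily_covering_enlargement_closedBall
    I (fun p => p.1) (fun p => p.2) (δ/10) (fun p hp => hp.2.2.1) 5 (by norm_num)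
  have hcount : u.Countable := hdisj.countable_of_nonempty_interior fun p hp => by
    have := (huI hp).2.1
    refine ⟨p.1, ball_subset_interior_closedBall (mem_ball_self this)⟩
  refine ⟨u, hcount, ?_, ?_, ?_⟩
  · intro x hx
    have h1 := h x hx
    have h2 : ∀ᶠ r in 𝓝[>] (0:ℝ), closedBall x r ⊆ U := by
      obtain ⟨ε, hε, hεU⟩ := Metric.isOpen_iff.1 hU x (hSU hx)
      filter_upwards [Ioo_mem_nhdsGT hε] with r hr
      exact (closedBall_subset_ball hr.2).trans hεU
    have h3 : ∀ᶠ r in 𝓝[>] (0:ℝ), 0 < r ∧ r < δ/10 := by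
      filter_upwards [Ioo_mem_nhdsGT (show (0:ℝ) < δ/10 by positivity)] with r hr
      exact hr
    obtain ⟨r, hr1, hr2, hr3, hr4⟩ := (h1.and_eventually (h2.and h3)).exists
    obtain ⟨b, hb, hsub⟩ := hcov (x, r) ⟨hx, hr3, hr4.le, hr2, hr1⟩
    exact mem_biUnion hb (hsub (mem_closedBall_self hr3.le))
  · intro p hp
    have hp' := huI hp
    refine (ediam_cB_le _).trans ?_
    exact ENNReal.ofReal_le_ofReal (by linarith [hp'.2.2.1])
  · calc ∑' i : u, ediam (closedBall i.1.1 (5 * i.1.2)) ^ (m:ℝ)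
        ≤ ∑' i : u, ENNReal.ofReal (10^m / t) * lam (closedBall i.1.1 i.1.2) := by
          refine ENNReal.tsum_le_tsum fun i => ?_
          have hp' := huI i.2
          refine le_trans ?_ (mul_le_mul_right hp'.2.2.2.2 _)
          rw [← ENNReal.ofReal_mul (by positivity), ENNReal.rpow_natCast]
          have : ediam (closedBall i.1.1 (5 * i.1.2)) ≤ ENNReal.ofReal (10 * i.1.2) := by
            refine (ediam_cB_le _).trans ?_
            exact ENNReal.ofReal_le_ofReal (by linarith)
          refine (pow_le_pow_left' this m).trans ?_
          rw [← ENNReal.ofReal_pow (by have := hp'.2.1; positivity)]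
          refine ENNReal.ofReal_le_ofReal (le_of_eq ?_)
          field_simp
          rw [mul_pow]
      _ = ENNReal.ofReal (10^m / t) * lam (⋃ i ∈ u, closedBall i.1 i.2) := by
          rw [ENNReal.tsum_mul_left, measure_biUnion hcount hdisj
            (fun _ _ => isClosed_closedBall.measurableSet)]
      _ ≤ _ := by
          gcongr
          exact iUnion₂_subset fun p hp => (huI hp).2.2.2.1

lemma null_of_null {m : ℕ} {F : Set (Euc (m+1))} (hF : MeasurableSet F)
    {lam : Measure (Euc (m+1))} [IsFiniteMeasure lam] (hD : DomBy F lam) {S : Set (Euc (m+1))}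
    (hS : S ⊆ essBoundary F) (h0 : lam S = 0) : μH[(m:ℝ)] S = 0 := by
  set Sk : ℕ → Set (Euc (m+1)) := fun k => {x ∈ S | ∃ᶠ r in 𝓝[>] (0:ℝ),
    ENNReal.ofReal (1/(k+1) * r^m) ≤ lam (closedBall x r)}
  have hSk : S ⊆ ⋃ k, Sk k := fun x hx => by
    obtain ⟨k, hk⟩ := dens_lower hF hD (hS hx)
    exact mem_iUnion.2 ⟨k, hx, hk⟩
  refine measure_mono_null hSk (measure_iUnion_null fun k => ?_)
  have hk0 : lam (Sk k) = 0 := measure_mono_null (fun x hx => hx.1) h0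
  have hpos : (0:ℝ) < 1/((k:ℝ)+1) := by positivity
  refine le_antisymm (ENNReal.le_of_forall_pos_le_add fun ε hε _ => ?_) zero_le
  set c := ENNReal.ofReal (10^m / (1/((k:ℝ)+1)))
  have hc0 : c ≠ 0 := by simp only [c]; rw [ne_eq, ENNReal.ofReal_eq_zero, not_le]; positivity
  have hct : c ≠ ⊤ := ENNReal.ofReal_ne_top
  obtain ⟨U, hSU, hU, hUv⟩ := (Sk k).exists_isOpen_lt_of_lt (μ := lam) ((ε:ℝ≥0∞) / c) (by
    rw [hk0]; exact ENNReal.div_pos (by simpa using hε.ne') hct)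
  have h1 := vitali_upper (lam := lam) hU hSU hpos (fun x hx => hx.2)
  refine h1.trans ?_
  rw [zero_add]
  calc c * lam U ≤ c * (ε / c) := by gcongr
    _ = ε := ENNReal.mul_div_cancel hc0 hct

lemma null_upper_infty {m : ℕ} {lam : Measure (Euc (m+1))} [IsFiniteMeasure lam]
    {S : Set (Euc (m+1))}
    (hS : ∀ x ∈ S, ∀ M : ℕ, ∃ᶠ r in 𝓝[>] (0:ℝ),
      ENNReal.ofReal ((M+1) * r^m) ≤ lam (closedBall x r)) : μH[(m:ℝ)] S = 0 := by
  have h1 : ∀ M : ℕ, μH[(m:ℝ)] S ≤ ENNReal.ofReal (10^m / ((M:ℝ)+1)) * lam univ := fun M =>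
    vitali_upper isOpen_univ (subset_univ _) (by positivity) (fun x hx => hS x hx M)
  have h2 : Tendsto (fun M : ℕ => ENNReal.ofReal (10^m / ((M:ℝ)+1)) * lam univ) atTop
      (𝓝 (ENNReal.ofReal 0 * lam univ)) := by
    refine ENNReal.Tendsto.mul_const (ENNReal.tendsto_ofReal ?_) (Or.inr (measure_ne_top _ _))
    have := (tendsto_one_div_add_atTop_nhds_zero_nat (𝕜 := ℝ)).const_mul ((10:ℝ)^m)
    simpa [div_eq_mul_inv] using this
  have h3 := ge_of_tendsto' h2 h1
  simpa using h3

open MeasureTheory Metric Set Filter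
open scoped ENNReal NNReal Topology RealInnerProductSpace

lemma exists_riesz {W H : Type*} [AddCommGroup W] [Module ℝ W] [NormedAddCommGroup H]
    [InnerProductSpace ℝ H] [CompleteSpace H] (T : W →ₗ[ℝ] H) (l : W →ₗ[ℝ] ℝ) (C : ℝ)
    (h : ∀ w, |l w| ≤ C * ‖T w‖) : ∃ g : H, ∀ w, l w = ⟪g, T w⟫ := by
  obtain ⟨s, hs⟩ := T.rangeRestrict.exists_rightInverse_of_surjective T.range_rangeRestrict
  have hs' : ∀ y : LinearMap.range T, T (s y) = y := fun y => by
    have := LinearMap.congr_fun hs y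
    simpa using congrArg Subtype.val this
  set f : LinearMap.range T →L[ℝ] ℝ := LinearMap.mkContinuous (l ∘ₗ s) C (fun y => by
    have := h (s y)
    rw [hs'] at this
    simpa using this) with hf
  obtain ⟨g, hg, -⟩ := exists_extension_norm_eq _ f
  refine ⟨(InnerProductSpace.toDual ℝ H).symm g, fun w => ?_⟩
  rw [InnerProductSpace.toDual_symm_apply]
  have h1 := hg ⟨T w, LinearMap.mem_range_self T w⟩
  rw [h1]
  have h2 : l (w - s ⟨T w, LinearMap.mem_range_self T w⟩) = 0 := by
    have := h (w - s ⟨T w, LinearMap.mem_range_self T w⟩)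
    rw [map_sub T, hs'] at this
    simpa using this
  rw [map_sub, sub_eq_zero] at h2
  rw [h2]
  rfl

/-- The space of `C¹` functions with compact support. -/
def CcOne (n : ℕ) : Submodule ℝ (Euc n → ℝ) where
  carrier := {φ | ContDiff ℝ 1 φ ∧ HasCompactSupport φ}
  add_mem' := fun ha hb => ⟨ha.1.add hb.1, ha.2.add hb.2⟩
  zero_mem' := ⟨contDiff_const, HasCompactSupport.zero⟩
  smul_mem' := fun c _ ha => ⟨contDiff_const.smul ha.1, ha.2.smul_left (f := fun _ => c)⟩

lemma CcOne.memLp {n : ℕ} (lam : Measure (Euc n)) [IsFiniteMeasure lam] (φ : CcOne n) :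
    MemLp (φ : Euc n → ℝ) 2 lam :=
  φ.2.1.continuous.memLp_of_hasCompactSupport φ.2.2

lemma integrable_fderiv {n : ℕ} {φ : Euc n → ℝ} (hφ : ContDiff ℝ 1 φ) (hc : HasCompactSupport φ)
    (v : Euc n) : Integrable (fun y => fderiv ℝ φ y v) := by
  refine Continuous.integrable_of_hasCompactSupport ?_ (hc.fderiv_apply ℝ v)
  exact (hφ.continuous_fderiv one_ne_zero).clm_apply continuous_const

lemma exists_sigma_dir {m : ℕ} {F : Set (Euc (m+1))}
    {lam : Measure (Euc (m+1))} [IsFiniteMeasure lam] (hD : DomBy F lam) (v : Euc (m+1)) :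
    ∃ g : Euc (m+1) → ℝ, Integrable g lam ∧ ∀ φ : Euc (m+1) → ℝ, ContDiff ℝ 1 φ →
      HasCompactSupport φ → ∫ y in F, fderiv ℝ φ y v = ∫ x, φ x * g x ∂lam := by
  set T : CcOne (m+1) →ₗ[ℝ] Lp ℝ 2 lam :=
    { toFun := fun φ => (CcOne.memLp lam φ).toLp _
      map_add' := fun a b => MemLp.toLp_add _ _
      map_smul' := fun c a => MemLp.toLp_const_smul c _ } with hT
  have hd : ∀ φ : CcOne (m+1), Differentiable ℝ (φ : Euc (m+1) → ℝ) := fun φ =>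
    φ.2.1.differentiable one_ne_zero
  set l : CcOne (m+1) →ₗ[ℝ] ℝ :=
    { toFun := fun φ => ∫ y in F, fderiv ℝ (φ : Euc (m+1) → ℝ) y v
      map_add' := fun a b => by
        rw [← integral_add (integrable_fderiv a.2.1 a.2.2 v).integrableOn
          (integrable_fderiv b.2.1 b.2.2 v).integrableOn]
        congr 1
        funext y
        have : fderiv ℝ ((a + b : CcOne (m+1)) : Euc (m+1) → ℝ) y
          = fderiv ℝ (a : Euc (m+1) → ℝ) y + fderiv ℝ (b : Euc (m+1) → ℝ) y :=
          fderiv_add (hd a y) (hd b y)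
        rw [this]; rfl
      map_smul' := fun c a => by
        rw [RingHom.id_apply, smul_eq_mul, ← integral_const_mul]
        congr 1
        funext y
        have : fderiv ℝ ((c • a : CcOne (m+1)) : Euc (m+1) → ℝ) y
          = c • fderiv ℝ (a : Euc (m+1) → ℝ) y := fderiv_const_smul (hd a y) c
        rw [this]; rfl } with hl
  have hTe : ∀ φ : CcOne (m+1), T φ =ᵐ[lam] (φ : Euc (m+1) → ℝ) := fun φ =>
    (CcOne.memLp lam φ).coeFn_toLp
  set K : ℝ := ‖(Lp.const 2 lam (1:ℝ))‖ with hK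
  have hb : ∀ φ, |l φ| ≤ ‖v‖ * K * ‖T φ‖ := by
    intro φ
    refine (hD v φ φ.2.1 φ.2.2).trans ?_
    rw [mul_assoc]
    gcongr
    have h1 : ∫ x, |(φ : Euc (m+1) → ℝ) x| ∂lam = ⟪Lp.const 2 lam (1:ℝ), |T φ|⟫ := by
      rw [L2.inner_def]
      refine integral_congr_ae ?_
      filter_upwards [hTe φ, Lp.coeFn_abs (T φ), Lp.coeFn_const 2 lam (1:ℝ)] with x h1 h2 h3
      rw [h2, h3, h1]
      simp
    rw [h1]
    refine (real_inner_le_norm _ _).trans ?_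
    rw [norm_abs_eq_norm]
  obtain ⟨g, hg⟩ := exists_riesz T l _ hb
  refine ⟨g, (Lp.memLp g).integrable (by norm_num), fun φ hφ hc => ?_⟩
  have h2 := hg ⟨φ, hφ, hc⟩
  refine h2.trans ?_
  rw [L2.inner_def]
  refine integral_congr_ae ?_
  filter_upwards [hTe ⟨φ, hφ, hc⟩] with x h1
  rw [h1]
  simp

lemma exists_sigma {m : ℕ} {F : Set (Euc (m+1))}
    {lam : Measure (Euc (m+1))} [IsFiniteMeasure lam] (hD : DomBy F lam) :
    ∃ σ : Euc (m+1) → Euc (m+1), Integrable σ lam ∧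
      ∀ (v : Euc (m+1)) (φ : Euc (m+1) → ℝ), ContDiff ℝ 1 φ →
      HasCompactSupport φ → ∫ y in F, fderiv ℝ φ y v = ∫ x, φ x * ⟪σ x, v⟫ ∂lam := by
  set b := EuclideanSpace.basisFun (Fin (m+1)) ℝ
  choose g hg hgi using fun i => exists_sigma_dir hD (b i)
  refine ⟨fun x => ∑ i, g i x • b i, integrable_finsetSum _ fun i _ => (hg i).smul_const _, ?_⟩
  intro v φ hφ hc
  have e1 : ∀ y, fderiv ℝ φ y v = ∑ i, ⟪b i, v⟫ * fderiv ℝ φ y (b i) := fun y => by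
    conv_lhs => rw [← b.sum_repr' v]
    simp [map_sum]
  have e2 : ∀ x, φ x * ⟪∑ i, g i x • b i, v⟫ = ∑ i, ⟪b i, v⟫ * (φ x * g i x) := fun x => by
    rw [sum_inner, Finset.mul_sum]
    refine Finset.sum_congr rfl fun i _ => ?_
    rw [real_inner_smul_left]; ring
  have hb : ∃ C, ∀ x, ‖φ x‖ ≤ C := hφ.continuous.bounded_above_of_compact_support hc
  obtain ⟨C, hC⟩ := hb
  simp_rw [e1, e2]
  rw [integral_finsetSum _ fun i _ => ((integrable_fderiv hφ hc (b i)).integrableOn).const_mul _,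
    integral_finsetSum _ fun i _ => (((hg i).bdd_mul hφ.continuous.aestronglyMeasurable
      (ae_of_all _ hC)).const_mul _)]
  refine Finset.sum_congr rfl fun i _ => ?_
  rw [integral_const_mul, integral_const_mul, hgi i φ hφ hc]

open MeasureTheory Metric Set Filter
open scoped ENNReal NNReal Topology RealInnerProductSpace

lemma Split.inner_nu {m : ℕ} {ν : Euc (m+1)} (S : Split m ν) (h : Euc (m+1)) :
    ⟪ν, h⟫ = S.τ h := by
  have h1 := S.norm_sq' (ν + h)
  have h2 := S.norm_sq' h
  rw [norm_add_sq_real, S.norm_nu] at h1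
  simp only [map_add, S.τ_nu, S.q_nu, zero_add] at h1
  nlinarith

lemma tendsto_const_mul_nhdsGT {c : ℝ} (hc : 0 < c) :
    Tendsto (fun r : ℝ => c * r) (𝓝[>] 0) (𝓝[>] 0) := by
  refine tendsto_nhdsWithin_of_tendsto_nhds_of_eventually_within _ ?_ ?_
  · have : Tendsto (fun r : ℝ => c * r) (𝓝 0) (𝓝 (c * 0)) :=
      (continuous_const_mul c).tendsto 0
    rw [mul_zero] at this
    exact this.mono_left nhdsWithin_le_nhds
  · filter_upwards [self_mem_nhdsWithin] with r hr
    have : (0:ℝ) < r := hr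
    exact mul_pos hc this

/-- Claim 1 -/
lemma halfspace_pair {m : ℕ} {F : Set (Euc (m+1))} (hF : MeasurableSet F)
    {lam : Measure (Euc (m+1))} [IsFiniteMeasure lam]
    {σ : Euc (m+1) → Euc (m+1)} (hσi : Integrable σ lam)
    (hσ : ∀ (v : Euc (m+1)) (φ : Euc (m+1) → ℝ), ContDiff ℝ 1 φ →
      HasCompactSupport φ → ∫ y in F, fderiv ℝ φ y v = ∫ x, φ x * ⟪σ x, v⟫ ∂lam)
    {x ν : Euc (m+1)} (S : Split m ν) (hν : ∃ s : ℝ, 0 ≤ s ∧ σ x = s • ν)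
    (hL : ∀ ε : ℝ, 0 < ε → ∀ᶠ r in 𝓝[>] (0:ℝ),
      ∫ y in closedBall x r, ‖σ y - σ x‖ ∂lam ≤ ε * r^m) {ε : ℝ} (hε : 0 < ε) :
    ∀ᶠ r in 𝓝[>] (0:ℝ), ∀ a : ℝ,
      volume {p | (p ∈ ball x r ∧ p ∉ F) ∧ S.τ (p - x) ≤ a} ≤ ENNReal.ofReal (ε * r^(m+1)) ∨
      volume {p | (p ∈ ball x r ∧ p ∈ F) ∧ a ≤ S.τ (p - x)} ≤ ENNReal.ofReal (ε * r^(m+1)) := by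
  set c : ℝ := 2 * 3^m * (omegaBall (m+1) * 2^(m+1)) with hc
  have hω := omega_pos (m+1)
  have hcpos : 0 < c := by positivity
  obtain ⟨s, hs, hsν⟩ := hν
  have h1 := (tendsto_const_mul_nhdsGT (show (0:ℝ) < 3 by norm_num)).eventually
    (hL (ε^2 / c) (by positivity))
  filter_upwards [h1, self_mem_nhdsWithin] with r hr hr0 a
  have hr0' : (0:ℝ) < r := hr0
  apply or_of_mul_le
  set w := ∫ y in closedBall x (3*r), ‖σ y - σ x‖ ∂lam with hw
  have hw0 : 0 ≤ w := integral_nonneg fun _ => norm_nonneg _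
  have hd : Integrable (fun y => ‖σ y - σ x‖) lam := (hσi.sub (integrable_const _)).norm
  have hp := pair_vol_le hF (C := {h | 0 ≤ S.τ h}) (measurableSet_le measurable_const
    S.τ.continuous.measurable) (x := x) (r := r) (ω := w) hw0 (by
      intro h hh φ hφ hcφ hsφ h01
      have hh' : 0 ≤ S.τ h := hh
      rw [hσ h φ hφ hcφ, ← integral_neg]
      obtain ⟨C, hC⟩ := hφ.continuous.bounded_above_of_compact_support hcφ
      have i1 : Integrable (fun y => φ y * ⟪σ y, h⟫) lam :=
        (hσi.inner_const h).bdd_mul hφ.continuous.aestronglyMeasurable (ae_of_all _ hC)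
      rw [hw, ← integral_indicator measurableSet_closedBall, ← integral_const_mul]
      refine integral_mono i1.neg ((hd.indicator measurableSet_closedBall).const_mul _) fun y => ?_
      simp only
      by_cases hy : y ∈ closedBall x (3*r)
      · rw [indicator_of_mem hy]
        have e : ⟪σ y, h⟫ = ⟪σ y - σ x, h⟫ + s * S.τ h := by
          rw [inner_sub_left, hsν, real_inner_smul_left, S.inner_nu]; ring
        rw [e]
        have h3 : -(‖σ y - σ x‖ * ‖h‖) ≤ ⟪σ y - σ x, h⟫ :=
          neg_le_of_abs_le (abs_real_inner_le_norm _ _)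
        have h4 := h01 y
        have h5 : 0 ≤ ‖σ y - σ x‖ * ‖h‖ := by positivity
        have h6 : 0 ≤ φ y * (s * S.τ h) := mul_nonneg h4.1 (mul_nonneg hs hh')
        have h7 : φ y * -(‖σ y - σ x‖ * ‖h‖) ≤ φ y * ⟪σ y - σ x, h⟫ :=
          mul_le_mul_of_nonneg_left h3 h4.1
        nlinarith [h4.2]
      · have : φ y = 0 := image_eq_zero_of_notMem_tsupport fun h' =>
          hy (ball_subset_closedBall (hsφ h'))
        rw [indicator_of_notMem hy, this]
        simp)
  have hsub : {p | (p ∈ ball x r ∧ p ∉ F) ∧ S.τ (p - x) ≤ a} ×ˢ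
      {p | (p ∈ ball x r ∧ p ∈ F) ∧ a ≤ S.τ (p - x)} ⊆
      {z : Euc (m+1) × Euc (m+1) | (z.1 ∈ ball x r ∧ z.1 ∉ F) ∧
      (z.2 ∈ ball x r ∧ z.2 ∈ F) ∧ z.2 - z.1 ∈ {h | 0 ≤ S.τ h}} := by
    rintro ⟨p, q⟩ ⟨⟨h1, h2⟩, h3, h4⟩
    refine ⟨h1, h3, ?_⟩
    simp only [map_sub, mem_ofPred_eq] at h2 h4 ⊢
    linarith
  rw [← Measure.prod_prod]
  refine (measure_mono hsub).trans (hp.trans ?_)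
  rw [vol_ball_real _ (by positivity), ← ENNReal.ofReal_mul (by positivity),
    ← ENNReal.ofReal_mul (by positivity)]
  refine ENNReal.ofReal_le_ofReal ?_
  calc 2 * r * w * (omegaBall (m+1) * (2*r)^(m+1))
      ≤ 2 * r * (ε^2 / c * (3*r)^m) * (omegaBall (m+1) * (2*r)^(m+1)) := by gcongr
    _ = (ε^2 / c) * c * (r^(m+1) * r^(m+1)) := by rw [hc]; ring
    _ = _ := by field_simp

lemma slab_vol {m : ℕ} {ν : Euc (m+1)} (S : Split m ν) (x : Euc (m+1)) {η : ℝ} (hη : 0 < η) :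
    ∃ κ : ℝ, 0 < κ ∧ κ < 1 ∧ ∀ r : ℝ, 0 < r →
      volume {p | p ∈ ball x r ∧ |S.τ (p - x)| ≤ κ * r} ≤ ENNReal.ofReal (η * r^(m+1)) := by
  have hω := omega_pos m
  refine ⟨min (1/2) (η / (4 * omegaBall m)), by positivity,
    (min_le_left _ _).trans_lt (by norm_num), fun r hr => ?_⟩
  set κ := min (1/2) (η / (4 * omegaBall m))
  have hκ : κ * (4 * omegaBall m) ≤ η := by
    rw [← le_div_iff₀ (by positivity)]; exact min_le_right _ _
  have hκ0 : 0 < κ := by positivity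
  have h1 : {p | p ∈ ball x r ∧ |S.τ (p - x)| ≤ κ * r} ⊆
      (fun p => p - x) ⁻¹' (S.e ⁻¹' (Icc (-(κ * r)) (κ * r) ×ˢ ball (0 : Euc m) r)) := by
    rintro p ⟨hp, hp2⟩
    rw [mem_preimage, mem_preimage, S.e_eq]
    refine ⟨abs_le.1 hp2, ?_⟩
    rw [mem_ball_zero_iff]
    rw [mem_ball, dist_eq_norm] at hp
    exact (S.q_le _).trans_lt hp
  refine (measure_mono h1).trans ?_
  have e0 := (measurePreserving_sub_right (volume : Measure (Euc (m+1))) x).measure_preimage_equiv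
    (f := (MeasurableEquiv.subRight x)) (S.e ⁻¹' (Icc (-(κ * r)) (κ * r) ×ˢ ball (0 : Euc m) r))
  refine (le_of_eq e0).trans ?_
  rw [S.vol_preimage, Measure.volume_eq_prod, Measure.prod_prod,
    Real.volume_Icc, vol_ball_real _ hr, ← ENNReal.ofReal_mul (by nlinarith)]
  refine ENNReal.ofReal_le_ofReal ?_
  calc (κ * r - -(κ * r)) * (omegaBall m * r^m) = κ * (2 * omegaBall m) * r^(m+1) := by ring
    _ ≤ η * r^(m+1) := by gcongr; nlinarith

/-- Claim 2: blow-up. -/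
lemma blowup {m : ℕ} {F : Set (Euc (m+1))} (hF : MeasurableSet F)
    {x ν : Euc (m+1)} (S : Split m ν)
    (hP : ∀ ε : ℝ, 0 < ε → ∀ᶠ r in 𝓝[>] (0:ℝ), ∀ a : ℝ,
      volume {p | (p ∈ ball x r ∧ p ∉ F) ∧ S.τ (p - x) ≤ a} ≤ ENNReal.ofReal (ε * r^(m+1)) ∨
      volume {p | (p ∈ ball x r ∧ p ∈ F) ∧ a ≤ S.τ (p - x)} ≤ ENNReal.ofReal (ε * r^(m+1)))
    (hx : x ∈ essBoundary F) {η : ℝ} (hη : 0 < η) :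
    ∃ᶠ r in 𝓝[>] (0:ℝ),
      volume {p | (p ∈ ball x r ∧ p ∈ F) ∧ 0 < S.τ (p - x)} ≤ ENNReal.ofReal (η * r^(m+1)) ∧
      volume {p | (p ∈ ball x r ∧ p ∉ F) ∧ S.τ (p - x) ≤ 0} ≤ ENNReal.ofReal (η * r^(m+1)) := by
  by_contra hcon
  rw [not_frequently] at hcon
  refine zeroDens_or_of_min hF x (fun ε hε => ?_) hx
  obtain ⟨κ, hκ, hκ1, hslab⟩ := slab_vol S x (η := η/2) (by positivity)
  have h1 := hP (min (η/2) (ε * κ^(m+1))) (by positivity)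
  have key : ∀ᶠ r in 𝓝[>] (0:ℝ),
      volume (F ∩ ball x (κ * r)) ≤ ENNReal.ofReal (ε * (κ*r)^(m+1)) ∨
      volume (Fᶜ ∩ ball x (κ * r)) ≤ ENNReal.ofReal (ε * (κ*r)^(m+1)) := by
    filter_upwards [hcon, h1, self_mem_nhdsWithin] with r h2 h3 hr
    have hr' : (0:ℝ) < r := hr
    have hb : ∀ p ∈ ball x (κ * r), p ∈ ball x r ∧ |S.τ (p - x)| ≤ κ * r := fun p hp => by
      have : κ * r ≤ r := by nlinarith
      refine ⟨ball_subset_ball this hp, (S.τ_le _).trans ?_⟩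
      rw [mem_ball, dist_eq_norm] at hp
      exact hp.le
    have hmin1 : ENNReal.ofReal (min (η/2) (ε * κ^(m+1)) * r^(m+1)) ≤
        ENNReal.ofReal (ε * (κ*r)^(m+1)) := by
      refine ENNReal.ofReal_le_ofReal ?_
      rw [mul_pow, ← mul_assoc]
      gcongr
      exact min_le_right _ _
    have hmin2 : ENNReal.ofReal (min (η/2) (ε * κ^(m+1)) * r^(m+1)) ≤
        ENNReal.ofReal (η/2 * r^(m+1)) := by
      refine ENNReal.ofReal_le_ofReal ?_
      gcongr
      exact min_le_left _ _
    have hsum : ENNReal.ofReal (η * r^(m+1)) =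
        ENNReal.ofReal (η/2 * r^(m+1)) + ENNReal.ofReal (η/2 * r^(m+1)) := by
      rw [← ENNReal.ofReal_add (by positivity) (by positivity)]; congr 1; ring
    rw [not_and_or, not_le, not_le] at h2
    rcases h2 with h2 | h2
    · right
      rcases h3 (κ * r) with h4 | h4
      · refine (measure_mono ?_).trans (h4.trans hmin1)
        rintro p ⟨hp, hpb⟩
        exact ⟨⟨(hb p hpb).1, hp⟩, (abs_le.1 (hb p hpb).2).2⟩
      · exfalso
        refine absurd h2 (not_lt.2 ?_)
        rw [hsum]
        refine le_trans ?_ (add_le_add (h4.trans hmin2) (hslab r hr'))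
        refine le_trans (measure_mono ?_) (measure_union_le _ _)
        rintro p ⟨hp, hp2⟩
        rcases le_total (κ * r) (S.τ (p - x)) with h | h
        · exact Or.inl ⟨hp, h⟩
        · exact Or.inr ⟨hp.1, abs_le.2 ⟨by nlinarith, h⟩⟩
    · left
      rcases h3 (-(κ * r)) with h4 | h4
      · exfalso
        refine absurd h2 (not_lt.2 ?_)
        rw [hsum]
        refine le_trans ?_ (add_le_add (h4.trans hmin2) (hslab r hr'))
        refine le_trans (measure_mono ?_) (measure_union_le _ _)
        rintro p ⟨hp, hp2⟩
        rcases le_total (S.τ (p - x)) (-(κ * r)) with h | h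
        · exact Or.inl ⟨hp, h⟩
        · exact Or.inr ⟨hp.1, abs_le.2 ⟨h, by nlinarith⟩⟩
      · refine (measure_mono ?_).trans (h4.trans hmin1)
        rintro p ⟨hp, hpb⟩
        exact ⟨⟨(hb p hpb).1, hp⟩, (abs_le.1 (hb p hpb).2).1⟩
  have h5 := (tendsto_const_mul_nhdsGT (inv_pos.2 hκ)).eventually key
  filter_upwards [h5] with r hr
  rwa [mul_inv_cancel_left₀ hκ.ne'] at hr

open MeasureTheory Metric Set Filter
open scoped ENNReal NNReal Topology RealInnerProductSpace

lemma exists_shape (m : ℕ) {c' : ℝ≥0} (hc : cH m < c') :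
    ∃ (K : Set (Euc m)) (δ v : ℝ), IsCompact K ∧ 0 < δ ∧ 0 < v ∧ v < (volume K).toReal ∧
      (diam K + 4 * δ)^m ≤ c' * v := by
  by_contra hcon
  push Not at hcon
  have hle : (c' • (volume : Measure (Euc m))) ≤ μH[(m:ℝ)] := by
    refine Measure.le_hausdorffMeasure _ _ 1 one_pos fun s hs => ?_
    rw [← ediam_closure]
    refine (measure_mono subset_closure).trans ?_
    set K := closure s with hKdef
    rw [← ediam_closure] at hs
    have hb : Bornology.IsBounded K := Metric.isBounded_iff_ediam_ne_top.2
      (hs.trans_lt ENNReal.one_lt_top).ne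
    have hK : IsCompact K := Metric.isCompact_of_isClosed_isBounded isClosed_closure hb
    have hvfin : volume K ≠ ⊤ := hK.measure_lt_top.ne
    by_contra hlt
    rw [not_le, ENNReal.rpow_natCast, Measure.smul_apply, ENNReal.smul_def, smul_eq_mul] at hlt
    have hd : ediam K = ENNReal.ofReal (diam K) := by
      rw [Metric.diam, ENNReal.ofReal_toReal (hs.trans_lt ENNReal.one_lt_top).ne]
    have hlt' : (diam K)^m < c' * (volume K).toReal := by
      rw [hd, ← ENNReal.ofReal_pow diam_nonneg, ← ENNReal.ofReal_toReal hvfin,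
        ← ENNReal.ofReal_coe_nnreal, ← ENNReal.ofReal_mul (by positivity)] at hlt
      exact (ENNReal.ofReal_lt_ofReal_iff_of_nonneg (by positivity)).1 hlt
    set V := (volume K).toReal
    have hc'pos : (0:ℝ) < c' := lt_of_le_of_lt (by positivity) (show (cH m : ℝ) < c' from hc)
    have hVpos : 0 < V := by
      have : 0 < (c':ℝ) * V := lt_of_le_of_lt (by positivity) hlt'
      exact (mul_pos_iff_of_pos_left hc'pos).1 this
    -- choose v
    have hv1 : (diam K)^m / c' < V := by rw [div_lt_iff₀ hc'pos]; linarith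
    obtain ⟨v, hv, hvV⟩ := exists_between (max_lt hv1 hVpos)
    have hv0 : 0 < v := (le_max_right _ _).trans_lt hv
    have hv2 : (diam K)^m < c' * v := by
      have := (le_max_left _ _).trans_lt hv
      rw [div_lt_iff₀ hc'pos] at this; linarith
    have hcont : Tendsto (fun δ : ℝ => (diam K + 4 * δ)^m) (𝓝[>] 0) (𝓝 ((diam K + 4 * 0)^m)) := by
      have : Continuous (fun δ : ℝ => (diam K + 4 * δ)^m) := by fun_prop
      exact (this.tendsto 0).mono_left nhdsWithin_le_nhds
    rw [mul_zero, add_zero] at hcont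
    obtain ⟨δ, hδ1, hδ⟩ := ((hcont.eventually_lt_const hv2).and self_mem_nhdsWithin).exists
    exact absurd hδ1.le (not_le.2 (hcon K δ v hK hδ hv0 hvV))
  have h1 := hle (ball 0 1)
  rw [hausdorff_eq, Measure.smul_apply, Measure.smul_apply, ENNReal.smul_def, ENNReal.smul_def,
    smul_eq_mul, smul_eq_mul] at h1
  have h2 : volume (ball (0:Euc m) 1) ≠ 0 := (measure_ball_pos volume _ one_pos).ne'
  have h3 : volume (ball (0:Euc m) 1) ≠ ⊤ := measure_ball_lt_top.ne
  rw [ENNReal.mul_le_mul_iff_left h2 h3] at h1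
  exact absurd (ENNReal.coe_le_coe.1 h1) (not_le.2 hc)

/-- the test function -/
lemma test_fun {m : ℕ} {ν : Euc (m+1)} (S : Split m ν) {ψ1 : Euc m → ℝ} {ψ2 : ℝ → ℝ}
    (h1 : ContDiff ℝ 1 ψ1) (h1c : HasCompactSupport ψ1)
    (h2 : ContDiff ℝ 1 ψ2) (h2c : HasCompactSupport ψ2) :
    ContDiff ℝ 1 (fun z => ψ2 (S.τ z) * ψ1 (S.q z)) ∧
    HasCompactSupport (fun z => ψ2 (S.τ z) * ψ1 (S.q z)) ∧
    (∀ z, fderiv ℝ (fun z => ψ2 (S.τ z) * ψ1 (S.q z)) z ν = deriv ψ2 (S.τ z) * ψ1 (S.q z)) ∧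
    ∫ z in {z | S.τ z ≤ 0}, fderiv ℝ (fun z => ψ2 (S.τ z) * ψ1 (S.q z)) z ν
      = ψ2 0 * ∫ p, ψ1 p := by
  have hC : ContDiff ℝ 1 (fun z => ψ2 (S.τ z) * ψ1 (S.q z)) :=
    (h2.comp S.τ.contDiff).mul (h1.comp S.q.contDiff)
  have hf : ∀ z, fderiv ℝ (fun z => ψ2 (S.τ z) * ψ1 (S.q z)) z ν
      = deriv ψ2 (S.τ z) * ψ1 (S.q z) := by
    intro z
    rw [← (hC.differentiable one_ne_zero z).lineDeriv_eq_fderiv, lineDeriv]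
    have e : (fun t : ℝ => ψ2 (S.τ (z + t • ν)) * ψ1 (S.q (z + t • ν)))
        = fun t : ℝ => ψ2 (S.τ z + t) * ψ1 (S.q z) := by
      funext t; simp
    rw [e, deriv_mul_const (by
      have := (h2.differentiable one_ne_zero).comp (differentiable_id.const_add (S.τ z))
      exact this 0)]
    congr 1
    rw [deriv_comp_const_add, add_zero]
  refine ⟨hC, ?_, hf, ?_⟩
  · refine HasCompactSupport.intro (K := S.e.symm '' (tsupport ψ2 ×ˢ tsupport ψ1))
      ((h2c.isCompact.prod h1c.isCompact).image S.e.symm.continuous) fun z hz => ?_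
    by_contra hne
    refine hz ⟨S.e z, ⟨?_, ?_⟩, S.e.symm_apply_apply z⟩
    · exact subset_tsupport _ (left_ne_zero_of_mul hne)
    · exact subset_tsupport _ (right_ne_zero_of_mul hne)
  · simp_rw [hf]
    have e1 : {z | S.τ z ≤ 0} = S.e ⁻¹' (Iic (0:ℝ) ×ˢ univ) := by
      ext z; rw [mem_preimage, S.e_eq]; simp
    have h3 := S.mp.setIntegral_preimage_emb S.e.toHomeomorph.measurableEmbedding
      (fun p : ℝ × Euc m => deriv ψ2 p.1 * ψ1 p.2) (Iic (0:ℝ) ×ˢ univ)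
    rw [e1]
    refine h3.trans ?_
    rw [Measure.volume_eq_prod, setIntegral_prod_mul, setIntegral_univ]
    congr 1
    have hd2 : Continuous (deriv ψ2) := h2.continuous_deriv le_rfl
    have h4 := integral_Iic_of_hasDerivAt_of_tendsto' (a := 0) (f := ψ2) (f' := deriv ψ2) (m := 0)
      (fun t _ => (h2.differentiable one_ne_zero t).hasDerivAt)
      (hd2.integrable_of_hasCompactSupport h2c.deriv).integrableOn ?_
    · rw [h4, sub_zero]
    · have := h2c.is_zero_at_infty
      refine this.mono_left ?_
      rw [cocompact_eq_atBot_atTop]; exact le_sup_left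

open MeasureTheory Metric Set Filter
open scoped ENNReal NNReal Topology RealInnerProductSpace

lemma setIntegral_compare {n : ℕ} {F H B : Set (Euc n)} (hF : MeasurableSet F) (hH : MeasurableSet H)
    (hB : MeasurableSet B) (hBfin : volume B ≠ ⊤)
    {G : Euc n → ℝ} (hG : Integrable G) {C a : ℝ} (hC : ∀ y, |G y| ≤ C) (ha : 0 ≤ a)
    (hG0 : ∀ y ∉ B, G y = 0)
    (h1 : volume {p | (p ∈ B ∧ p ∈ F) ∧ p ∉ H} ≤ ENNReal.ofReal a)
    (h2 : volume {p | (p ∈ B ∧ p ∉ F) ∧ p ∈ H} ≤ ENNReal.ofReal a) :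
    (∫ y in H, G y) - C * (2 * a) ≤ ∫ y in F, G y := by
  have hC0 : 0 ≤ C := (abs_nonneg _).trans (hC 0)
  set A1 := {p | (p ∈ B ∧ p ∈ F) ∧ p ∉ H} with hA1
  set A2 := {p | (p ∈ B ∧ p ∉ F) ∧ p ∈ H} with hA2
  have m1 : MeasurableSet A1 := (hB.inter hF).inter hH.compl
  have m2 : MeasurableSet A2 := (hB.inter hF.compl).inter hH
  have f1 : volume A1 ≠ ⊤ := (h1.trans_lt ENNReal.ofReal_lt_top).ne
  have f2 : volume A2 ≠ ⊤ := (h2.trans_lt ENNReal.ofReal_lt_top).ne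
  have i1 : Integrable (A1.indicator (fun _ => C)) :=
    (integrable_indicator_iff m1).2 (integrableOn_const f1)
  have i2 : Integrable (A2.indicator (fun _ => C)) :=
    (integrable_indicator_iff m2).2 (integrableOn_const f2)
  have h3 : ∫ y, (H.indicator G y - F.indicator G y) ≤
      ∫ y, (A1.indicator (fun _ => C) y + A2.indicator (fun _ => C) y) := by
    refine integral_mono ((hG.indicator hH).sub (hG.indicator hF)) (i1.add i2) fun y => ?_
    simp only
    have h4 := abs_le.1 (hC y)
    have p1 : 0 ≤ A1.indicator (fun _ => C) y := indicator_nonneg (fun _ _ => hC0) _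
    have p2 : 0 ≤ A2.indicator (fun _ => C) y := indicator_nonneg (fun _ _ => hC0) _
    by_cases hy : y ∈ B
    · by_cases hyF : y ∈ F <;> by_cases hyH : y ∈ H
      · simp only [indicator_of_mem hyF, indicator_of_mem hyH]; linarith
      · have e : A1.indicator (fun _ => C) y = C := indicator_of_mem (show y ∈ A1 from ⟨⟨hy, hyF⟩, hyH⟩) _
        rw [indicator_of_mem hyF, indicator_of_notMem hyH]; linarith
      · have e : A2.indicator (fun _ => C) y = C := indicator_of_mem (show y ∈ A2 from ⟨⟨hy, hyF⟩, hyH⟩) _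
        rw [indicator_of_notMem hyF, indicator_of_mem hyH]; linarith
      · simp only [indicator_of_notMem hyF, indicator_of_notMem hyH]; linarith
    · have : ∀ s : Set (Euc n), s.indicator G y = 0 := fun s => by
        by_cases hs : y ∈ s
        · rw [indicator_of_mem hs, hG0 y hy]
        · rw [indicator_of_notMem hs]
      rw [this, this]; linarith
  rw [integral_sub (hG.indicator hH) (hG.indicator hF), integral_add i1 i2,
    integral_indicator hH, integral_indicator hF, integral_indicator m1, integral_indicator m2] at h3
  simp only [integral_const, smul_eq_mul, Measure.real, Measure.restrict_apply_univ] at h3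
  have b1 : (volume A1).toReal ≤ a := ENNReal.toReal_le_of_le_ofReal ha h1
  have b2 : (volume A2).toReal ≤ a := ENNReal.toReal_le_of_le_ofReal ha h2
  nlinarith

lemma scaled_integral {m : ℕ} {ν : Euc (m+1)} (S : Split m ν) (x : Euc (m+1)) {r : ℝ} (hr : 0 < r)
    (g : Euc (m+1) → ℝ) :
    ∫ y in {y | S.τ (y - x) ≤ 0}, g (r⁻¹ • (y - x)) = r^(m+1) * ∫ z in {z | S.τ z ≤ 0}, g z := by
  have m1 : MeasurableSet {z | S.τ z ≤ 0} := measurableSet_le S.τ.continuous.measurable measurable_const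
  have m2 : MeasurableSet {y | S.τ (y - x) ≤ 0} := measurableSet_le
    (S.τ.continuous.measurable.comp (measurable_id.sub_const x)) measurable_const
  rw [← integral_indicator m1, ← integral_indicator m2]
  have e : {y | S.τ (y - x) ≤ 0}.indicator (fun y => g (r⁻¹ • (y - x)))
      = fun y => (fun w => ({z | S.τ z ≤ 0}.indicator g) (r⁻¹ • w)) (y - x) := by
    funext y
    by_cases hy : S.τ (y - x) ≤ 0
    · have : r⁻¹ • (y - x) ∈ {z | S.τ z ≤ 0} := by
        simp only [mem_ofPred_eq, map_smul, smul_eq_mul]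
        exact mul_nonpos_of_nonneg_of_nonpos (by positivity) hy
      rw [indicator_of_mem (show y ∈ {y | S.τ (y - x) ≤ 0} from hy)]
      simp only [indicator_of_mem this]
    · have : r⁻¹ • (y - x) ∉ {z | S.τ z ≤ 0} := by
        simp only [mem_ofPred_eq, map_smul, smul_eq_mul, not_le] at hy ⊢
        positivity
      rw [indicator_of_notMem (show y ∉ {y | S.τ (y - x) ≤ 0} from hy)]
      simp only [indicator_of_notMem this]
  rw [e, integral_sub_right_eq_self (μ := volume)
    (fun w => ({z | S.τ z ≤ 0}.indicator g) (r⁻¹ • w)) x,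
    Measure.integral_comp_smul_of_nonneg _ _ _ (hR := by positivity)]
  simp

lemma shape_at {m : ℕ} {K : Set (Euc m)} {δ v R0 : ℝ} (hK : IsCompact K) (hδ : 0 < δ)
    (hv0 : 0 < v) (hvK : v < (volume K).toReal) (hR0 : K ⊆ closedBall 0 R0)
    {F : Set (Euc (m+1))} (hF : MeasurableSet F)
    {lam : Measure (Euc (m+1))} [IsFiniteMeasure lam] (hD : DomBy F lam)
    {x ν : Euc (m+1)} (S : Split m ν)
    (hb : ∀ η : ℝ, 0 < η → ∃ᶠ r in 𝓝[>] (0:ℝ),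
      volume {p | (p ∈ ball x r ∧ p ∈ F) ∧ 0 < S.τ (p - x)} ≤ ENNReal.ofReal (η * r^(m+1)) ∧
      volume {p | (p ∈ ball x r ∧ p ∉ F) ∧ S.τ (p - x) ≤ 0} ≤ ENNReal.ofReal (η * r^(m+1))) :
    ∃ᶠ r in 𝓝[>] (0:ℝ), ∃ T : Set (Euc (m+1)), IsClosed T ∧ (interior T).Nonempty ∧
      T ⊆ closedBall x ((|R0| + 2 * δ + 1) * r) ∧ ENNReal.ofReal (v * r^m) ≤ lam T ∧
      ediam T ≤ ENNReal.ofReal (r * (diam K + 4 * δ)) := by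
  set R := |R0| + 2 * δ + 1 with hR
  have hRpos : 0 < R := by positivity
  have hKne : K.Nonempty := by
    rw [nonempty_iff_ne_empty]; rintro rfl; simp at hvK; linarith
  obtain ⟨ψ1, h1, h1c, h1s, h101, h1K⟩ := exists_bump hK (isOpen_thickening (δ := δ) (E := K))
    (self_subset_thickening hδ K)
  set bp : ContDiffBump (0:ℝ) := ⟨δ/2, δ, by positivity, by linarith⟩ with hbp
  obtain ⟨hC, hcs, hfd, hInteg⟩ := test_fun S h1 h1c (bp.contDiff (n := 1)) bp.hasCompactSupport
  set φ0 : Euc (m+1) → ℝ := fun z => bp (S.τ z) * ψ1 (S.q z) with hφ0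
  set g : Euc (m+1) → ℝ := fun z => fderiv ℝ φ0 z ν with hg
  have hgc : Continuous g := (hC.continuous_fderiv one_ne_zero).clm_apply continuous_const
  have hgcs : HasCompactSupport g := hcs.fderiv_apply ℝ ν
  obtain ⟨C, hCb⟩ := hgc.bounded_above_of_compact_support hgcs
  have hC0 : 0 ≤ C := (norm_nonneg _).trans (hCb 0)
  have hbp0 : bp 0 = 1 := bp.one_of_mem_closedBall (by simp [hbp]; positivity)
  have hI0 : (volume K).toReal ≤ ∫ p, ψ1 p := by
    have e : (volume K).toReal = ∫ p, K.indicator (fun _ => (1:ℝ)) p := by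
      rw [integral_indicator hK.measurableSet]; simp [Measure.real]
    rw [e]
    refine integral_mono ((integrable_indicator_iff hK.measurableSet).2
      (integrableOn_const hK.measure_lt_top.ne))
      (h1.continuous.integrable_of_hasCompactSupport h1c) fun p => ?_
    by_cases hp : p ∈ K
    · simp only [indicator_of_mem hp]; exact (h1K p hp).ge
    · rw [indicator_of_notMem hp]; exact (h101 p).1
  set T0 : Set (Euc (m+1)) := {z | |S.τ z| ≤ δ ∧ S.q z ∈ cthickening δ K} with hT0
  have hT0c : IsClosed T0 := (isClosed_le (S.τ.continuous.abs) continuous_const).inter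
    (isClosed_cthickening.preimage S.q.continuous)
  have hφT : ∀ z ∉ T0, φ0 z = 0 := by
    intro z hz
    by_contra hne
    refine hz ⟨?_, ?_⟩
    · have : S.τ z ∈ Function.support bp := left_ne_zero_of_mul hne
      rw [bp.support_eq] at this
      simpa [hbp] using (mem_ball.1 this).le
    · exact thickening_subset_cthickening _ _ (h1s (subset_tsupport _ (right_ne_zero_of_mul hne)))
  have hcth : ∀ p ∈ cthickening δ K, ∃ k ∈ K, dist p k ≤ δ := by
    intro p hp
    rw [hK.cthickening_eq_biUnion_closedBall hδ.le] at hp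
    simpa using hp
  have hT0b : ∀ z ∈ T0, ‖z‖ < R := by
    intro z hz
    obtain ⟨k, hk, hkd⟩ := hcth _ hz.2
    have h5 := hR0 hk
    rw [mem_closedBall_zero_iff] at h5
    have h6 : ‖S.q z‖ ≤ ‖k‖ + δ := by
      rw [dist_eq_norm] at hkd
      have := norm_add_le (S.q z - k) k
      rw [sub_add_cancel] at this; linarith
    have := S.norm_le z
    have := hz.1
    have := le_abs_self R0
    simp only [hR]; linarith
  have hgT : ∀ z ∉ T0, g z = 0 := by
    intro z hz
    have : φ0 =ᶠ[𝓝 z] fun _ => 0 := by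
      filter_upwards [hT0c.isOpen_compl.mem_nhds hz] with w hw using hφT w hw
    simp only [hg]
    rw [this.fderiv_eq]; simp
  -- choose η
  set η : ℝ := ((volume K).toReal - v) / (2 * (C + 1) * R^(m+1)) with hη
  have hηpos : 0 < η := by
    have : 0 < (volume K).toReal - v := by linarith
    positivity
  have hηC : C * (2 * (η * R^(m+1))) ≤ (volume K).toReal - v := by
    have e : (C+1) * (2 * (η * R^(m+1))) = (volume K).toReal - v := by rw [hη]; field_simp
    have : 0 ≤ 2 * (η * R^(m+1)) := by positivity
    nlinarith
  refine (tendsto_const_mul_nhdsGT (inv_pos.2 hRpos)).frequently ?_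
  refine ((hb η hηpos).and_eventually self_mem_nhdsWithin).mono ?_
  rintro ρ ⟨⟨hb1, hb2⟩, hρ⟩
  have hρ' : (0:ℝ) < ρ := hρ
  set r := R⁻¹ * ρ with hr
  have hrpos : 0 < r := by positivity
  have hρr : ρ = R * r := by rw [hr]; field_simp
  rw [hρr] at hb1 hb2
  set T : Set (Euc (m+1)) := (fun y => r⁻¹ • (y - x)) ⁻¹' T0 with hT
  have hTball : T ⊆ ball x (R * r) := by
    intro y hy
    have := hT0b _ hy
    rw [norm_smul, norm_inv, Real.norm_eq_abs, abs_of_pos hrpos, inv_mul_lt_iff₀ hrpos] at this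
    rw [mem_ball, dist_eq_norm]; linarith
  have hsc : Continuous (fun y : Euc (m+1) => r⁻¹ • (y - x)) := by fun_prop
  have hTcl : IsClosed T := hT0c.preimage hsc
  refine ⟨T, hTcl, ?_, hTball.trans ball_subset_closedBall, ?_, ?_⟩
  · -- interior
    obtain ⟨k, hk⟩ := hKne
    refine ⟨x + r • S.e.symm (0, k), ?_⟩
    refine interior_maximal (t := (fun y => r⁻¹ • (y - x)) ⁻¹'
      {z | |S.τ z| < δ ∧ S.q z ∈ thickening δ K}) ?_ ?_ ?_
    · intro y hy
      exact ⟨hy.1.le, thickening_subset_cthickening _ _ hy.2⟩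
    · exact ((isOpen_lt (S.τ.continuous.abs) continuous_const).inter
        (isOpen_thickening.preimage S.q.continuous)).preimage hsc
    · have e : r⁻¹ • (x + r • S.e.symm (0, k) - x) = S.e.symm (0, k) := by
        rw [add_sub_cancel_left, smul_smul, inv_mul_cancel₀ hrpos.ne', one_smul]
      rw [mem_preimage, e]
      refine ⟨?_, ?_⟩
      · rw [S.symm_τ]; simpa using hδ
      · rw [S.symm_q]; exact self_subset_thickening hδ K hk
  · -- measure bound
    set φ : Euc (m+1) → ℝ := fun y => φ0 (r⁻¹ • (y - x)) with hφ
    have hφC : ContDiff ℝ 1 φ := hC.comp (by fun_prop)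
    have hφT' : ∀ y ∉ T, φ y = 0 := fun y hy => hφT _ hy
    have hTcomp : IsCompact T := Metric.isCompact_of_isClosed_isBounded hTcl
      (isBounded_ball.subset hTball)
    have hφcs : HasCompactSupport φ := HasCompactSupport.intro hTcomp hφT'
    have hφs : tsupport φ ⊆ T := closure_minimal (fun y hy => by
      by_contra h; exact hy (hφT' y h)) hTcl
    have hφ01 : ∀ y, φ y ∈ Icc (0:ℝ) 1 := fun y =>
      ⟨mul_nonneg bp.nonneg (h101 _).1, mul_le_one₀ bp.le_one (h101 _).1 (h101 _).2⟩
    have hfd' : ∀ y, fderiv ℝ φ y ν = r⁻¹ * g (r⁻¹ • (y - x)) := by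
      intro y
      have hin : HasFDerivAt (fun y : Euc (m+1) => r⁻¹ • (y - x))
          (r⁻¹ • ContinuousLinearMap.id ℝ (Euc (m+1))) y :=
        ((hasFDerivAt_id y).sub_const x).const_smul r⁻¹
      have := ((hC.differentiable one_ne_zero (r⁻¹ • (y - x))).hasFDerivAt.comp y hin).fderiv
      have e : φ = φ0 ∘ fun y => r⁻¹ • (y - x) := rfl
      rw [e, this]
      simp [hg]
    have hDν := hD ν φ hφC hφcs
    rw [S.norm_nu, one_mul] at hDν
    have hle := (le_abs_self _).trans (hDν.trans
      (integral_le_of_tsupport lam hTcl.measurableSet hφC hφcs hφs hφ01))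
    simp_rw [hfd'] at hle
    rw [integral_const_mul] at hle
    have hGc : Continuous (fun y => g (r⁻¹ • (y - x))) := hgc.comp hsc
    have hGcs : HasCompactSupport (fun y => g (r⁻¹ • (y - x))) :=
      HasCompactSupport.intro hTcomp fun y hy => hgT _ hy
    have hmH : MeasurableSet {y | S.τ (y - x) ≤ 0} := measurableSet_le
      (S.τ.continuous.measurable.comp (measurable_id.sub_const x)) measurable_const
    have hcmp := setIntegral_compare hF hmH (measurableSet_ball (x := x) (ε := R * r))
      measure_ball_lt_top.ne (hGc.integrable_of_hasCompactSupport hGcs) (C := C)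
      (a := η * (R*r)^(m+1)) (fun y => hCb _) (by positivity)
      (fun y hy => hgT _ fun h => hy (hTball h)) (by simpa using hb1) hb2
    rw [scaled_integral S x hrpos g, hInteg, hbp0, one_mul] at hcmp
    have hfin : v * r^m ≤ lam.real T := by
      refine le_trans ?_ hle
      rw [le_inv_mul_iff₀ hrpos]
      refine le_trans ?_ hcmp
      have e1 : C * (2 * (η * (R*r)^(m+1))) = C * (2 * (η * R^(m+1))) * r^(m+1) := by ring
      have e2 : r * (v * r^m) = v * r^(m+1) := by ring
      rw [e1, e2]
      have : 0 < r^(m+1) := by positivity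
      nlinarith
    exact ENNReal.ofReal_le_of_le_toReal hfin
  · -- diameter
    refine ediam_le fun y hy z hz => ?_
    rw [edist_dist]
    refine ENNReal.ofReal_le_ofReal ?_
    obtain ⟨k, hk, hkd⟩ := hcth _ hy.2
    obtain ⟨k', hk', hkd'⟩ := hcth _ hz.2
    have h3 := dist_le_diam_of_mem hK.isBounded hk hk'
    set y' := r⁻¹ • (y - x)
    set z' := r⁻¹ • (z - x)
    have h4 : ‖y' - z'‖ ≤ diam K + 4 * δ := by
      refine (S.norm_le _).trans ?_
      have h5 : |S.τ (y' - z')| ≤ 2 * δ := by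
        rw [map_sub]; exact (abs_sub _ _).trans (by linarith [hy.1, hz.1])
      have h6 : ‖S.q (y' - z')‖ ≤ diam K + 2 * δ := by
        rw [map_sub, ← dist_eq_norm]
        refine (dist_triangle4 _ k k' _).trans ?_
        rw [dist_comm k'] ; linarith
      linarith
    have h7 : y' - z' = r⁻¹ • (y - z) := by
      rw [← smul_sub]; congr 1; abel
    rw [h7, norm_smul, norm_inv, Real.norm_eq_abs, abs_of_pos hrpos, inv_mul_le_iff₀ hrpos] at h4
    rwa [dist_eq_norm]

open MeasureTheory Metric Set Filter
open scoped ENNReal NNReal Topology RealInnerProductSpace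

lemma shape_bound {m : ℕ} {F : Set (Euc (m+1))} (hF : MeasurableSet F)
    {lam : Measure (Euc (m+1))} [IsFiniteMeasure lam] (hD : DomBy F lam)
    {S U : Set (Euc (m+1))} (hS : S ⊆ essBoundary F) (hU : IsOpen U) (hSU : S ⊆ U)
    {R D v M ρ : ℝ} {c' : ℝ≥0} (hR : 0 < R) (hD0 : 0 < D) (hv : 0 < v) (hM : 0 ≤ M) (hρ : 0 < ρ)
    (hc : D^m ≤ c' * v)
    (hup : ∀ x ∈ S, ∀ r : ℝ, 0 < r → r < ρ → lam (closedBall x r) ≤ ENNReal.ofReal (M * r^m))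
    (hT : ∀ x ∈ S, ∃ᶠ r in 𝓝[>] (0:ℝ), ∃ T : Set (Euc (m+1)), IsClosed T ∧ (interior T).Nonempty ∧
      T ⊆ closedBall x (R * r) ∧ ENNReal.ofReal (v * r^m) ≤ lam T ∧
      ediam T ≤ ENNReal.ofReal (r * D)) :
    μH[(m:ℝ)] S ≤ c' * lam U := by
  have hRr : ∀ r : ℝ, 0 < r → ENNReal.ofReal (M * (3 * (R * r))^m) =
      ENNReal.ofReal (M * (3 * R)^m / v) * ENNReal.ofReal (v * r^m) := by
    intro r hr
    rw [← ENNReal.ofReal_mul (by positivity)]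
    congr 1
    rw [show 3 * (R * r) = (3 * R) * r by ring, mul_pow (3*R) r]
    field_simp
  have key : ∀ δ : ℝ, 0 < δ → ∃ u : Set (Euc (m+1) × ℝ × Set (Euc (m+1))), u.Countable ∧
      lam (S \ ⋃ i ∈ u, i.2.2) = 0 ∧
      (∀ i ∈ u, ediam (i.2.2) ≤ ENNReal.ofReal δ) ∧
      ∑' i : u, ediam ((i : Euc (m+1) × ℝ × Set (Euc (m+1))).2.2) ^ (m:ℝ) ≤ c' * lam U := by
    intro δ hδ
    set I : Set (Euc (m+1) × ℝ × Set (Euc (m+1))) := {p | p.1 ∈ S ∧ 0 < p.2.1 ∧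
      3 * (R * p.2.1) < ρ ∧ p.2.1 * D ≤ δ ∧ closedBall p.1 (R * p.2.1) ⊆ U ∧
      IsClosed p.2.2 ∧ (interior p.2.2).Nonempty ∧ p.2.2 ⊆ closedBall p.1 (R * p.2.1) ∧
      ENNReal.ofReal (v * p.2.1^m) ≤ lam p.2.2 ∧ ediam p.2.2 ≤ ENNReal.ofReal (p.2.1 * D)} with hI
    obtain ⟨u, huI, hu, hdisj, hnull⟩ := Vitali.exists_disjoint_covering_ae lam S I
      (Real.toNNReal (M * (3 * R)^m / v)) (fun p => R * p.2.1) (fun p => p.1) (fun p => p.2.2)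
      (fun p hp => hp.2.2.2.2.2.2.2.1)
      (fun p hp => by
        obtain ⟨h1, h2, h3, h4, h5, h6, h7, h8, h9, h10⟩ := hp
        refine (hup p.1 h1 _ (by positivity) h3).trans ?_
        rw [hRr _ h2]
        change _ ≤ ENNReal.ofReal (M * (3 * R)^m / v) * _
        gcongr)
      (fun p hp => hp.2.2.2.2.2.2.1) (fun p hp => hp.2.2.2.2.2.1)
      (fun x hx ε hε => by
        obtain ⟨η, hη, hηU⟩ := Metric.isOpen_iff.1 hU x (hSU hx)
        have hev : ∀ᶠ r in 𝓝[>] (0:ℝ), 0 < r ∧ r < ρ / (3 * R) ∧ r < δ / D ∧ r < η / R ∧ r < ε / R := by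
          filter_upwards [Ioo_mem_nhdsGT (show (0:ℝ) < ρ / (3*R) by positivity),
            Ioo_mem_nhdsGT (show (0:ℝ) < δ / D by positivity),
            Ioo_mem_nhdsGT (show (0:ℝ) < η / R by positivity),
            Ioo_mem_nhdsGT (show (0:ℝ) < ε / R by positivity)] with r h1 h2 h3 h4
          exact ⟨h1.1, h1.2, h2.2, h3.2, h4.2⟩
        obtain ⟨r, ⟨T, hT1, hT2, hT3, hT4, hT5⟩, h1, h2, h3, h4, h5⟩ := ((hT x hx).and_eventually hev).exists
        rw [lt_div_iff₀ (by positivity)] at h2 h3 h4 h5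
        refine ⟨(x, r, T), ⟨hx, h1, by simp only; linarith, h3.le, ?_, hT1, hT2, hT3, hT4, hT5⟩,
          by simp only; linarith, rfl⟩
        exact (closedBall_subset_ball (by simp only; linarith)).trans hηU)
    refine ⟨u, hu, hnull, fun i hi => ?_, ?_⟩
    · obtain ⟨h1, h2, h3, h4, h5, h6, h7, h8, h9, h10⟩ := huI hi
      exact h10.trans (ENNReal.ofReal_le_ofReal h4)
    · have h1 : ∀ i : u, ediam ((i : Euc (m+1) × ℝ × Set (Euc (m+1))).2.2) ^ (m:ℝ) ≤ c' * lam (i : Euc (m+1) × ℝ × Set (Euc (m+1))).2.2 := by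
        rintro ⟨i, hi⟩
        obtain ⟨h1, h2, h3, h4, h5, h6, h7, h8, h9, h10⟩ := huI hi
        rw [ENNReal.rpow_natCast]
        calc ediam i.2.2 ^ m ≤ ENNReal.ofReal (i.2.1 * D) ^ m := by gcongr
          _ = ENNReal.ofReal (i.2.1^m * D^m) := by
              rw [← ENNReal.ofReal_pow (by positivity), mul_pow]
          _ ≤ ENNReal.ofReal (c' * (v * i.2.1^m)) := by
              apply ENNReal.ofReal_le_ofReal
              have : 0 ≤ i.2.1^m := by positivity
              nlinarith
          _ = c' * ENNReal.ofReal (v * i.2.1^m) := by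
              rw [ENNReal.ofReal_mul (NNReal.coe_nonneg c'), ENNReal.ofReal_coe_nnreal]
          _ ≤ _ := by gcongr
      refine (ENNReal.tsum_le_tsum h1).trans ?_
      rw [ENNReal.tsum_mul_left]
      gcongr
      rw [← measure_biUnion (f := fun p : Euc (m+1) × ℝ × Set (Euc (m+1)) => p.2.2) hu hdisj
        (fun p hp => (huI hp).2.2.2.2.2.1.measurableSet)]
      refine measure_mono (iUnion₂_subset fun p hp => ?_)
      exact (huI hp).2.2.2.2.2.2.2.1.trans (huI hp).2.2.2.2.1
  have hpos : ∀ k : ℕ, (0:ℝ) < 1 / ((k:ℝ)+1) := fun k => by positivity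
  choose u hu hnull hdiam hsum using fun k : ℕ => key (1 / ((k:ℝ)+1)) (hpos k)
  set N := ⋃ k, (S \ ⋃ i ∈ u k, i.2.2) with hN
  have hN0 : μH[(m:ℝ)] N = 0 := measure_iUnion_null fun k =>
    null_of_null hF hD (sdiff_subset.trans hS) (hnull k)
  have h2 : μH[(m:ℝ)] (S \ N) ≤ c' * lam U := by
    refine hausdorff_cover (fun p : Euc (m+1) × ℝ × Set (Euc (m+1)) => p.2.2) fun δ hδ => ?_
    obtain ⟨k, hk⟩ := exists_nat_one_div_lt hδ
    refine ⟨u k, hu k, ?_, fun i hi => (hdiam k i hi).trans (ENNReal.ofReal_le_ofReal hk.le), hsum k⟩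
    intro x hx
    by_contra h
    exact hx.2 (mem_iUnion.2 ⟨k, hx.1, h⟩)
  calc μH[(m:ℝ)] S ≤ μH[(m:ℝ)] ((S \ N) ∪ N) := measure_mono (by
        intro x hx; by_cases h : x ∈ N; exacts [Or.inr h, Or.inl ⟨hx, h⟩])
    _ ≤ μH[(m:ℝ)] (S \ N) + μH[(m:ℝ)] N := measure_union_le _ _
    _ ≤ c' * lam U := by rw [hN0, add_zero]; exact h2

lemma lebesgue_conv {m : ℕ} {lam : Measure (Euc (m+1))} [IsFiniteMeasure lam]
    {σ : Euc (m+1) → Euc (m+1)} {x : Euc (m+1)}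
    (h : Tendsto (fun r => ⨍ y in closedBall x r, ‖σ y - σ x‖ ∂lam) (𝓝[>] (0:ℝ)) (𝓝 0))
    {M ρ : ℝ} (hM : 0 ≤ M) (hρ : 0 < ρ)
    (hup : ∀ r : ℝ, 0 < r → r < ρ → lam (closedBall x r) ≤ ENNReal.ofReal (M * r^m))
    {ε : ℝ} (hε : 0 < ε) :
    ∀ᶠ r in 𝓝[>] (0:ℝ), ∫ y in closedBall x r, ‖σ y - σ x‖ ∂lam ≤ ε * r^m := by
  have h1 := (tendsto_order.1 h).2 (ε / (M+1)) (by positivity)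
  filter_upwards [h1, Ioo_mem_nhdsGT hρ] with r h2 h3
  have h4 := ENNReal.toReal_le_of_le_ofReal (by have := h3.1; positivity) (hup r h3.1 h3.2)
  rw [setAverage_eq, smul_eq_mul] at h2
  have hr : 0 < r^m := pow_pos h3.1 _
  set I := ∫ y in closedBall x r, ‖σ y - σ x‖ ∂lam with hI
  have hI0 : 0 ≤ I := integral_nonneg fun _ => norm_nonneg _
  change lam.real _ ≤ _ at h4
  rcases eq_or_lt_of_le (measureReal_nonneg (μ := lam) (s := closedBall x r)) with h0 | h0
  · have : lam (closedBall x r) = 0 := by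
      rw [measureReal_def, eq_comm, ENNReal.toReal_eq_zero_iff] at h0
      exact h0.resolve_right (measure_ne_top _ _)
    have : I = 0 := by rw [hI, Measure.restrict_eq_zero.2 this, integral_zero_measure]
    rw [this]; positivity
  · rw [inv_mul_lt_iff₀ h0] at h2
    refine h2.le.trans ?_
    calc lam.real (closedBall x r) * (ε / (M+1)) ≤ (M * r^m) * (ε / (M+1)) := by gcongr
      _ = (M/(M+1)) * (ε * r^m) := by field_simp
      _ ≤ 1 * (ε * r^m) := by
        gcongr
        rw [div_le_one (by positivity)]; linarith
      _ = _ := one_mul _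

/-- Part II: domination of the Hausdorff measure of the essential boundary. -/
theorem ess_le {m : ℕ} {F : Set (Euc (m+1))} (hF : MeasurableSet F)
    {lam : Measure (Euc (m+1))} [IsFiniteMeasure lam] (hD : DomBy F lam) (A : Set (Euc (m+1))) :
    μH[(m:ℝ)] (essBoundary F ∩ A) ≤ cH m * lam A := by
  obtain ⟨σ, hσi, hσ⟩ := exists_sigma hD
  -- enough: for every c1 > cH and U open ⊇ A
  suffices H : ∀ c' : ℝ≥0, cH m < c' → ∀ U : Set (Euc (m+1)), IsOpen U → A ⊆ U →
      μH[(m:ℝ)] (essBoundary F ∩ A) ≤ c' * lam U by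
    have h1 : ∀ c' : ℝ≥0, cH m < c' → μH[(m:ℝ)] (essBoundary F ∩ A) ≤ c' * lam A := by
      intro c' hc'
      have hc0 : (c':ℝ≥0∞) ≠ 0 := by
        have : 0 < c' := lt_of_le_of_lt (zero_le) hc'
        exact_mod_cast this.ne'
      rw [A.measure_eq_iInf_isOpen lam]
      simp only [ENNReal.mul_iInf_of_ne hc0 ENNReal.coe_ne_top]
      exact le_iInf fun U => le_iInf fun hAU => le_iInf fun hU => H c' hc' U hU hAU
    have h2 : Tendsto (fun k : ℕ => ((cH m + 1/((k:ℝ≥0)+1) : ℝ≥0) : ℝ≥0∞) * lam A) atTop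
        (𝓝 (((cH m + 0 : ℝ≥0) : ℝ≥0∞) * lam A)) := by
      refine ENNReal.Tendsto.mul_const (ENNReal.tendsto_coe.2 ?_) (Or.inr (measure_ne_top _ _))
      exact tendsto_const_nhds.add tendsto_one_div_add_atTop_nhds_zero_nat
    rw [add_zero] at h2
    exact ge_of_tendsto' h2 fun k => h1 _ (lt_add_of_pos_right _ (by positivity))
  intro c' hc' U hU hAU
  obtain ⟨K, δ, v, hK, hδ, hv0, hvK, hKc⟩ := exists_shape m hc'
  obtain ⟨R0, hR0⟩ := hK.isBounded.subset_closedBall 0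
  set L : Set (Euc (m+1)) := {x | Tendsto (fun r => ⨍ y in closedBall x r, ‖σ y - σ x‖ ∂lam)
    (𝓝[>] (0:ℝ)) (𝓝 0)} with hL
  have hL0 : lam Lᶜ = 0 := by
    have := (Besicovitch.vitaliFamily lam).ae_tendsto_average_norm_sub hσi.locallyIntegrable
    rw [ae_iff] at this
    refine measure_mono_null (fun x hx => ?_) this
    exact fun h => hx (h.comp (Besicovitch.tendsto_filterAt lam x))
  set SM : ℕ → Set (Euc (m+1)) := fun M => {x | x ∈ essBoundary F ∩ A ∧ x ∈ L ∧
    ∀ r : ℝ, 0 < r → r < 1/((M:ℝ)+1) → lam (closedBall x r) ≤ ENNReal.ofReal (((M:ℝ)+1) * r^m)}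
    with hSM
  have hSMb : ∀ M, μH[(m:ℝ)] (SM M) ≤ c' * lam U := by
    intro M
    refine shape_bound hF hD (R := |R0| + 2*δ+1) (D := diam K + 4 * δ) (fun x hx => hx.1.1) hU
      (fun x hx => hAU hx.1.2) (by positivity) (by positivity) hv0 (M := (M:ℝ)+1)
      (ρ := 1/((M:ℝ)+1)) (by positivity) (by positivity) hKc (fun x hx => hx.2.2) ?_
    rintro x ⟨⟨hxF, hxA⟩, hxL, hup⟩
    obtain ⟨ν, hν1, hν⟩ : ∃ ν : Euc (m+1), ‖ν‖ = 1 ∧ ∃ s : ℝ, 0 ≤ s ∧ σ x = s • ν := by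
      by_cases h0 : σ x = 0
      · obtain ⟨ν, hν⟩ := exists_norm_eq (Euc (m+1)) zero_le_one
        exact ⟨ν, hν, 0, le_rfl, by rw [h0, zero_smul]⟩
      · have : ‖σ x‖ ≠ 0 := norm_ne_zero_iff.2 h0
        refine ⟨‖σ x‖⁻¹ • σ x, ?_, ‖σ x‖, norm_nonneg _, ?_⟩
        · rw [norm_smul, norm_inv, norm_norm, inv_mul_cancel₀ this]
        · rw [smul_smul, mul_inv_cancel₀ this, one_smul]
    obtain ⟨S⟩ := exists_split ν hν1
    refine shape_at hK hδ hv0 hvK hR0 hF hD S fun η hη => ?_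
    refine blowup hF S (fun ε hε => ?_) hxF hη
    exact halfspace_pair hF hσi hσ S hν (fun ε hε => lebesgue_conv hxL (by positivity)
      (by positivity) hup hε) hε
  have hmono : Monotone SM := by
    intro M M' hMM x hx
    refine ⟨hx.1, hx.2.1, fun r hr hr' => ?_⟩
    have h1 : (M:ℝ) ≤ M' := by exact_mod_cast hMM
    refine (hx.2.2 r hr (hr'.trans_le ?_)).trans (ENNReal.ofReal_le_ofReal ?_)
    · gcongr
    · gcongr
  have hUn : μH[(m:ℝ)] (⋃ M, SM M) ≤ c' * lam U := by
    rw [hmono.measure_iUnion]; exact iSup_le hSMb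
  set N1 := essBoundary F ∩ A ∩ Lᶜ
  set N2 : Set (Euc (m+1)) := {x | ∀ M : ℕ, ∃ᶠ r in 𝓝[>] (0:ℝ),
      ENNReal.ofReal ((M+1) * r^m) ≤ lam (closedBall x r)}
  have hN1 : μH[(m:ℝ)] N1 = 0 := null_of_null hF hD (fun x hx => hx.1.1)
    (measure_mono_null inter_subset_right hL0)
  have hN2 : μH[(m:ℝ)] N2 = 0 := null_upper_infty (lam := lam) fun x hx => hx
  have hcov : essBoundary F ∩ A ⊆ (⋃ M, SM M) ∪ (N1 ∪ N2) := by
    intro x hx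
    by_cases hxL : x ∈ L
    swap
    · exact Or.inr (Or.inl ⟨hx, hxL⟩)
    by_cases hx2 : x ∈ N2
    · exact Or.inr (Or.inr hx2)
    left
    simp only [N2, mem_ofPred_eq, not_forall, not_frequently, not_le] at hx2
    obtain ⟨M, hM⟩ := hx2
    obtain ⟨ρ, hρ, hρM⟩ := mem_nhdsGT_iff_exists_Ioo_subset.1 hM
    have hρ' : (0:ℝ) < ρ := hρ
    obtain ⟨k, hk⟩ := exists_nat_one_div_lt hρ'
    refine mem_iUnion.2 ⟨max M k, hx, hxL, fun r hr hr' => ?_⟩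
    have h1 : (M:ℝ) ≤ (max M k : ℕ) := by exact_mod_cast le_max_left _ _
    have h2 : (k:ℝ) ≤ (max M k : ℕ) := by exact_mod_cast le_max_right _ _
    have h3 : r < ρ := hr'.trans_le (le_trans (by gcongr) hk.le)
    have h4 := hρM ⟨hr, h3⟩
    refine le_trans (le_of_lt h4) (ENNReal.ofReal_le_ofReal ?_)
    gcongr
  calc μH[(m:ℝ)] (essBoundary F ∩ A) ≤ μH[(m:ℝ)] ((⋃ M, SM M) ∪ (N1 ∪ N2)) := measure_mono hcov
    _ ≤ μH[(m:ℝ)] (⋃ M, SM M) + (μH[(m:ℝ)] N1 + μH[(m:ℝ)] N2) :=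
      (measure_union_le _ _).trans (by gcongr; exact measure_union_le _ _)
    _ ≤ c' * lam U := by rw [hN1, hN2, add_zero, add_zero]; exact hUn

open MeasureTheory Metric Set Filter
open scoped ENNReal NNReal Topology RealInnerProductSpace

/-- Assemble a point of `ℝⁿ` from two planar coordinates and the remaining ones. -/
noncomputable def joinV {n : ℕ} (hn : 2 ≤ n) (z : (ℝ × ℝ) × Euc (n - 2)) : Euc n :=
  WithLp.toLp 2 fun i => if i.1 = 0 then z.1.1 else if i.1 = 1 then z.1.2 else
    if h : i.1 - 2 < n - 2 then z.2 ⟨i.1 - 2, h⟩ else 0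

/-- Split a point of `ℝⁿ` in its two planar coordinates and the remaining ones. -/
noncomputable def splitV {n : ℕ} (hn : 2 ≤ n) (x : Euc n) : (ℝ × ℝ) × Euc (n - 2) :=
  ((x ⟨0, by omega⟩, x ⟨1, by omega⟩), prC hn x)

lemma prC_apply {n : ℕ} (hn : 2 ≤ n) (x : Euc n) (i : Fin (n-2)) :
    prC hn x i = x ⟨i.1 + 2, by have := i.2; omega⟩ := rfl

lemma pr12_apply {n : ℕ} (hn : 2 ≤ n) (x : Euc n) (i : Fin 2) :
    pr12 hn x i = x ⟨i.1, lt_of_lt_of_le i.2 hn⟩ := rfl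

lemma joinV_zero {n : ℕ} (hn : 2 ≤ n) (z : (ℝ × ℝ) × Euc (n - 2)) :
    joinV hn z ⟨0, by omega⟩ = z.1.1 := by simp [joinV]

lemma joinV_one {n : ℕ} (hn : 2 ≤ n) (z : (ℝ × ℝ) × Euc (n - 2)) :
    joinV hn z ⟨1, by omega⟩ = z.1.2 := by simp [joinV]

lemma prC_joinV {n : ℕ} (hn : 2 ≤ n) (z : (ℝ × ℝ) × Euc (n - 2)) :
    prC hn (joinV hn z) = z.2 := by
  ext i
  rw [prC_apply]
  simp [joinV]

lemma joinV_splitV {n : ℕ} (hn : 2 ≤ n) (x : Euc n) : joinV hn (splitV hn x) = x := by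
  ext ⟨i, hi⟩
  simp only [joinV, splitV]
  rcases i with _ | _ | i
  · simp
  · simp
  · have : i < n - 2 := by omega
    simp [this, prC_apply]

lemma splitV_joinV {n : ℕ} (hn : 2 ≤ n) (z : (ℝ × ℝ) × Euc (n - 2)) :
    splitV hn (joinV hn z) = z := by
  rw [splitV, prC_joinV, joinV_zero, joinV_one]

lemma norm_pr12_sq {n : ℕ} (hn : 2 ≤ n) (x : Euc n) :
    ‖pr12 hn x‖^2 = (x ⟨0, by omega⟩)^2 + (x ⟨1, by omega⟩)^2 := by
  rw [EuclideanSpace.norm_sq_eq, Fin.sum_univ_two]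
  simp [pr12_apply]

lemma continuous_splitV {n : ℕ} (hn : 2 ≤ n) : Continuous (splitV hn) := by
  unfold splitV prC
  fun_prop

lemma continuous_prC {n : ℕ} (hn : 2 ≤ n) : Continuous (prC hn) := by
  unfold prC; fun_prop

lemma continuous_pr12 {n : ℕ} (hn : 2 ≤ n) : Continuous (pr12 hn) := by
  unfold pr12; fun_prop

lemma continuous_joinV {n : ℕ} (hn : 2 ≤ n) : Continuous (joinV hn) := by
  unfold joinV
  refine (PiLp.continuous_toLp 2 _).comp (continuous_pi fun i => ?_)
  split_ifs <;> fun_prop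

/-- the coordinate splitting as a measurable equivalence -/
noncomputable def splitM {n : ℕ} (hn : 2 ≤ n) : Euc n ≃ᵐ (ℝ × ℝ) × Euc (n - 2) where
  toFun := splitV hn
  invFun := joinV hn
  left_inv := joinV_splitV hn
  right_inv := splitV_joinV hn
  measurable_toFun := (continuous_splitV hn).measurable
  measurable_invFun := (continuous_joinV hn).measurable

lemma joinV_mp {n : ℕ} (hn : 2 ≤ n) : MeasurePreserving (joinV hn) volume volume := by
  set e : Fin 2 ⊕ Fin (n-2) ≃ Fin n := finSumFinEquiv.trans (finCongr (by omega)) with he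
  have hA : MeasurePreserving (MeasurableEquiv.finTwoArrow.symm : ℝ × ℝ → (Fin 2 → ℝ)) volume volume :=
    (volume_preserving_finTwoArrow ℝ).symm
  have hB : MeasurePreserving (WithLp.ofLp : Euc (n-2) → (Fin (n-2) → ℝ)) volume volume :=
    PiLp.volume_preserving_ofLp (Fin (n-2))
  have h1 : MeasurePreserving (Prod.map (MeasurableEquiv.finTwoArrow.symm : ℝ × ℝ → (Fin 2 → ℝ))
    (WithLp.ofLp : Euc (n-2) → (Fin (n-2) → ℝ))) (volume.prod volume) (volume.prod volume) :=
    hA.prod hB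
  have h2 := volume_measurePreserving_sumPiEquivProdPi_symm (fun _ : Fin 2 ⊕ Fin (n-2) => ℝ)
  have h3 := volume_measurePreserving_piCongrLeft (fun _ : Fin n => ℝ) e
  have h4 := (PiLp.volume_preserving_toLp (Fin n)).comp (h3.comp (h2.comp h1))
  suffices hh : joinV hn = _ by rw [hh]; exact h4
  funext z
  ext i
  obtain ⟨j, rfl⟩ := e.surjective i
  simp only [Function.comp_apply]
  rw [MeasurableEquiv.coe_piCongrLeft, Equiv.piCongrLeft_apply_apply]
  rcases j with j | j
  · fin_cases j <;> simp [joinV, he] <;> rfl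
  · have := j.2
    simp [joinV, he]
    rw [if_neg (by omega)]
    rfl

lemma splitV_mp {n : ℕ} (hn : 2 ≤ n) : MeasurePreserving (splitV hn) volume volume :=
  MeasurePreserving.symm (splitM hn).symm (joinV_mp hn)

/-! ### the angle circle -/

instance factTwoPi : Fact (0 < 2 * Real.pi) := ⟨Real.two_pi_pos⟩

/-- The circle of angles. -/
abbrev Ang : Type := AddCircle (2 * Real.pi)

noncomputable def cosA : Ang → ℝ := Real.cos_periodic.lift
noncomputable def sinA : Ang → ℝ := Real.sin_periodic.lift

lemma cosA_coe (t : ℝ) : cosA (t : Ang) = Real.cos t := rfl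
lemma sinA_coe (t : ℝ) : sinA (t : Ang) = Real.sin t := rfl

lemma continuous_cosA : Continuous cosA := continuous_coinduced_dom.2 Real.continuous_cos
lemma continuous_sinA : Continuous sinA := continuous_coinduced_dom.2 Real.continuous_sin

lemma cosA_sq_add (θ : Ang) : cosA θ ^ 2 + sinA θ ^ 2 = 1 := by
  induction θ using QuotientAddGroup.induction_on with
  | H t => exact Real.cos_sq_add_sin_sq t

lemma cosA_sub (a b : Ang) : cosA (a - b) = cosA a * cosA b + sinA a * sinA b := by
  induction a using QuotientAddGroup.induction_on with
  | H s => induction b using QuotientAddGroup.induction_on with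
    | H t => exact Real.cos_sub s t

lemma sinA_sub (a b : Ang) : sinA (a - b) = sinA a * cosA b - cosA a * sinA b := by
  induction a using QuotientAddGroup.induction_on with
  | H s => induction b using QuotientAddGroup.induction_on with
    | H t => exact Real.sin_sub s t

/-- Polar parametrization `Φ₁₂`. -/
noncomputable def Psi {n : ℕ} (hn : 2 ≤ n) (p : ℝ × Euc (n - 2)) (θ : Ang) : Euc n :=
  joinV hn ((p.1 * cosA θ, p.1 * sinA θ), p.2)

lemma continuous_Psi {n : ℕ} (hn : 2 ≤ n) :
    Continuous (fun z : (ℝ × Euc (n - 2)) × Ang => Psi hn z.1 z.2) := by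
  have h1 := continuous_cosA; have h2 := continuous_sinA
  unfold Psi
  exact (continuous_joinV hn).comp (by fun_prop)

/-- The base projection. -/
noncomputable def baseQ {n : ℕ} (hn : 2 ≤ n) (x : Euc n) : ℝ × Euc (n - 2) :=
  (‖pr12 hn x‖, prC hn x)

lemma continuous_baseQ {n : ℕ} (hn : 2 ≤ n) : Continuous (baseQ hn) :=
  ((continuous_pr12 hn).norm).prodMk (continuous_prC hn)

lemma norm_pr12_Psi {n : ℕ} (hn : 2 ≤ n) {p : ℝ × Euc (n - 2)} (hp : 0 ≤ p.1) (θ : Ang) :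
    ‖pr12 hn (Psi hn p θ)‖ = p.1 := by
  rw [← sq_eq_sq₀ (norm_nonneg _) hp, norm_pr12_sq, Psi, joinV_zero, joinV_one]
  linear_combination p.1^2 * cosA_sq_add θ

lemma baseQ_Psi {n : ℕ} (hn : 2 ≤ n) {p : ℝ × Euc (n - 2)} (hp : 0 ≤ p.1) (θ : Ang) :
    baseQ hn (Psi hn p θ) = p := by
  rw [baseQ, norm_pr12_Psi hn hp, Psi, prC_joinV]

lemma exists_Psi {n : ℕ} (hn : 2 ≤ n) (x : Euc n) : ∃ θ : Ang, Psi hn (baseQ hn x) θ = x := by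
  set w : ℂ := ⟨x ⟨0, by omega⟩, x ⟨1, by omega⟩⟩ with hw
  have hnorm : ‖pr12 hn x‖ = ‖w‖ := by
    rw [← sq_eq_sq₀ (norm_nonneg _) (norm_nonneg _), norm_pr12_sq, Complex.sq_norm,
      Complex.normSq_apply]
    ring
  refine ⟨((Complex.arg w : ℝ) : Ang), ?_⟩
  rw [Psi, cosA_coe, sinA_coe]
  simp only [baseQ]
  rw [hnorm, Complex.norm_mul_cos_arg, Complex.norm_mul_sin_arg]
  exact joinV_splitV hn x

/-- Integration in polar coordinates. -/
lemma polar_lintegral {n : ℕ} (hn : 2 ≤ n) {f : Euc n → ℝ≥0∞} (hf : Measurable f) :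
    ∫⁻ x, f x = ∫⁻ p in Ioi (0:ℝ) ×ˢ (univ : Set (Euc (n-2))),
      ENNReal.ofReal p.1 * ∫⁻ θ : Ang, f (Psi hn p θ) := by
  have hj : Measurable (joinV hn) := (continuous_joinV hn).measurable
  have hΨ : Measurable (fun z : (ℝ × Euc (n - 2)) × Ang => f (Psi hn z.1 z.2)) :=
    hf.comp (continuous_Psi hn).measurable
  have h1 : ∫⁻ x, f x = ∫⁻ y : Euc (n-2), ∫⁻ w : ℝ × ℝ, f (joinV hn (w, y)) := by
    rw [← (joinV_mp hn).lintegral_comp hf, Measure.volume_eq_prod,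
      lintegral_prod_symm' (fun z => f (joinV hn z)) (hf.comp hj)]
  have h2 : ∀ y : Euc (n-2), ∫⁻ w : ℝ × ℝ, f (joinV hn (w, y)) =
      ∫⁻ r in Ioi (0:ℝ), ENNReal.ofReal r * ∫⁻ θ : Ang, f (Psi hn (r, y) θ) := by
    intro y
    rw [← lintegral_comp_polarCoord_symm, polarCoord_target, Measure.volume_eq_prod,
      ← Measure.prod_restrict]
    have hm : Measurable (fun p : ℝ × ℝ => ENNReal.ofReal p.1 • f (joinV hn (polarCoord.symm p, y))) := by
      simp only [polarCoord_symm_apply]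
      have : Measurable (fun p : ℝ × ℝ => joinV hn ((p.1 * Real.cos p.2, p.1 * Real.sin p.2), y)) :=
        ((continuous_joinV hn).comp (by fun_prop)).measurable
      exact (ENNReal.measurable_ofReal.comp measurable_fst).smul (hf.comp this)
    rw [lintegral_prod _ hm.aemeasurable]
    refine lintegral_congr fun r => ?_
    have hm2 : Measurable (fun t : ℝ => f (Psi hn (r, y) (t : Ang))) :=
      hf.comp ((continuous_Psi hn).measurable.comp
        (measurable_const.prodMk (AddCircle.measurable_mk'.comp measurable_id)))
    rw [← AddCircle.lintegral_preimage (2 * Real.pi) (-Real.pi), ← lintegral_const_mul _ hm2,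
      show -Real.pi + 2 * Real.pi = Real.pi by ring]
    rw [restrict_Ioo_eq_restrict_Ioc]
    rfl
  rw [h1]
  simp_rw [h2]
  rw [Measure.volume_eq_prod, ← Measure.prod_restrict, Measure.restrict_univ,
    lintegral_prod_symm']
  exact (ENNReal.measurable_ofReal.comp (measurable_fst)).mul hΨ.lintegral_prod_right'

open MeasureTheory Metric Set Filter
open scoped ENNReal NNReal Topology RealInnerProductSpace

lemma inner_joinV {n : ℕ} (hn : 2 ≤ n) (z : (ℝ × ℝ) × Euc (n - 2)) (x : Euc n) :
    ⟪joinV hn z, x⟫ = z.1.1 * x ⟨0, by omega⟩ + z.1.2 * x ⟨1, by omega⟩ + ⟪z.2, prC hn x⟫ := by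
  obtain ⟨k, rfl⟩ : ∃ k, n = k + 2 := ⟨n - 2, by omega⟩
  simp only [PiLp.inner_apply]
  rw [Fin.sum_univ_succ, Fin.sum_univ_succ, ← add_assoc]
  congr 1
  · congr 1
    · simp [joinV, mul_comm]
    · simp [joinV, mul_comm]
  · refine Finset.sum_congr rfl fun i _ => ?_
    congr 1
    simp [joinV]

/-- Half of the representative in `(0, 2π]` of an angle. -/
noncomputable def hfA (b : Ang) : ℝ := (AddCircle.equivIoc (2 * Real.pi) 0 b : ℝ) / 2

lemma hfA_mem (b : Ang) : hfA b ∈ Ioc 0 Real.pi := by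
  have := (AddCircle.equivIoc (2 * Real.pi) 0 b).2
  rw [mem_Ioc] at this
  unfold hfA
  constructor <;> linarith

lemma hfA_coe (b : Ang) : ((2 * hfA b : ℝ) : Ang) = b := by
  unfold hfA
  rw [mul_div_cancel₀ _ two_ne_zero]
  exact (AddCircle.equivIoc (2 * Real.pi) 0).symm_apply_apply b

/-- Unit normal of the reflection `θ ↦ b - θ`. -/
noncomputable def uA {n : ℕ} (hn : 2 ≤ n) (b : Ang) : Euc n :=
  joinV hn ((Real.sin (hfA b), - Real.cos (hfA b)), 0)

lemma inner_uA {n : ℕ} (hn : 2 ≤ n) (b : Ang) (x : Euc n) :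
    ⟪uA hn b, x⟫ = Real.sin (hfA b) * x ⟨0, by omega⟩ - Real.cos (hfA b) * x ⟨1, by omega⟩ := by
  rw [uA, inner_joinV]; simp; ring

lemma norm_uA {n : ℕ} (hn : 2 ≤ n) (b : Ang) : ‖uA hn b‖ = 1 := by
  have : ‖uA hn b‖^2 = 1 := by
    rw [← real_inner_self_eq_norm_sq, inner_uA, uA, joinV_zero, joinV_one]
    linear_combination Real.sin_sq_add_cos_sq (hfA b)
  nlinarith [norm_nonneg (uA hn b)]

/-- The reflection acting as `θ ↦ b - θ` on angles. -/
noncomputable def sigA {n : ℕ} (hn : 2 ≤ n) (b : Ang) : Euc n ≃ₗᵢ[ℝ] Euc n :=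
  (ℝ ∙ uA hn b)ᗮ.reflection

lemma sigA_apply {n : ℕ} (hn : 2 ≤ n) (b : Ang) (x : Euc n) :
    sigA hn b x = x - (2 * ⟪uA hn b, x⟫) • uA hn b := by
  rw [sigA, Submodule.reflection_orthogonal_apply, Submodule.reflection_singleton_apply, norm_uA]
  simp [two_mul, add_smul, two_smul]

lemma sigA_sigA {n : ℕ} (hn : 2 ≤ n) (b : Ang) (x : Euc n) : sigA hn b (sigA hn b x) = x :=
  Submodule.reflection_reflection _ x

lemma joinV_ext {n : ℕ} (hn : 2 ≤ n) {x y : Euc n} (h0 : x ⟨0, by omega⟩ = y ⟨0, by omega⟩)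
    (h1 : x ⟨1, by omega⟩ = y ⟨1, by omega⟩) (h2 : prC hn x = prC hn y) : x = y := by
  rw [← joinV_splitV hn x, ← joinV_splitV hn y, splitV, splitV, h0, h1, h2]

lemma prC_uA {n : ℕ} (hn : 2 ≤ n) (b : Ang) : prC hn (uA hn b) = 0 := by rw [uA, prC_joinV]

lemma prC_sigA {n : ℕ} (hn : 2 ≤ n) (b : Ang) (x : Euc n) : prC hn (sigA hn b x) = prC hn x := by
  ext i
  have := congrArg (fun v : Euc (n-2) => v i) (prC_uA hn b)
  simp only [prC_apply] at this ⊢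
  simp [sigA_apply, this]

lemma sigA_Psi {n : ℕ} (hn : 2 ≤ n) (b : Ang) (p : ℝ × Euc (n-2)) (θ : Ang) :
    sigA hn b (Psi hn p θ) = Psi hn p (b - θ) := by
  have hs := Real.sin_sq_add_cos_sq (hfA b)
  have hc : cosA b = 1 - 2 * Real.sin (hfA b)^2 := by
    conv_lhs => rw [← hfA_coe b, cosA_coe, Real.cos_two_mul]
    linear_combination 2 * hs
  have hc' : sinA b = 2 * Real.sin (hfA b) * Real.cos (hfA b) := by
    conv_lhs => rw [← hfA_coe b, sinA_coe, Real.sin_two_mul]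
  refine joinV_ext hn ?_ ?_ ?_
  · rw [sigA_apply]
    simp only [PiLp.sub_apply, PiLp.smul_apply, smul_eq_mul, inner_uA]
    simp only [Psi, uA, joinV_zero, joinV_one, cosA_sub]
    rw [hc, hc']; ring
  · rw [sigA_apply]
    simp only [PiLp.sub_apply, PiLp.smul_apply, smul_eq_mul, inner_uA]
    simp only [Psi, uA, joinV_zero, joinV_one, sinA_sub]
    rw [hc, hc']
    linear_combination (-2 * p.1 * sinA θ) * hs
  · rw [prC_sigA, Psi, Psi, prC_joinV, prC_joinV]

lemma baseQ_sigA {n : ℕ} (hn : 2 ≤ n) (b : Ang) (x : Euc n) :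
    baseQ hn (sigA hn b x) = baseQ hn x := by
  obtain ⟨θ, hθ⟩ := exists_Psi hn x
  have h0 : 0 ≤ (baseQ hn x).1 := norm_nonneg _
  conv_lhs => rw [← hθ, sigA_Psi, baseQ_Psi hn h0]

/-- the arc of half-length `c` around `0`. -/
def arcA (c : ℝ) : Set Ang := {θ | Real.arccos (cosA θ) < c}

lemma arcA_preimage {c : ℝ} (hc' : c ≤ Real.pi) :
    ((↑) ⁻¹' arcA c : Set ℝ) ∩ Ioc (-Real.pi) (-Real.pi + 2 * Real.pi) = Ioo (-c) c := by
  ext t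
  simp only [arcA, mem_inter_iff, mem_preimage, mem_ofPred_eq, cosA_coe, mem_Ioc, mem_Ioo]
  have key : |t| ≤ Real.pi → Real.arccos (Real.cos t) = |t| := fun h => by
    rw [← Real.cos_abs, Real.arccos_cos (abs_nonneg _) h]
  constructor
  · rintro ⟨h1, h2, h3⟩
    rw [key (abs_le.2 ⟨by linarith, by linarith⟩), abs_lt] at h1
    exact h1
  · rintro ⟨h1, h2⟩
    refine ⟨?_, by linarith, by linarith⟩
    rw [key (abs_le.2 ⟨by linarith, by linarith⟩), abs_lt]
    exact ⟨h1, h2⟩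

lemma measurableSet_arcA (c : ℝ) : MeasurableSet (arcA c) :=
  measurableSet_lt (Real.continuous_arccos.comp continuous_cosA).measurable measurable_const

lemma volume_arcA {c : ℝ} (hc' : c ≤ Real.pi) :
    volume (arcA c) = ENNReal.ofReal (2 * c) := by
  have h := (AddCircle.measurePreserving_mk (2 * Real.pi) (-Real.pi)).measure_preimage
    (measurableSet_arcA c).nullMeasurableSet
  rw [← h, Measure.restrict_apply (AddCircle.measurable_mk' (measurableSet_arcA c))]
  erw [arcA_preimage hc']
  rw [Real.volume_Ioo]; congr 1; ring

lemma arcA_eq_image {c : ℝ} (hc' : c ≤ Real.pi) : arcA c = (fun t : ℝ => (t : Ang)) '' Ioo (-c) c := by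
  ext θ
  constructor
  · intro h
    obtain ⟨t, ht, rfl⟩ : ∃ t ∈ Ioc (-Real.pi) (-Real.pi + 2 * Real.pi), (t : Ang) = θ :=
      ⟨_, (AddCircle.equivIoc (2 * Real.pi) (-Real.pi) θ).2,
        (AddCircle.equivIoc (2 * Real.pi) (-Real.pi)).symm_apply_apply θ⟩
    exact ⟨t, by rw [← arcA_preimage hc']; exact ⟨h, ht⟩, rfl⟩
  · rintro ⟨t, ht, rfl⟩
    rw [← arcA_preimage hc'] at ht
    exact ht.1

lemma Psi_injective {n : ℕ} (hn : 2 ≤ n) {p : ℝ × Euc (n-2)} (hp : 0 < p.1) :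
    Function.Injective (Psi hn p) := by
  intro a b h
  have h0 := congrArg (fun x : Euc n => x ⟨0, by omega⟩) h
  have h1 := congrArg (fun x : Euc n => x ⟨1, by omega⟩) h
  simp only [Psi, joinV_zero, joinV_one] at h0 h1
  have h0' := mul_left_cancel₀ hp.ne' h0
  have h1' := mul_left_cancel₀ hp.ne' h1
  induction a using QuotientAddGroup.induction_on with
  | H s => induction b using QuotientAddGroup.induction_on with
    | H t => exact Real.Angle.cos_sin_inj h0' h1'

lemma continuous_Psi_right {n : ℕ} (hn : 2 ≤ n) (p : ℝ × Euc (n-2)) : Continuous (Psi hn p) :=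
  (continuous_Psi hn).comp (continuous_const.prodMk continuous_id)

lemma Psi_emb {n : ℕ} (hn : 2 ≤ n) {p : ℝ × Euc (n-2)} (hp : 0 < p.1) :
    MeasurableEmbedding (Psi hn p) :=
  ((continuous_Psi_right hn p).isClosedEmbedding (Psi_injective hn hp)).measurableEmbedding

lemma Psi_lip {n : ℕ} (hn : 2 ≤ n) {p : ℝ × Euc (n-2)} (hp : 0 < p.1) :
    LipschitzWith (Real.toNNReal p.1) (fun t : ℝ => Psi hn p (t : Ang)) := by
  refine LipschitzWith.of_dist_le_mul fun s t => ?_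
  rw [Real.coe_toNNReal _ hp.le, dist_eq_norm, Real.dist_eq]
  have hsub : Psi hn p (s : Ang) - Psi hn p (t : Ang) = joinV hn
      ((p.1 * (Real.cos s - Real.cos t), p.1 * (Real.sin s - Real.sin t)), 0) := by
    refine joinV_ext hn ?_ ?_ ?_
    · simp only [PiLp.sub_apply, Psi, joinV_zero, cosA_coe]; ring
    · simp only [PiLp.sub_apply, Psi, joinV_one, sinA_coe]; ring
    · rw [prC_joinV]
      ext i
      have h1 : ∀ τ : Ang, (Psi hn p τ) ⟨i.1 + 2, by have := i.2; omega⟩ = p.2 i := fun τ => by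
        rw [← prC_apply hn, Psi, prC_joinV]
      simp [prC_apply, h1]
  have hsq : ‖Psi hn p (s : Ang) - Psi hn p (t : Ang)‖^2 = p.1^2 * (2 - 2 * Real.cos (s - t)) := by
    rw [hsub, ← real_inner_self_eq_norm_sq, inner_joinV, joinV_zero, joinV_one, Real.cos_sub]
    simp only [inner_zero_left]
    linear_combination p.1^2 * (Real.sin_sq_add_cos_sq s + Real.sin_sq_add_cos_sq t)
  have hcos := Real.one_sub_sq_div_two_le_cos (x := s - t)
  refine abs_le_of_sq_le_sq' (b := p.1 * |s - t|) ?_ (by positivity) |>.2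
  rw [hsq, mul_pow, sq_abs]
  have : 0 ≤ p.1^2 := sq_nonneg _
  nlinarith

lemma circ_hausdorff {n : ℕ} (hn : 2 ≤ n) {p : ℝ × Euc (n-2)} (hp : 0 < p.1) (A : Set Ang) :
    μH[(1:ℝ)] (Psi hn p '' A) = ENNReal.ofReal p.1 * volume A := by
  set ν : Measure Ang := Measure.comap (Psi hn p) μH[(1:ℝ)] with hν
  have hνA : ∀ A, ν A = μH[(1:ℝ)] (Psi hn p '' A) := fun A => (Psi_emb hn hp).comap_apply _ _
  have hup : ∀ c ≤ Real.pi, ν (arcA c) ≤ ENNReal.ofReal p.1 * ENNReal.ofReal (2 * c) := by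
    intro c hc
    rw [hνA, arcA_eq_image hc, image_image]
    refine ((Psi_lip hn hp).hausdorffMeasure_image_le zero_le_one _).trans ?_
    rw [hausdorffMeasure_real, Real.volume_Ioo, ENNReal.rpow_one, ENNReal.ofReal]
    refine le_of_eq ?_
    congr 2; ring
  have hall : Psi hn p '' univ = (fun t : ℝ => Psi hn p (t : Ang)) '' Icc (-Real.pi) Real.pi := by
    apply Subset.antisymm
    · rintro _ ⟨θ, -, rfl⟩
      have h := (AddCircle.equivIoc (2 * Real.pi) (-Real.pi) θ).2
      rw [mem_Ioc] at h
      refine ⟨(AddCircle.equivIoc (2 * Real.pi) (-Real.pi) θ : ℝ), ⟨by linarith, by linarith⟩, ?_⟩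
      exact congrArg (Psi hn p) ((AddCircle.equivIoc (2 * Real.pi) (-Real.pi)).symm_apply_apply θ)
    · rintro _ ⟨t, -, rfl⟩; exact ⟨_, trivial, rfl⟩
  have hfin : IsFiniteMeasure ν := ⟨by
    rw [hνA, hall]
    refine ((Psi_lip hn hp).hausdorffMeasure_image_le zero_le_one _).trans_lt ?_
    rw [hausdorffMeasure_real, Real.volume_Icc]
    exact ENNReal.mul_lt_top (by simp) (by simp)⟩
  have hinv : ν.IsAddLeftInvariant := ⟨fun a => by
    ext S hS
    rw [Measure.map_apply (measurable_const_add a) hS, hνA, hνA]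
    have : Psi hn p '' S = (fun x => sigA hn a (sigA hn 0 x)) '' (Psi hn p '' ((a + ·) ⁻¹' S)) := by
      rw [image_image]
      have h1 : ∀ θ, sigA hn a (sigA hn 0 (Psi hn p θ)) = Psi hn p (a + θ) := fun θ => by
        rw [sigA_Psi, sigA_Psi]; congr 1; abel
      simp only [h1]
      rw [← image_image (Psi hn p) (a + ·), image_preimage_eq _ (add_left_surjective a)]
    rw [this]
    have hi : Isometry (fun x => sigA hn a (sigA hn 0 x)) :=
      (sigA hn a).isometry.comp (sigA hn 0).isometry
    rw [hi.hausdorffMeasure_image (Or.inl zero_le_one)]⟩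
  obtain ⟨C, hC⟩ : ∃ C : ℝ≥0, ν = C • volume := ⟨_, Measure.isAddLeftInvariant_eq_smul ν volume⟩
  have hCr : (C : ℝ) = p.1 := by
    have hlow : ∀ h ∈ Ioc (0:ℝ) 1, p.1 * (2 * Real.sin h) ≤ C * (2 * h) := by
      intro h hh
      have h3 := Real.pi_gt_three
      have hcv : ν (arcA h) = ENNReal.ofReal (C * (2 * h)) := by
        rw [hC, Measure.smul_apply, volume_arcA (by linarith [hh.2]), ENNReal.ofReal_mul (NNReal.coe_nonneg C)]
        simp [ENNReal.smul_def]
      have hlip : LipschitzWith 1 (fun x : Euc n => x ⟨1, by omega⟩) := by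
        refine LipschitzWith.of_dist_le_mul fun x y => ?_
        rw [NNReal.coe_one, one_mul, dist_eq_norm, dist_eq_norm, ← PiLp.sub_apply]
        exact PiLp.norm_apply_le _ _
      have h4 := hlip.hausdorffMeasure_image_le (d := 1) zero_le_one (Psi hn p '' arcA h)
      rw [← hνA, hcv, hausdorffMeasure_real] at h4
      have h5 : Ioo (-(p.1 * Real.sin h)) (p.1 * Real.sin h) ⊆
          (fun x : Euc n => x ⟨1, by omega⟩) '' (Psi hn p '' arcA h) := by
        rintro y ⟨hy1, hy2⟩
        have hs1 : Real.sin h ≤ 1 := Real.sin_le_one h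
        have hy1' : -Real.sin h < y / p.1 := by rw [lt_div_iff₀ hp]; linarith
        have hy2' : y / p.1 < Real.sin h := by rw [div_lt_iff₀ hp]; linarith
        refine ⟨_, ⟨((Real.arcsin (y / p.1) : ℝ) : Ang), ?_, rfl⟩, ?_⟩
        · rw [arcA_eq_image (by linarith [hh.2])]
          refine ⟨_, ⟨?_, ?_⟩, rfl⟩
          · rw [Real.lt_arcsin_iff_sin_lt' ⟨by linarith [hh.2], by linarith [hh.1]⟩, Real.sin_neg]
            exact hy1'
          · rw [Real.arcsin_lt_iff_lt_sin' ⟨by linarith [hh.1], by linarith [hh.2]⟩]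
            exact hy2'
        · simp only [Psi, joinV_one, sinA_coe]
          rw [Real.sin_arcsin (by linarith) (by linarith)]
          field_simp
      have h6 := (measure_mono (μ := volume) h5).trans h4
      rw [Real.volume_Ioo, ENNReal.coe_one, ENNReal.one_rpow, one_mul] at h6
      have h7 := (ENNReal.ofReal_le_ofReal_iff (mul_nonneg (NNReal.coe_nonneg C) (by linarith [hh.1]))).1 h6
      linarith
    apply le_antisymm
    · have h1 := hup 1 (by linarith [Real.pi_gt_three])
      rw [hC, Measure.smul_apply, volume_arcA (by linarith [Real.pi_gt_three]),
        ENNReal.smul_def, smul_eq_mul] at h1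
      have h2 := (ENNReal.mul_le_mul_iff_left (by simp) (by simp)).1 h1
      rw [ENNReal.ofReal, ENNReal.coe_le_coe] at h2
      have := NNReal.coe_le_coe.2 h2
      rwa [Real.coe_toNNReal _ hp.le] at this
    · have ht : Tendsto (fun h : ℝ => p.1 * (1 - h^2/6)) (𝓝[>] 0) (𝓝 (p.1 * (1 - 0^2/6))) :=
        ((by fun_prop : Continuous fun h : ℝ => p.1 * (1 - h^2/6)).tendsto 0).mono_left
          nhdsWithin_le_nhds
      have : p.1 * (1 - 0^2/6) = p.1 := by ring
      rw [this] at ht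
      refine le_of_tendsto ht ?_
      filter_upwards [Ioc_mem_nhdsGT (show (0:ℝ) < 1 by norm_num)] with h hh
      have h1 := hlow h hh
      have h2 := Real.sin_gt_sub_cube hh.1
      have hh1 := hh.1
      have h3 : p.1 * (h - h^3/6) ≤ C * h := by nlinarith
      have h4 : (p.1 * (1 - h^2/6)) * h ≤ C * h := by linarith
      exact le_of_mul_le_mul_right h4 hh1
  rw [← hνA, hC, Measure.smul_apply, ENNReal.smul_def, smul_eq_mul, ← hCr,
    ENNReal.ofReal_coe_nnreal]

/-- slice set in angles -/
def sliceA {n : ℕ} (hn : 2 ≤ n) (E : Set (Euc n)) (p : ℝ × Euc (n-2)) : Set Ang :=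
  {θ | Psi hn p θ ∈ E}

lemma cslice_eq {n : ℕ} (hn : 2 ≤ n) (E : Set (Euc n)) {p : ℝ × Euc (n-2)} (hp : 0 < p.1) :
    cslice hn E p = Psi hn p '' sliceA hn E p := by
  ext x
  simp only [cslice, circFiber, sliceA, mem_inter_iff, mem_ofPred_eq, mem_image]
  constructor
  · rintro ⟨hx, h1, h2⟩
    obtain ⟨θ, hθ⟩ := exists_Psi hn x
    have : baseQ hn x = p := Prod.ext h2 h1
    rw [this] at hθ
    exact ⟨θ, by rw [hθ]; exact hx, hθ⟩
  · rintro ⟨θ, h, rfl⟩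
    have := baseQ_Psi hn hp.le θ
    exact ⟨h, congrArg Prod.snd this, congrArg Prod.fst this⟩

lemma slice_len {n : ℕ} (hn : 2 ≤ n) (E : Set (Euc n)) {p : ℝ × Euc (n-2)} (hp : 0 < p.1) :
    μH[(1:ℝ)] (cslice hn E p) = ENNReal.ofReal p.1 * volume (sliceA hn E p) := by
  rw [cslice_eq hn E hp, circ_hausdorff hn hp]

lemma hatv_inner_Psi {n : ℕ} (hn : 2 ≤ n) {p : ℝ × Euc (n-2)} (hp : 0 < p.1) (θ : Ang) :
    ⟪hatv (pr12 hn (Psi hn p θ)), e1 2 (by norm_num)⟫ = cosA θ := by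
  have h1 := norm_pr12_Psi hn hp.le θ
  have h2 : pr12 hn (Psi hn p θ) 0 = p.1 * cosA θ := by
    rw [pr12_apply]; exact joinV_zero hn _
  simp only [PiLp.inner_apply, Fin.sum_univ_two]
  simp [hatv, e1, h1, h2]
  field_simp

lemma sliceA_circSymm {n : ℕ} (hn : 2 ≤ n) (ℓ : ℝ × Euc (n-2) → ℝ) {p : ℝ × Euc (n-2)}
    (hp : 0 < p.1) : sliceA hn (circSymm hn ℓ) p = arcA (ℓ p / (2 * p.1)) := by
  ext θ
  simp only [sliceA, circSymm, mem_ofPred_eq, arcA, hatv_inner_Psi hn hp]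
  have h1 := norm_pr12_Psi hn hp.le θ
  have h2 : prC hn (Psi hn p θ) = p.2 := congrArg Prod.snd (baseQ_Psi hn hp.le θ)
  rw [h1, h2]
  constructor
  · rintro ⟨-, h⟩; exact h
  · intro h
    refine ⟨?_, h⟩
    intro h0
    rw [h0, norm_zero] at h1
    exact hp.ne h1

open MeasureTheory Metric Set Filter
open scoped ENNReal NNReal Topology RealInnerProductSpace

/-- Polarization of a set with respect to an involution `s` and a half space `H`. -/
def pol {α : Type*} (s : α → α) (H E : Set α) : Set α :=
  {x | (x ∈ H ∧ (x ∈ E ∨ s x ∈ E)) ∨ (x ∉ H ∧ x ∈ E ∧ s x ∈ E)}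

lemma measurableSet_pol {α : Type*} [MeasurableSpace α] {s : α → α} (hs : Measurable s)
    {H E : Set α} (hH : MeasurableSet H) (hE : MeasurableSet E) : MeasurableSet (pol s H E) := by
  have : pol s H E = (H ∩ (E ∪ s ⁻¹' E)) ∪ (Hᶜ ∩ (E ∩ s ⁻¹' E)) := by
    ext x; simp [pol]
  rw [this]
  exact (hH.inter (hE.union (hs hE))).union (hH.compl.inter (hE.inter (hs hE)))

lemma measure_pol {α : Type*} [MeasurableSpace α] {μ : Measure α} {s : α → α}
    (hs : MeasurePreserving s μ μ) {H E : Set α} (hH : MeasurableSet H) (hE : MeasurableSet E)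
    (hss : ∀ x, s (s x) = x) (h1 : ∀ x ∈ H, s x ∉ H) (h2 : ∀ x, x ∉ H → s x ∉ H → s x = x) :
    μ (pol s H E) = μ E := by
  have hP := measurableSet_pol hs.measurable hH hE
  have h : E \ pol s H E = s ⁻¹' (pol s H E \ E) := by
    ext x
    simp only [pol, Set.mem_sdiff, mem_ofPred_eq, mem_preimage, hss]
    have a := h1 x
    have b := h1 (s x)
    have c := h2 x
    rw [hss] at b
    by_cases e1 : x ∈ H <;> by_cases e2 : s x ∈ H
    · exact absurd e2 (a e1)
    · simp only [e1, e2]; tauto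
    · simp only [e1, e2]; tauto
    · have := c e1 e2
      simp only [this]; tauto
  rw [← measure_inter_add_sdiff E hP, ← measure_inter_add_sdiff (pol s H E) hE, h,
    hs.measure_preimage (hP.diff hE).nullMeasurableSet, inter_comm]

lemma measure_pol_diff {α : Type*} [MeasurableSpace α] {μ : Measure α} {s : α → α}
    (hs : MeasurePreserving s μ μ) {H E F : Set α} (hH : MeasurableSet H) (hE : MeasurableSet E)
    (hFm : MeasurableSet F)
    (hss : ∀ x, s (s x) = x) (h1 : ∀ x ∈ H, s x ∉ H)
    (hF : ∀ x ∈ F, x ∉ H → s x ∈ F) :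
    μ (pol s H E \ F) + μ {x | (x ∈ F ∧ x ∉ E) ∧ s x ∈ E ∧ s x ∉ F} ≤ μ (E \ F) := by
  have hP := measurableSet_pol hs.measurable hH hE
  set X := pol s H E \ F with hX
  have hXm : MeasurableSet X := hP.diff hFm
  set Z : Set α := {x | (x ∈ E ∧ x ∉ F) ∧ s x ∈ F ∧ s x ∉ E} with hZ
  have hZm : MeasurableSet Z := by
    have : Z = (E \ F) ∩ s ⁻¹' (F \ E) := by ext x; simp [hZ]
    rw [this]
    exact (hE.diff hFm).inter (hs.measurable (hFm.diff hE))
  have hD : {x | (x ∈ F ∧ x ∉ E) ∧ s x ∈ E ∧ s x ∉ F} = s ⁻¹' Z := by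
    ext x; simp only [hZ, mem_ofPred_eq, mem_preimage, hss]; tauto
  rw [hD, hs.measure_preimage hZm.nullMeasurableSet, ← measure_inter_add_sdiff X hE,
    ← hs.measure_preimage (hXm.diff hE).nullMeasurableSet, add_assoc]
  have hdis1 : Disjoint (s ⁻¹' (X \ E)) Z := by
    rw [disjoint_left]
    rintro x ⟨hx, -⟩ ⟨-, hx2, -⟩
    exact hx.2 hx2
  have hdis2 : Disjoint (X ∩ E) (s ⁻¹' (X \ E) ∪ Z) := by
    rw [disjoint_left]
    rintro x ⟨⟨hxp, hxF⟩, hxE⟩ (⟨⟨hx2, hx3⟩, hx4⟩ | ⟨-, hx2, hx3⟩)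
    · simp only [pol, mem_ofPred_eq, hss] at hxp hx2
      have b := h1 (s x)
      rw [hss] at b
      tauto
    · simp only [pol, mem_ofPred_eq] at hxp
      have b := h1 x
      have c := hF (s x) hx2
      rw [hss] at c
      tauto
  rw [← measure_union hdis1 hZm, ← measure_union hdis2 ((hs.measurable (hXm.diff hE)).union hZm)]
  refine measure_mono ?_
  rintro x (⟨⟨-, hxF⟩, hxE⟩ | ⟨⟨hx2, hx3⟩, hx4⟩ | ⟨hx, -⟩)
  · exact ⟨hxE, hxF⟩
  · simp only [pol, mem_ofPred_eq, hss] at hx2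
    have b := h1 (s x)
    have c := hF x
    rw [hss] at b
    exact ⟨by tauto, fun h => by tauto⟩
  · exact hx

lemma zeroDens.mono_local {n : ℕ} {E E' U : Set (Euc n)} {x : Euc n} (h : zeroDens E x)
    (hU : IsOpen U) (hx : x ∈ U) (hs : E' ∩ U ⊆ E) : zeroDens E' x := by
  intro ε hε
  obtain ⟨r, hr, hball⟩ := Metric.isOpen_iff.1 hU x hx
  filter_upwards [h ε hε, Ioo_mem_nhdsGT hr] with ρ h1 hρ
  refine (measure_mono ?_).trans h1
  rintro y ⟨hy, hyb⟩
  exact ⟨hs ⟨hy, hball (ball_subset_ball hρ.2.le hyb)⟩, hyb⟩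

/-- The half space of a polarization. -/
def HA {n : ℕ} (hn : 2 ≤ n) (b : Ang) : Set (Euc n) := {x | 0 < ⟪uA hn b, x⟫}

lemma isOpen_HA {n : ℕ} (hn : 2 ≤ n) (b : Ang) : IsOpen (HA hn b) :=
  isOpen_lt continuous_const (by fun_prop)

lemma inner_sigA {n : ℕ} (hn : 2 ≤ n) (b : Ang) (x : Euc n) :
    ⟪uA hn b, sigA hn b x⟫ = - ⟪uA hn b, x⟫ := by
  rw [sigA_apply, inner_sub_right, inner_smul_right, real_inner_self_eq_norm_sq, norm_uA]; ring

lemma HA_one {n : ℕ} (hn : 2 ≤ n) (b : Ang) (x : Euc n) (hx : x ∈ HA hn b) :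
    sigA hn b x ∉ HA hn b := by
  simp only [HA, mem_ofPred_eq, inner_sigA] at hx ⊢; linarith

lemma HA_two {n : ℕ} (hn : 2 ≤ n) (b : Ang) (x : Euc n) (hx : x ∉ HA hn b)
    (hx2 : sigA hn b x ∉ HA hn b) : sigA hn b x = x := by
  simp only [HA, mem_ofPred_eq, inner_sigA] at hx hx2
  have : ⟪uA hn b, x⟫ = 0 := by linarith
  rw [sigA_apply, this]; simp

/-- polarization by `b` -/
def polA {n : ℕ} (hn : 2 ≤ n) (b : Ang) (E : Set (Euc n)) : Set (Euc n) :=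
  pol (sigA hn b) (HA hn b) E

lemma measurableSet_polA {n : ℕ} (hn : 2 ≤ n) (b : Ang) {E : Set (Euc n)} (hE : MeasurableSet E) :
    MeasurableSet (polA hn b E) :=
  measurableSet_pol (sigA hn b).continuous.measurable (isOpen_HA hn b).measurableSet hE

lemma ess_pol_subset {n : ℕ} (hn : 2 ≤ n) (b : Ang) {E : Set (Euc n)} (hE : MeasurableSet E) :
    (∀ x, x ∈ essBoundary (polA hn b E) → x ∈ essBoundary E ∨ sigA hn b x ∈ essBoundary E) ∧
    (∀ x, x ∈ essBoundary (polA hn b E) → sigA hn b x ∈ essBoundary (polA hn b E) →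
      x ∈ essBoundary E ∧ sigA hn b x ∈ essBoundary E) := by
  have hP := measurableSet_polA hn b hE
  set σ := sigA hn b
  have hσσ : ∀ x, σ (σ x) = x := sigA_sigA hn b
  have hpre : ∀ (A : Set (Euc n)) x, zeroDens (σ ⁻¹' A) x ↔ zeroDens A (σ x) :=
    fun A x => zeroDens_preimage σ x
  have hA : ∀ x, zeroDens E x → zeroDens E (σ x) → zeroDens (polA hn b E) x := by
    intro x h1 h2
    refine (h1.union ((hpre E x).2 h2)).mono ?_
    intro y hy
    simp only [polA, pol, mem_ofPred_eq] at hy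
    simp only [mem_union, mem_preimage]; tauto
  have hB : ∀ x, zeroDens Eᶜ x → zeroDens Eᶜ (σ x) → zeroDens (polA hn b E)ᶜ x := by
    intro x h1 h2
    refine (h1.union ((hpre Eᶜ x).2 h2)).mono ?_
    intro y hy
    simp only [polA, pol, mem_ofPred_eq, mem_compl_iff] at hy
    simp only [mem_union, mem_preimage, mem_compl_iff]; tauto
  have hC : ∀ x ∈ HA hn b, zeroDens Eᶜ x ∨ zeroDens Eᶜ (σ x) → zeroDens (polA hn b E)ᶜ x := by
    rintro x hx (h | h)
    · refine h.mono_local (isOpen_HA hn b) hx ?_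
      rintro y ⟨hy, hyH⟩
      simp only [polA, pol, mem_ofPred_eq, mem_compl_iff] at hy
      simp only [mem_compl_iff]; tauto
    · refine ((hpre Eᶜ x).2 h).mono_local (isOpen_HA hn b) hx ?_
      rintro y ⟨hy, hyH⟩
      simp only [polA, pol, mem_ofPred_eq, mem_compl_iff] at hy
      simp only [mem_compl_iff, mem_preimage]; tauto
  have hD : ∀ x, σ x ∈ HA hn b → zeroDens E x ∨ zeroDens E (σ x) → zeroDens (polA hn b E) x := by
    have hop : IsOpen (σ ⁻¹' HA hn b) := (isOpen_HA hn b).preimage σ.continuous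
    have hno : ∀ y, σ y ∈ HA hn b → y ∉ HA hn b := fun y hy => by
      have := HA_one hn b _ hy
      rwa [sigA_sigA] at this
    rintro x hx (h | h)
    · refine h.mono_local hop hx ?_
      rintro y ⟨hy, hyH⟩
      have := hno y hyH
      simp only [polA, pol, mem_ofPred_eq] at hy
      tauto
    · refine ((hpre E x).2 h).mono_local hop hx ?_
      rintro y ⟨hy, hyH⟩
      have := hno y hyH
      simp only [polA, pol, mem_ofPred_eq] at hy
      simp only [mem_preimage]; tauto
  simp only [mem_essBoundary_iff hE, mem_essBoundary_iff hP]
  refine ⟨fun x => ?_, fun x => ?_⟩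
  · by_cases h1 : x ∈ HA hn b
    · have a := hA x; have c := hC x h1
      clear hA hB hC hD hpre hσσ h1 hE hP
      generalize zeroDens (polA hn b E) x = P1 at *
      generalize zeroDens (polA hn b E)ᶜ x = P2 at *
      tauto
    by_cases h2 : σ x ∈ HA hn b
    · have a := hB x; have c := hD x h2
      clear hA hB hC hD hpre hσσ h1 h2 hE hP
      generalize zeroDens (polA hn b E) x = P1 at *
      generalize zeroDens (polA hn b E)ᶜ x = P2 at *
      tauto
    have := HA_two hn b x h1 h2
    change σ x = x at this
    have a := hA x; have b1 := hB x
    rw [this] at a b1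
    rintro ⟨h3, h4⟩
    exact Or.inl ⟨fun h => h3 (a h h), fun h => h4 (b1 h h)⟩
  · by_cases h1 : x ∈ HA hn b
    · have c := hC x h1
      have d := hD (σ x)
      rw [hσσ] at d
      rintro ⟨h3, h4⟩ ⟨h5, h6⟩
      exact ⟨⟨fun h => h5 (d h1 (Or.inr h)), fun h => h4 (c (Or.inl h))⟩,
        ⟨fun h => h5 (d h1 (Or.inl h)), fun h => h4 (c (Or.inr h))⟩⟩
    by_cases h2 : σ x ∈ HA hn b
    · have c := hC (σ x) h2
      have d := hD x h2
      rw [hσσ] at c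
      rintro ⟨h3, h4⟩ ⟨h5, h6⟩
      exact ⟨⟨fun h => h3 (d (Or.inl h)), fun h => h6 (c (Or.inr h))⟩,
        ⟨fun h => h3 (d (Or.inr h)), fun h => h6 (c (Or.inl h))⟩⟩
    have := HA_two hn b x h1 h2
    change σ x = x at this
    have a := hA x; have b1 := hB x
    rw [this] at a b1 ⊢
    rintro ⟨h3, h4⟩ -
    exact ⟨⟨fun h => h3 (a h h), fun h => h4 (b1 h h)⟩, ⟨fun h => h3 (a h h), fun h => h4 (b1 h h)⟩⟩

lemma ess_pol_le {n : ℕ} (hn : 2 ≤ n) (b : Ang) {E : Set (Euc n)} (hE : MeasurableSet E) (d : ℝ)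
    {A : Set (Euc n)} (hAm : MeasurableSet A) (hA : sigA hn b ⁻¹' A = A) :
    μH[d] (essBoundary (polA hn b E) ∩ A) ≤ μH[d] (essBoundary E ∩ A) := by
  have hP := measurableSet_polA hn b hE
  obtain ⟨h1, h2⟩ := ess_pol_subset hn b hE
  have hS := (measurableSet_essBoundary hE).inter hAm
  have hS' := (measurableSet_essBoundary hP).inter hAm
  set S := essBoundary E ∩ A
  set S' := essBoundary (polA hn b E) ∩ A
  have hmp : MeasurePreserving (sigA hn b) μH[d] μH[d] :=
    IsometryEquiv.measurePreserving_hausdorffMeasure (sigA hn b).toIsometryEquiv d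
  have hAx : ∀ x, sigA hn b x ∈ A ↔ x ∈ A := fun x => by
    rw [← mem_preimage, hA]
  have hd : ∀ T : Set (Euc n), MeasurableSet T → μH[d] T + μH[d] T =
      μH[d] (T ∪ sigA hn b ⁻¹' T) + μH[d] (T ∩ sigA hn b ⁻¹' T) := by
    intro T hT
    rw [measure_union_add_inter _ (hmp.measurable hT), hmp.measure_preimage hT.nullMeasurableSet]
  have hle : μH[d] S' + μH[d] S' ≤ μH[d] S + μH[d] S := by
    rw [hd S hS, hd S' hS']
    gcongr ?_ + ?_
    · refine measure_mono ?_
      rintro x (⟨hx, hxA⟩ | ⟨hx, hxA⟩)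
      · rcases h1 x hx with h | h
        · exact Or.inl ⟨h, hxA⟩
        · exact Or.inr ⟨h, (hAx x).2 hxA⟩
      · have := h1 _ hx
        rw [sigA_sigA] at this
        rcases this with h | h
        · exact Or.inr ⟨h, hxA⟩
        · exact Or.inl ⟨h, (hAx x).1 hxA⟩
    · refine measure_mono ?_
      rintro x ⟨⟨hx, hxA⟩, ⟨hx', hxA'⟩⟩
      obtain ⟨ha, hb⟩ := h2 x hx hx'
      exact ⟨⟨ha, hxA⟩, ⟨hb, hxA'⟩⟩
  rw [← two_mul, ← two_mul] at hle
  exact (ENNReal.mul_le_mul_iff_right (by simp) (by simp)).1 hle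

open MeasureTheory Metric Set Filter
open scoped ENNReal NNReal Topology RealInnerProductSpace

lemma mp_sub_left (b : Ang) : MeasurePreserving (fun θ : Ang => b - θ) volume volume :=
  Measure.measurePreserving_sub_left volume b

lemma measurableSet_sliceA {n : ℕ} (hn : 2 ≤ n) {E : Set (Euc n)} (hE : MeasurableSet E)
    (p : ℝ × Euc (n-2)) : MeasurableSet (sliceA hn E p) :=
  (continuous_Psi_right hn p).measurable hE

lemma volume_slice_pol {n : ℕ} (hn : 2 ≤ n) (b : Ang) {E : Set (Euc n)} (hE : MeasurableSet E)
    {p : ℝ × Euc (n-2)} (hp : 0 < p.1) :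
    volume (sliceA hn (polA hn b E) p) = volume (sliceA hn E p) := by
  have h : sliceA hn (polA hn b E) p =
      pol (fun θ : Ang => b - θ) (sliceA hn (HA hn b) p) (sliceA hn E p) := by
    ext θ
    simp only [sliceA, polA, pol, mem_ofPred_eq, sigA_Psi]
  rw [h]
  refine measure_pol (mp_sub_left b)
    (measurableSet_sliceA hn (isOpen_HA hn b).measurableSet p) (measurableSet_sliceA hn hE p)
    (fun x => sub_sub_cancel b x) (fun x hx => ?_) (fun x hx hx2 => ?_)
  · have := HA_one hn b _ hx
    rwa [sigA_Psi] at this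
  · simp only [sliceA, mem_ofPred_eq] at hx hx2
    rw [← sigA_Psi] at hx2
    have := HA_two hn b _ hx hx2
    rw [sigA_Psi] at this
    exact Psi_injective hn hp this

lemma measurableSet_circSymm {n : ℕ} (hn : 2 ≤ n) {ℓ : ℝ × Euc (n-2) → ℝ} (hl : Measurable ℓ) :
    MeasurableSet (circSymm hn ℓ) := by
  have h1 : Measurable (pr12 hn) := (continuous_pr12 hn).measurable
  have h2 : Measurable (prC hn) := (continuous_prC hn).measurable
  have h3 : Measurable (fun x => hatv (pr12 hn x)) := (h1.norm.inv).smul h1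
  refine MeasurableSet.inter (h1 (measurableSet_singleton 0).compl) ?_
  exact measurableSet_lt (Real.continuous_arccos.measurable.comp (h3.inner measurable_const))
    ((hl.comp (h1.norm.prodMk h2)).div (h1.norm.const_mul 2))

lemma circSymm_refl {n : ℕ} (hn : 2 ≤ n) (ℓ : ℝ × Euc (n-2) → ℝ) (b : Ang) (x : Euc n)
    (hx : x ∈ circSymm hn ℓ) (hxH : x ∉ HA hn b) : sigA hn b x ∈ circSymm hn ℓ := by
  have hb := baseQ_sigA hn b x
  simp only [baseQ, Prod.mk.injEq] at hb
  obtain ⟨hx0, hx1⟩ := hx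
  refine ⟨?_, ?_⟩
  · rw [← norm_ne_zero_iff, hb.1, norm_ne_zero_iff]; exact hx0
  · rw [hb.1, hb.2]
    refine lt_of_le_of_lt (Real.arccos_le_arccos ?_) hx1
    have hi : ∀ y : Euc n, ⟪hatv (pr12 hn y), e1 2 (by norm_num)⟫ =
        ‖pr12 hn y‖⁻¹ * y ⟨0, by omega⟩ := by
      intro y
      simp only [PiLp.inner_apply, Fin.sum_univ_two]
      simp [hatv, e1, pr12_apply]
    rw [hi, hi, hb.1]
    refine mul_le_mul_of_nonneg_left ?_ (by positivity)
    rw [sigA_apply]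
    simp only [PiLp.sub_apply, PiLp.smul_apply, smul_eq_mul]
    have h0 : uA hn b ⟨0, by omega⟩ = Real.sin (hfA b) := joinV_zero hn _
    rw [h0]
    have hs : 0 ≤ Real.sin (hfA b) :=
      Real.sin_nonneg_of_nonneg_of_le_pi (hfA_mem b).1.le (hfA_mem b).2
    simp only [HA, mem_ofPred_eq, not_lt] at hxH
    nlinarith

lemma volume_polar {n : ℕ} (hn : 2 ≤ n) {A : Set (Euc n)} (hA : MeasurableSet A) :
    volume A = ∫⁻ p in Ioi (0:ℝ) ×ˢ (univ : Set (Euc (n-2))),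
      ENNReal.ofReal p.1 * volume (sliceA hn A p) := by
  rw [← lintegral_indicator_one hA, polar_lintegral hn (measurable_one.indicator hA)]
  refine lintegral_congr fun p => ?_
  rw [← lintegral_indicator_one (measurableSet_sliceA hn hA p)]
  rfl

lemma measurable_slice {n : ℕ} (hn : 2 ≤ n) {A : Set (Euc n)} (hA : MeasurableSet A) :
    Measurable (fun p => volume (sliceA hn A p)) := by
  have : MeasurableSet ((fun z : (ℝ × Euc (n - 2)) × Ang => Psi hn z.1 z.2) ⁻¹' A) :=
    (continuous_Psi hn).measurable hA
  exact measurable_measure_prodMk_left this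

lemma integral_D {n : ℕ} (hn : 2 ≤ n) {F E : Set (Euc n)} (hF : MeasurableSet F)
    (hE : MeasurableSet E) :
    ∫⁻ b : Ang, volume {x | x ∈ F ∧ sigA hn b x ∈ E} =
      ∫⁻ p in Ioi (0:ℝ) ×ˢ (univ : Set (Euc (n-2))),
        ENNReal.ofReal p.1 * (volume (sliceA hn F p) * volume (sliceA hn E p)) := by
  have hm : ∀ b : Ang, MeasurableSet {x | x ∈ F ∧ sigA hn b x ∈ E} := fun b =>
    hF.inter ((sigA hn b).continuous.measurable hE)
  simp_rw [fun b => volume_polar hn (hm b)]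
  have hmeas : Measurable (fun z : (ℝ × Euc (n-2)) × (Ang × Ang) =>
      (F.indicator (1 : Euc n → ℝ≥0∞) (Psi hn z.1 z.2.2)) *
        (E.indicator (1 : Euc n → ℝ≥0∞) (Psi hn z.1 (z.2.1 - z.2.2)))) := by
    refine Measurable.mul ?_ ?_
    · exact (measurable_one.indicator hF).comp ((continuous_Psi hn).measurable.comp
        (f := fun z : (ℝ × Euc (n-2)) × (Ang × Ang) => (z.1, z.2.2)) (by fun_prop))
    · exact (measurable_one.indicator hE).comp ((continuous_Psi hn).measurable.comp
        (f := fun z : (ℝ × Euc (n-2)) × (Ang × Ang) => (z.1, z.2.1 - z.2.2)) (by fun_prop))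
  have hs : ∀ (b : Ang) (p : ℝ × Euc (n-2)), volume (sliceA hn {x | x ∈ F ∧ sigA hn b x ∈ E} p) =
      ∫⁻ θ : Ang, (F.indicator (1 : Euc n → ℝ≥0∞) (Psi hn p θ)) *
        (E.indicator (1 : Euc n → ℝ≥0∞) (Psi hn p (b - θ))) := by
    intro b p
    rw [← lintegral_indicator_one (measurableSet_sliceA hn (hm b) p)]
    refine lintegral_congr fun θ => ?_
    by_cases h1 : Psi hn p θ ∈ F <;> by_cases h2 : Psi hn p (b - θ) ∈ E <;>
      simp [sliceA, h1, h2, sigA_Psi, indicator]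
  simp_rw [hs]
  rw [lintegral_lintegral_swap]
  · refine lintegral_congr fun p => ?_
    rw [lintegral_const_mul]
    · congr 1
      rw [lintegral_lintegral_swap]
      · have hb : ∀ θ : Ang, ∫⁻ b : Ang, (F.indicator (1 : Euc n → ℝ≥0∞) (Psi hn p θ)) *
            (E.indicator (1 : Euc n → ℝ≥0∞) (Psi hn p (b - θ))) =
            (F.indicator (1 : Euc n → ℝ≥0∞) (Psi hn p θ)) * volume (sliceA hn E p) := by
          intro θ
          rw [lintegral_const_mul]
          · congr 1
            rw [lintegral_sub_right_eq_self (fun b => E.indicator (1 : Euc n → ℝ≥0∞) (Psi hn p b)) θ,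
              ← lintegral_indicator_one (measurableSet_sliceA hn hE p)]
            rfl
          · exact (measurable_one.indicator hE).comp
              ((continuous_Psi_right hn p).measurable.comp (measurable_id.sub_const θ))
        simp_rw [hb]
        rw [lintegral_mul_const, ← lintegral_indicator_one (measurableSet_sliceA hn hF p)]
        · rfl
        · exact (measurable_one.indicator hF).comp (continuous_Psi_right hn p).measurable
      · exact (hmeas.comp (measurable_const.prodMk measurable_id)).aemeasurable
    · exact (hmeas.comp (measurable_const.prodMk measurable_id)).lintegral_prod_right'
  · refine (Measurable.mul (by fun_prop) ?_).aemeasurable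
    have : Measurable (fun z : (Ang × (ℝ × Euc (n-2))) × Ang => 
      (F.indicator (1 : Euc n → ℝ≥0∞) (Psi hn z.1.2 z.2)) *
        (E.indicator (1 : Euc n → ℝ≥0∞) (Psi hn z.1.2 (z.1.1 - z.2)))) :=
      hmeas.comp (f := fun z : (Ang × (ℝ × Euc (n-2))) × Ang => (z.1.2, (z.1.1, z.2))) (by fun_prop)
    exact this.lintegral_prod_right'

open MeasureTheory Metric Set Filter
open scoped ENNReal NNReal Topology RealInnerProductSpace

lemma volume_polA {n : ℕ} (hn : 2 ≤ n) (b : Ang) {E : Set (Euc n)} (hE : MeasurableSet E) :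
    volume (polA hn b E) = volume E :=
  measure_pol (sigA hn b).measurePreserving (isOpen_HA hn b).measurableSet hE (sigA_sigA hn b)
    (HA_one hn b) (HA_two hn b)

lemma exists_good_b {n : ℕ} (hn : 2 ≤ n) {F E : Set (Euc n)} (hF : MeasurableSet F)
    (hE : MeasurableSet E) (hv : volume E ≠ ⊤) :
    ∃ b : Ang, ∫⁻ p in Ioi (0:ℝ) ×ˢ (univ : Set (Euc (n-2))),
        ENNReal.ofReal p.1 * (volume (sliceA hn (F \ E) p) * volume (sliceA hn (E \ F) p)) ≤
      volume (univ : Set Ang) * volume {x | (x ∈ F ∧ x ∉ E) ∧ sigA hn b x ∈ E ∧ sigA hn b x ∉ F} := by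
  have h := integral_D hn (hF.diff hE) (hE.diff hF)
  have hle : ∀ b, volume {x | x ∈ F \ E ∧ sigA hn b x ∈ E \ F} ≤ volume E := by
    intro b
    rw [← (sigA hn b).measurePreserving.measure_preimage hE.nullMeasurableSet]
    exact measure_mono fun x hx => hx.2.1
  have hu : volume (univ : Set Ang) ≠ 0 := by
    rw [AddCircle.measure_univ]; simp [Real.pi_pos]
  have hu' : volume (univ : Set Ang) ≠ ⊤ := measure_ne_top _ _
  have hfin : ∫⁻ b : Ang, volume {x | x ∈ F \ E ∧ sigA hn b x ∈ E \ F} ≠ ⊤ := by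
    refine ne_top_of_le_ne_top ?_ (lintegral_mono hle)
    rw [lintegral_const]
    exact ENNReal.mul_ne_top hv hu'
  obtain ⟨b, hb⟩ := exists_laverage_le (μ := (volume : Measure Ang))
    (fun h0 => hu (by rw [h0]; rfl)) hfin
  refine ⟨b, ?_⟩
  rw [← h]
  rw [laverage_eq, ENNReal.div_le_iff hu hu'] at hb
  exact hb.trans (le_of_eq (mul_comm _ _))

lemma sliceA_diff {n : ℕ} (hn : 2 ≤ n) (E F : Set (Euc n)) (p : ℝ × Euc (n-2)) :
    sliceA hn (E \ F) p = sliceA hn E p \ sliceA hn F p := rfl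

theorem exists_polar_seq {n : ℕ} (hn : 2 ≤ n) {F E : Set (Euc n)} (hF : MeasurableSet F)
    (hE : MeasurableSet E) (hv : volume E ≠ ⊤)
    (hFr : ∀ b, ∀ x ∈ F, x ∉ HA hn b → sigA hn b x ∈ F)
    (hEF : ∀ᵐ p ∂(volume.restrict (Ioi (0:ℝ) ×ˢ (univ : Set (Euc (n-2))))),
      volume (sliceA hn E p) = volume (sliceA hn F p)) :
    ∃ Es : ℕ → Set (Euc n), (∀ k, MeasurableSet (Es k)) ∧
      (∀ k (d : ℝ) A, MeasurableSet A → (∀ b, sigA hn b ⁻¹' A = A) →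
        μH[d] (essBoundary (Es k) ∩ A) ≤ μH[d] (essBoundary E ∩ A)) ∧
      Tendsto (fun k => volume (Es k \ F)) atTop (𝓝 0) ∧
      Tendsto (fun k => volume (F \ Es k)) atTop (𝓝 0) := by
  set Ω : Set (ℝ × Euc (n-2)) := Ioi (0:ℝ) ×ˢ univ with hΩ
  have hΩm : MeasurableSet Ω := measurableSet_Ioi.prod MeasurableSet.univ
  have hex : ∀ X : Set (Euc n), ∃ b : Ang, MeasurableSet X → volume X ≠ ⊤ →
      ∫⁻ p in Ω, ENNReal.ofReal p.1 * (volume (sliceA hn (F \ X) p) * volume (sliceA hn (X \ F) p)) ≤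
      volume (univ : Set Ang) * volume {x | (x ∈ F ∧ x ∉ X) ∧ sigA hn b x ∈ X ∧ sigA hn b x ∉ F} := by
    intro X
    by_cases h : MeasurableSet X ∧ volume X ≠ ⊤
    · obtain ⟨b, hb⟩ := exists_good_b hn hF h.1 h.2
      exact ⟨b, fun _ _ => hb⟩
    · exact ⟨0, fun h1 h2 => absurd ⟨h1, h2⟩ h⟩
  choose bf hbf using hex
  set Es : ℕ → Set (Euc n) := fun k => (fun X => polA hn (bf X) X)^[k] E with hEs
  have hE0 : Es 0 = E := rfl
  have hsucc : ∀ k, Es (k+1) = polA hn (bf (Es k)) (Es k) := fun k => by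
    simp only [hEs, Function.iterate_succ_apply']
  have hm : ∀ k, MeasurableSet (Es k) := by
    intro k
    induction k with
    | zero => exact hE
    | succ k ih => rw [hsucc]; exact measurableSet_polA hn _ ih
  have hvol : ∀ k, volume (Es k) = volume E := by
    intro k
    induction k with
    | zero => rfl
    | succ k ih => rw [hsucc, volume_polA hn _ (hm k), ih]
  have hsl : ∀ k p, 0 < p.1 → volume (sliceA hn (Es k) p) = volume (sliceA hn E p) := by
    intro k p hp
    induction k with
    | zero => rfl
    | succ k ih => rw [hsucc, volume_slice_pol hn _ (hm k) hp, ih]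
  set D : ℕ → ℝ≥0∞ := fun k => volume {x | (x ∈ F ∧ x ∉ Es k) ∧
    sigA hn (bf (Es k)) x ∈ Es k ∧ sigA hn (bf (Es k)) x ∉ F} with hD
  have hstep : ∀ k, volume (Es (k+1) \ F) + D k ≤ volume (Es k \ F) := fun k => by
    rw [hsucc]
    exact measure_pol_diff (sigA hn _).measurePreserving (isOpen_HA hn _).measurableSet (hm k) hF
      (sigA_sigA hn _) (HA_one hn _) (hFr _)
  have hsum : ∀ N, volume (Es N \ F) + ∑ k ∈ Finset.range N, D k ≤ volume E := by
    intro N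
    induction N with
    | zero => simpa [hE0] using measure_mono (μ := volume) (sdiff_subset (s := E) (t := F))
    | succ N ih =>
      refine le_trans ?_ ih
      rw [Finset.sum_range_succ, add_comm (∑ k ∈ Finset.range N, D k), ← add_assoc]
      gcongr
      exact hstep N
  have hDt : Tendsto D atTop (𝓝 0) := by
    refine ENNReal.tendsto_atTop_zero_of_tsum_ne_top (ne_top_of_le_ne_top hv ?_)
    rw [ENNReal.tsum_eq_iSup_nat]
    exact iSup_le fun N => le_add_self.trans (hsum N)
  set g : ℕ → ℝ × Euc (n-2) → ℝ≥0∞ := fun k p => volume (sliceA hn (Es k \ F) p) with hg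
  have hgm : ∀ k, Measurable (g k) := fun k => measurable_slice hn ((hm k).diff hF)
  have hgF : ∀ k, ∀ᵐ p ∂(volume.restrict Ω), volume (sliceA hn (F \ Es k) p) = g k p := by
    intro k
    filter_upwards [hEF, ae_restrict_mem hΩm] with p hp hpΩ
    have h0 : volume (sliceA hn (Es k) p) = volume (sliceA hn F p) := by
      rw [hsl k p hpΩ.1, hp]
    have a := measure_inter_add_sdiff (μ := volume) (sliceA hn (Es k) p) (measurableSet_sliceA hn hF p)
    have c := measure_inter_add_sdiff (μ := volume) (sliceA hn F p) (measurableSet_sliceA hn (hm k) p)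
    rw [← h0, ← a, inter_comm] at c
    exact (ENNReal.add_right_inj (measure_ne_top _ _)).1 c
  set I : ℕ → ℝ≥0∞ := fun k => ∫⁻ p in Ω, ENNReal.ofReal p.1 * (g k p * g k p) with hI
  have hIt : Tendsto I atTop (𝓝 0) := by
    have hb : ∀ k, I k ≤ volume (univ : Set Ang) * D k := by
      intro k
      refine le_trans (le_of_eq ?_) (hbf (Es k) (hm k) (by rw [hvol k]; exact hv))
      refine lintegral_congr_ae ?_
      filter_upwards [hgF k] with p hp
      rw [hp]
    have ht : Tendsto (fun k => volume (univ : Set Ang) * D k) atTop (𝓝 0) := by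
      have := ENNReal.Tendsto.const_mul hDt (Or.inr (measure_ne_top volume (univ : Set Ang)))
      rwa [mul_zero] at this
    exact tendsto_of_tendsto_of_tendsto_of_le_of_le tendsto_const_nhds ht (fun _ => zero_le) hb
  set w : ℝ × Euc (n-2) → ℝ≥0∞ := fun p => volume (sliceA hn E p) with hw
  have hwm : Measurable w := measurable_slice hn hE
  have hgw : ∀ k p, 0 < p.1 → g k p ≤ w p := by
    intro k p hp
    rw [hw, hg]
    simp only
    rw [← hsl k p hp]
    exact measure_mono sdiff_subset
  have hvk : ∀ k, volume (Es k \ F) = ∫⁻ p in Ω, ENNReal.ofReal p.1 * g k p := fun k =>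
    volume_polar hn ((hm k).diff hF)
  have hW : Tendsto (fun j : ℕ => ∫⁻ p in Ω, ENNReal.ofReal p.1 * min (w p) ((j:ℝ≥0∞)+1)⁻¹) atTop (𝓝 0) := by
    have : (0 : ℝ≥0∞) = ∫⁻ p in Ω, 0 := by simp
    rw [this]
    refine tendsto_lintegral_of_dominated_convergence (fun p => ENNReal.ofReal p.1 * w p)
      (fun j => ?_) (fun j => ?_) ?_ ?_
    · exact (ENNReal.measurable_ofReal.comp measurable_fst).mul (hwm.min measurable_const)
    · exact Eventually.of_forall fun p => mul_le_mul_right (min_le_left _ _) _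
    · rw [← volume_polar hn hE]; exact hv
    · refine Eventually.of_forall fun p => ?_
      have h1 : Tendsto (fun j : ℕ => ((j:ℝ≥0∞)+1)⁻¹) atTop (𝓝 0) := by
        have := (tendsto_add_atTop_iff_nat 1).2 ENNReal.tendsto_inv_nat_nhds_zero
        simpa using this
      have h2 : Tendsto (fun j : ℕ => min (w p) ((j:ℝ≥0∞)+1)⁻¹) atTop (𝓝 0) :=
        tendsto_of_tendsto_of_tendsto_of_le_of_le tendsto_const_nhds h1 (fun _ => zero_le)
          (fun j => min_le_right _ _)
      have := ENNReal.Tendsto.const_mul h2 (Or.inr (ENNReal.ofReal_ne_top (r := p.1)))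
      rwa [mul_zero] at this
  have hmain : Tendsto (fun k => volume (Es k \ F)) atTop (𝓝 0) := by
    rw [ENNReal.tendsto_atTop_zero]
    intro ε hε
    have hε2 : 0 < ε / 2 := ENNReal.half_pos hε.ne'
    obtain ⟨j, hj⟩ := ((ENNReal.tendsto_atTop_zero.1 hW) (ε/2) hε2)
    have hj := hj j le_rfl
    have hIt2 : Tendsto (fun k => ((j:ℝ≥0∞)+1) * I k) atTop (𝓝 0) := by
      have := ENNReal.Tendsto.const_mul hIt (Or.inr (show ((j:ℝ≥0∞)+1) ≠ ⊤ by simp))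
      rwa [mul_zero] at this
    obtain ⟨N, hN⟩ := (ENNReal.tendsto_atTop_zero.1 hIt2) (ε/2) hε2
    refine ⟨N, fun k hk => ?_⟩
    have hpt : ∀ᵐ p ∂(volume.restrict Ω), ENNReal.ofReal p.1 * g k p ≤
        ((j:ℝ≥0∞)+1) * (ENNReal.ofReal p.1 * (g k p * g k p)) +
          ENNReal.ofReal p.1 * min (w p) ((j:ℝ≥0∞)+1)⁻¹ := by
      filter_upwards [ae_restrict_mem hΩm] with p hp
      rcases le_total (g k p) ((j:ℝ≥0∞)+1)⁻¹ with h | h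
      · refine le_add_left ?_
        gcongr
        exact le_min (hgw k p hp.1) h
      · refine le_add_right ?_
        have h1 : 1 ≤ ((j:ℝ≥0∞)+1) * g k p := by
          calc (1:ℝ≥0∞) = ((j:ℝ≥0∞)+1) * ((j:ℝ≥0∞)+1)⁻¹ :=
                (ENNReal.mul_inv_cancel (by simp) (by simp)).symm
            _ ≤ _ := by gcongr
        calc ENNReal.ofReal p.1 * g k p = (ENNReal.ofReal p.1 * g k p) * 1 := (mul_one _).symm
          _ ≤ (ENNReal.ofReal p.1 * g k p) * (((j:ℝ≥0∞)+1) * g k p) := by gcongr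
          _ = _ := by ring
    calc volume (Es k \ F) = ∫⁻ p in Ω, ENNReal.ofReal p.1 * g k p := hvk k
      _ ≤ ∫⁻ p in Ω, (((j:ℝ≥0∞)+1) * (ENNReal.ofReal p.1 * (g k p * g k p)) +
          ENNReal.ofReal p.1 * min (w p) ((j:ℝ≥0∞)+1)⁻¹) := lintegral_mono_ae hpt
      _ = ((j:ℝ≥0∞)+1) * I k + ∫⁻ p in Ω, ENNReal.ofReal p.1 * min (w p) ((j:ℝ≥0∞)+1)⁻¹ := by
        have hmm : Measurable fun p : ℝ × Euc (n-2) => ENNReal.ofReal p.1 * (g k p * g k p) :=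
          (ENNReal.measurable_ofReal.comp measurable_fst).mul ((hgm k).mul (hgm k))
        rw [lintegral_add_left (hmm.const_mul _), lintegral_const_mul _ hmm]
      _ ≤ ε/2 + ε/2 := add_le_add (hN k hk) hj
      _ = ε := ENNReal.add_halves ε
  refine ⟨Es, hm, ?_, hmain, ?_⟩
  · intro k d A hA hAs
    induction k with
    | zero => exact le_rfl
    | succ k ih => rw [hsucc]; exact (ess_pol_le hn _ (hm k) d hA (hAs _)).trans ih
  · refine hmain.congr fun k => ?_
    rw [hvk k, volume_polar hn (hF.diff (hm k))]
    refine lintegral_congr_ae ?_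
    filter_upwards [hgF k] with p hp
    rw [hp]

lemma slice_eq_of_distrib {n : ℕ} (hn : 2 ≤ n) {ℓ : ℝ × Euc (n-2) → ℝ}
    (hl_nonneg : ∀ p ∈ Ioi (0:ℝ) ×ˢ (univ : Set (Euc (n-2))), 0 ≤ ℓ p)
    (hl_le : ∀ᵐ p ∂(volume.restrict (Ioi (0:ℝ) ×ˢ (univ : Set (Euc (n-2))))),
      ℓ p ≤ 2 * Real.pi * p.1) {E : Set (Euc n)} (hE : CircDistrib hn ℓ E) :
    ∀ᵐ p ∂(volume.restrict (Ioi (0:ℝ) ×ˢ (univ : Set (Euc (n-2))))),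
      volume (sliceA hn E p) = volume (sliceA hn (circSymm hn ℓ) p) := by
  have hΩm : MeasurableSet (Ioi (0:ℝ) ×ˢ (univ : Set (Euc (n-2)))) :=
    measurableSet_Ioi.prod MeasurableSet.univ
  filter_upwards [hl_le, hE, ae_restrict_mem hΩm] with p h1 h2 h3
  have hp : 0 < p.1 := h3.1
  have h0 := hl_nonneg p h3
  rw [slice_len hn E hp] at h2
  rw [sliceA_circSymm hn ℓ hp, volume_arcA]
  · have h4 : ENNReal.ofReal p.1 * ENNReal.ofReal (2 * (ℓ p / (2 * p.1))) = ENNReal.ofReal (ℓ p) := by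
      rw [← ENNReal.ofReal_mul hp.le]; congr 1; field_simp
    rw [← h4] at h2
    exact (ENNReal.mul_right_inj (by simpa using hp) ENNReal.ofReal_ne_top).1 h2
  · rw [div_le_iff₀ (by positivity)]; linarith

open MeasureTheory Metric Set Filter
open scoped ENNReal NNReal Topology RealInnerProductSpace

open scoped CompactlySupported

/-- Vague compactness along an ultrafilter. -/
lemma exists_vague_limit {n : ℕ} (lam : ℕ → Measure (Euc n)) (M : ℝ≥0)
    (hM : ∀ k, lam k univ ≤ M) :
    ∃ (U : Ultrafilter ℕ) (mu : Measure (Euc n)), (U : Filter ℕ) ≤ atTop ∧ mu.Regular ∧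
      ∀ φ : Euc n → ℝ, Continuous φ → HasCompactSupport φ →
        Tendsto (fun k => ∫ x, φ x ∂(lam k)) U (𝓝 (∫ x, φ x ∂mu)) := by
  have hfin : ∀ k, IsFiniteMeasure (lam k) := fun k =>
    ⟨(hM k).trans_lt ENNReal.coe_lt_top⟩
  set U : Ultrafilter ℕ := Ultrafilter.of atTop with hU
  have hUle : (U : Filter ℕ) ≤ atTop := Ultrafilter.of_le atTop
  have L : ∀ g : C_c(Euc n, ℝ), ∃ y : ℝ, Tendsto (fun k => ∫ x, g x ∂(lam k)) U (𝓝 y) := by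
    intro g
    obtain ⟨C, hC⟩ := g.hasCompactSupport.exists_bound_of_continuous g.continuous
    have hC0 : 0 ≤ C := (norm_nonneg _).trans (hC 0)
    have hb : ∀ k, (∫ x, g x ∂(lam k)) ∈ closedBall (0:ℝ) (C * M) := by
      intro k
      rw [mem_closedBall_zero_iff]
      refine (norm_integral_le_of_norm_le_const (C := C) (Eventually.of_forall hC)).trans ?_
      refine mul_le_mul_of_nonneg_left ?_ hC0
      exact ENNReal.toReal_mono ENNReal.coe_ne_top (hM k)
    obtain ⟨y, -, hy⟩ := (isCompact_closedBall (0:ℝ) (C * M)).ultrafilter_le_nhds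
      (U.map (fun k => ∫ x, g x ∂(lam k)))
      (by rw [le_principal_iff]; exact Filter.mem_map.2 (Filter.univ_mem' hb))
    exact ⟨y, hy⟩
  choose Λ hΛ using L
  let Λ' : C_c(Euc n, ℝ) →ₚ[ℝ] ℝ :=
  { toFun := Λ
    map_add' g g' := by
      refine tendsto_nhds_unique (hΛ (g + g')) (((hΛ g).add (hΛ g')).congr fun k => ?_)
      exact (integral_add g.integrable g'.integrable).symm
    map_smul' c g := by
      refine tendsto_nhds_unique (hΛ (c • g)) (((hΛ g).const_smul c).congr fun k => ?_)
      exact (integral_smul c _).symm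
    monotone' g g' hgg' := by
      refine le_of_tendsto_of_tendsto' (hΛ g) (hΛ g') (fun k ↦ ?_)
      exact integral_mono g.integrable g'.integrable hgg' }
  refine ⟨U, RealRMK.rieszMeasure Λ', hUle, RealRMK.regular_rieszMeasure Λ', fun φ hφ hc => ?_⟩
  have := RealRMK.integral_rieszMeasure Λ' ⟨⟨φ, hφ⟩, hc⟩
  rw [show (∫ x, φ x ∂(RealRMK.rieszMeasure Λ')) = Λ' ⟨⟨φ, hφ⟩, hc⟩ from this]
  exact hΛ ⟨⟨φ, hφ⟩, hc⟩

lemma vague_open_le {n : ℕ} {lam : ℕ → Measure (Euc n)} {U : Ultrafilter ℕ} {mu : Measure (Euc n)}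
    (hreg : mu.Regular)
    (hlim : ∀ φ : Euc n → ℝ, Continuous φ → HasCompactSupport φ →
        Tendsto (fun k => ∫ x, φ x ∂(lam k)) U (𝓝 (∫ x, φ x ∂mu)))
    {W : Set (Euc n)} (hW : IsOpen W) {M : ℝ≥0∞} (hMt : M ≠ ⊤) (hM : ∀ k, lam k W ≤ M) :
    mu W ≤ M := by
  rw [hW.measure_eq_iSup_isCompact]
  refine iSup_le fun K => iSup_le fun hKW => iSup_le fun hK => ?_
  obtain ⟨φ, hφ, hc, hs, h01, hφK⟩ := exists_bump hK hW hKW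
  have h1 : ∫ x, φ x ∂mu ≤ M.toReal := by
    refine le_of_tendsto (hlim φ hφ.continuous hc) (Eventually.of_forall fun k => ?_)
    have hb : ∀ x, φ x ≤ W.indicator (fun _ => (1:ℝ)) x := by
      intro x
      by_cases hx : x ∈ W
      · rw [indicator_of_mem hx]; exact (h01 x).2
      · rw [indicator_of_notMem hx, image_eq_zero_of_notMem_tsupport (fun h => hx (hs h))]
    have hWf : lam k W ≠ ⊤ := ne_top_of_le_ne_top hMt (hM k)
    calc ∫ x, φ x ∂(lam k) ≤ ∫ x, W.indicator (fun _ => (1:ℝ)) x ∂(lam k) := by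
          refine integral_mono_of_nonneg (Eventually.of_forall fun x => (h01 x).1) ?_
            (Eventually.of_forall hb)
          rw [integrable_indicator_iff hW.measurableSet]
          exact integrableOn_const hWf
      _ = (lam k W).toReal := by
          rw [integral_indicator hW.measurableSet]; simp [Measure.real]
      _ ≤ M.toReal := ENNReal.toReal_mono hMt (hM k)
  have hi : Integrable φ mu := hφ.continuous.integrable_of_hasCompactSupport hc
  have h2 : (mu K).toReal ≤ ∫ x, φ x ∂mu := by
    calc (mu K).toReal = ∫ x, K.indicator (fun _ => (1:ℝ)) x ∂mu := by
          rw [integral_indicator hK.measurableSet]; simp [Measure.real]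
      _ ≤ _ := by
        refine integral_mono_of_nonneg (Eventually.of_forall fun x =>
          indicator_nonneg (fun _ _ => zero_le_one) x) hi (Eventually.of_forall fun x => ?_)
        by_cases hx : x ∈ K
        · simp only [indicator_of_mem hx, hφK x hx]; exact le_rfl
        · simp only [indicator_of_notMem hx]; exact (h01 x).1
  rw [← ENNReal.ofReal_toReal hMt, ← ENNReal.ofReal_toReal (hK.measure_lt_top (μ := mu)).ne]
  exact ENNReal.ofReal_le_ofReal (h2.trans h1)

lemma sig_preimage_baseQ {n : ℕ} (hn : 2 ≤ n) (B : Set (ℝ × Euc (n-2))) (b : Ang) :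
    sigA hn b ⁻¹' (baseQ hn ⁻¹' B) = baseQ hn ⁻¹' B := by
  ext x; simp only [mem_preimage, baseQ_sigA]

lemma tendsto_setIntegral_sets {n : ℕ} {F : Set (Euc n)} {Es : ℕ → Set (Euc n)}
    (hF : MeasurableSet F) (hEs : ∀ k, MeasurableSet (Es k))
    (h1 : Tendsto (fun k => volume (Es k \ F)) atTop (𝓝 0))
    (h2 : Tendsto (fun k => volume (F \ Es k)) atTop (𝓝 0))
    {f : Euc n → ℝ} (hf : Integrable f) :
    Tendsto (fun k => ∫ x in Es k, f x) atTop (𝓝 (∫ x in F, f x)) := by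
  have a1 := hf.tendsto_setIntegral_nhds_zero (s := fun k => Es k \ F) h1
  have a2 := hf.tendsto_setIntegral_nhds_zero (s := fun k => F \ Es k) h2
  have h := (a1.sub a2).add (tendsto_const_nhds (x := ∫ x in F, f x))
  rw [sub_zero, zero_add] at h
  refine h.congr fun k => ?_
  have b1 := integral_inter_add_sdiff (s := Es k) hF hf.integrableOn
  have b2 := integral_inter_add_sdiff (s := F) (hEs k) hf.integrableOn
  rw [inter_comm] at b2
  linarith

theorem perim_main {m : ℕ} (hn : 2 ≤ m + 1) {F E : Set (Euc (m+1))} (hF : MeasurableSet F)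
    (hE : MeasurableSet E) (hv : volume E ≠ ⊤)
    (hFr : ∀ b, ∀ x ∈ F, x ∉ HA hn b → sigA hn b x ∈ F)
    (hEF : ∀ᵐ p ∂(volume.restrict (Ioi (0:ℝ) ×ˢ (univ : Set (Euc (m+1-2))))),
      volume (sliceA hn E p) = volume (sliceA hn F p))
    (hper : μH[(m:ℝ)] (essBoundary E) < ⊤) :
    μH[(m:ℝ)] (essBoundary F) < ⊤ ∧
    ∀ B : Set (ℝ × Euc (m+1-2)), MeasurableSet B →
      μH[(m:ℝ)] (essBoundary F ∩ baseQ hn ⁻¹' B) ≤ μH[(m:ℝ)] (essBoundary E ∩ baseQ hn ⁻¹' B) := by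
  obtain ⟨Es, hEs, hess, ht1, ht2⟩ := exists_polar_seq hn hF hE hv hFr hEF
  have hc0 : (cH m : ℝ≥0∞) ≠ 0 := by
    have := cH_pos m
    simpa using this.ne'
  set lam0 : Measure (Euc (m+1)) :=
    ((cH m)⁻¹ : ℝ≥0) • (μH[(m:ℝ)] : Measure (Euc (m+1))).restrict (essBoundary E) with hlam0
  set lam : ℕ → Measure (Euc (m+1)) := fun k =>
    ((cH m)⁻¹ : ℝ≥0) • (μH[(m:ℝ)] : Measure (Euc (m+1))).restrict (essBoundary (Es k)) with hlam
  have hle : ∀ k A, MeasurableSet A → (∀ b, sigA hn b ⁻¹' A = A) → lam k A ≤ lam0 A := by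
    intro k A hA hAs
    simp only [hlam, hlam0, Measure.smul_apply]
    refine smul_le_smul_of_nonneg_left ?_ zero_le
    rw [Measure.restrict_apply hA, Measure.restrict_apply hA, inter_comm, inter_comm A]
    exact hess k m A hA hAs
  have hfin0 : lam0 univ < ⊤ := by
    simp only [hlam0, Measure.smul_apply, Measure.restrict_apply_univ]
    exact ENNReal.mul_lt_top ENNReal.coe_lt_top hper
  have hF0 : IsFiniteMeasure lam0 := ⟨hfin0⟩
  obtain ⟨U, mu, hU, hreg, hlim⟩ := exists_vague_limit lam (lam0 univ).toNNReal (fun k => by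
    rw [ENNReal.coe_toNNReal hfin0.ne]
    exact hle k univ MeasurableSet.univ (fun b => preimage_univ))
  have hopen : ∀ W : Set (ℝ × Euc (m+1-2)), IsOpen W →
      mu (baseQ hn ⁻¹' W) ≤ lam0 (baseQ hn ⁻¹' W) := by
    intro W hW
    have hWo : IsOpen (baseQ hn ⁻¹' W) := hW.preimage (continuous_baseQ hn)
    exact vague_open_le hreg hlim hWo (measure_ne_top _ _)
      (fun k => hle k _ hWo.measurableSet (sig_preimage_baseQ hn W))
  have hmufin : IsFiniteMeasure mu := ⟨by
    have := hopen univ isOpen_univ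
    rw [preimage_univ] at this
    exact this.trans_lt hfin0⟩
  have hDom : DomBy F mu := by
    intro v φ hφ hc
    have hI := integrable_fderiv hφ hc v
    have l1 := ((tendsto_setIntegral_sets hF hEs ht1 ht2 hI).mono_left hU).abs
    have l2 := (hlim (fun x => |φ x|) hφ.continuous.abs
      (hc.comp_left (g := fun t : ℝ => |t|) abs_zero)).const_mul ‖v‖
    refine le_of_tendsto_of_tendsto' l1 l2 fun k => ?_
    have hk : μH[(m:ℝ)] (essBoundary (Es k)) < ⊤ := by
      have := hess k m univ MeasurableSet.univ (fun b => preimage_univ)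
      rw [inter_univ, inter_univ] at this
      exact this.trans_lt hper
    have hf := federer v (hEs k) hk hφ hc
    have hcp : (0:ℝ) < cH m := NNReal.coe_pos.2 (cH_pos m)
    have : ∫ x, |φ x| ∂(lam k) = (cH m : ℝ)⁻¹ * ∫ x in essBoundary (Es k), |φ x| ∂μH[(m:ℝ)] := by
      simp only [hlam]
      rw [integral_smul_nnreal_measure, NNReal.smul_def, NNReal.coe_inv, smul_eq_mul]
    rw [this, ← mul_assoc, mul_comm ‖v‖, mul_assoc, ← div_eq_inv_mul, le_div_iff₀ hcp, mul_comm]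
    exact hf
  have hcan : ∀ A, MeasurableSet A → (cH m : ℝ≥0∞) * lam0 A = μH[(m:ℝ)] (essBoundary E ∩ A) := by
    intro A hA
    simp only [hlam0, Measure.smul_apply]
    rw [Measure.restrict_apply hA, ENNReal.smul_def, smul_eq_mul, ← mul_assoc,
      ENNReal.coe_inv (cH_pos m).ne', ENNReal.mul_inv_cancel hc0 ENNReal.coe_ne_top, one_mul,
      inter_comm]
  refine ⟨?_, fun B hB => ?_⟩
  · have := ess_le hF hDom univ
    rw [inter_univ] at this
    exact this.trans_lt (ENNReal.mul_lt_top ENNReal.coe_lt_top (measure_lt_top _ _))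
  · have hBm : MeasurableSet (baseQ hn ⁻¹' B) := (continuous_baseQ hn).measurable hB
    rw [← hcan _ hBm]
    refine (ess_le hF hDom _).trans (mul_le_mul_right ?_ _)
    have hq : Measurable (baseQ hn) := (continuous_baseQ hn).measurable
    refine ENNReal.le_of_forall_pos_le_add fun ε hε _ => ?_
    obtain ⟨W, hBW, hWo, hWle⟩ := B.exists_isOpen_le_add (lam0.map (baseQ hn))
      (ε := (ε : ℝ≥0∞)) (by simpa using hε.ne')
    rw [Measure.map_apply hq hWo.measurableSet, Measure.map_apply hq hB] at hWle
    exact (measure_mono (preimage_mono hBW)).trans ((hopen W hWo).trans hWle)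

open MeasureTheory Metric Set Filter
open scoped ENNReal NNReal Topology RealInnerProductSpace

lemma map_baseQ {n : ℕ} (hn : 2 ≤ n) {ℓ : ℝ × Euc (n-2) → ℝ} {E : Set (Euc n)}
    (hEm : MeasurableSet E) (hE : CircDistrib hn ℓ E) :
    (volume.restrict E).map (baseQ hn) =
      (volume.restrict (Ioi (0:ℝ) ×ˢ (univ : Set (Euc (n-2))))).withDensity
        (fun p => ENNReal.ofReal (ℓ p)) := by
  have hQ := (continuous_baseQ hn).measurable
  ext A hA
  rw [Measure.map_apply hQ hA, Measure.restrict_apply (hQ hA), withDensity_apply _ hA,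
    volume_polar hn ((hQ hA).inter hEm), ← lintegral_indicator hA]
  refine lintegral_congr_ae ?_
  filter_upwards [hE, ae_restrict_mem (measurableSet_Ioi.prod MeasurableSet.univ)] with p hp hp0
  have hp1 : 0 < p.1 := hp0.1
  by_cases h : p ∈ A
  · rw [indicator_of_mem h, ← hp, slice_len hn E hp1]
    congr 2
    ext θ
    simp [sliceA, baseQ_Psi hn hp1.le, h]
  · rw [indicator_of_notMem h]
    have : sliceA hn (baseQ hn ⁻¹' A ∩ E) p = ∅ := by
      ext θ
      simp [sliceA, baseQ_Psi hn hp1.le, h]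
    simp [this]

lemma integral_baseQ {n : ℕ} (hn : 2 ≤ n) {ℓ : ℝ × Euc (n-2) → ℝ} (hl : Measurable ℓ)
    (hl_nonneg : ∀ p ∈ Ioi (0:ℝ) ×ˢ (univ : Set (Euc (n-2))), 0 ≤ ℓ p)
    {E : Set (Euc n)}
    (hEm : MeasurableSet E) (hE : CircDistrib hn ℓ E) {T : ℝ × Euc (n-2) → ℝ}
    (hT : Continuous T) :
    ∫ p in Ioi (0:ℝ) ×ˢ (univ : Set (Euc (n-2))), ℓ p * T p = ∫ x in E, T (baseQ hn x) := by
  rw [← integral_map (continuous_baseQ hn).aemeasurable hT.aestronglyMeasurable,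
    map_baseQ hn hEm hE, integral_withDensity_eq_integral_toReal_smul
      (f := fun p => ENNReal.ofReal (ℓ p)) (ENNReal.measurable_ofReal.comp hl) (Eventually.of_forall fun _ => ENNReal.ofReal_lt_top)]
  refine setIntegral_congr_fun (measurableSet_Ioi.prod MeasurableSet.univ) fun p hp => ?_
  simp [ENNReal.toReal_ofReal (hl_nonneg p hp)]

lemma isCompact_baseQ_preimage {n : ℕ} (hn : 2 ≤ n) {K : Set (ℝ × Euc (n-2))} (hK : IsCompact K) :
    IsCompact (baseQ hn ⁻¹' K) := by
  have h : IsCompact ((fun z : (ℝ × Euc (n-2)) × Ang => Psi hn z.1 z.2) '' (K ×ˢ univ)) :=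
    (hK.prod isCompact_univ).image (continuous_Psi hn)
  refine h.of_isClosed_subset (hK.isClosed.preimage (continuous_baseQ hn)) fun x hx => ?_
  obtain ⟨θ, hθ⟩ := exists_Psi hn x
  exact ⟨(baseQ hn x, θ), ⟨hx, mem_univ _⟩, hθ⟩

/-- product of a function smooth off the axis with a pulled-back cut-off -/
noncomputable def pull {n : ℕ} (hn : 2 ≤ n) (ψ : Euc n → ℝ) (φ : ℝ × Euc (n-2) → ℝ) :
    Euc n → ℝ := fun x => ψ x * φ (baseQ hn x)

lemma pull_hcs {n : ℕ} (hn : 2 ≤ n) (ψ : Euc n → ℝ) {φ : ℝ × Euc (n-2) → ℝ}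
    (hc : HasCompactSupport φ) : HasCompactSupport (pull hn ψ φ) := by
  refine HasCompactSupport.intro (isCompact_baseQ_preimage hn hc) fun x hx => ?_
  have : φ (baseQ hn x) = 0 := image_eq_zero_of_notMem_tsupport hx
  simp [pull, this]

/-- coordinate projection -/
noncomputable def projE {n : ℕ} (i : Fin n) : Euc n →L[ℝ] ℝ := EuclideanSpace.proj i

lemma projE_apply {n : ℕ} (i : Fin n) (v : Euc n) : projE i v = v i := rfl

/-- derivative of the radius -/
noncomputable def radD {n : ℕ} (hn : 2 ≤ n) (x : Euc n) : Euc n →L[ℝ] ℝ :=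
  ‖pr12 hn x‖⁻¹ • (x ⟨0, by omega⟩ • projE ⟨0, by omega⟩
    + x ⟨1, by omega⟩ • projE ⟨1, by omega⟩)

noncomputable def prCL {n : ℕ} (hn : 2 ≤ n) : Euc n →L[ℝ] Euc (n-2) :=
  LinearMap.toContinuousLinearMap
    { toFun := prC hn
      map_add' := fun x y => by ext i; simp [prC_apply]
      map_smul' := fun c y => by ext i; simp [prC_apply] }

lemma norm_pr12_sqrt {n : ℕ} (hn : 2 ≤ n) (x : Euc n) :
    ‖pr12 hn x‖ = √((x ⟨0, by omega⟩)^2 + (x ⟨1, by omega⟩)^2) := by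
  rw [← norm_pr12_sq, Real.sqrt_sq (norm_nonneg _)]

lemma hasFDerivAt_coord {n : ℕ} (i : Fin n) (x : Euc n) :
    HasFDerivAt (fun y : Euc n => y i)
      (projE i) x :=
  (projE i).hasFDerivAt

lemma hasFDerivAt_rad {n : ℕ} (hn : 2 ≤ n) {x : Euc n} (hx : pr12 hn x ≠ 0) :
    HasFDerivAt (fun y => ‖pr12 hn y‖) (radD hn x) x := by
  have hr : ‖pr12 hn x‖ ≠ 0 := norm_ne_zero_iff.2 hx
  have e : (fun y => ‖pr12 hn y‖) = fun y => √((y ⟨0, by omega⟩)^2 + (y ⟨1, by omega⟩)^2) :=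
    funext fun y => norm_pr12_sqrt hn y
  rw [e]
  have h := (((hasFDerivAt_coord ⟨0, by omega⟩ x).pow 2).add
    ((hasFDerivAt_coord ⟨1, by omega⟩ x).pow 2)).sqrt (by
      have := norm_pr12_sq hn x
      intro h0
      rw [Pi.add_apply, ← norm_pr12_sq hn] at h0
      exact hr (pow_eq_zero_iff (two_ne_zero) |>.1 h0))
  refine (h.congr_fderiv ?_)
  ext v
  simp [radD, norm_pr12_sqrt hn x, projE_apply]
  ring

lemma hasFDerivAt_baseQ {n : ℕ} (hn : 2 ≤ n) {x : Euc n} (hx : pr12 hn x ≠ 0) :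
    HasFDerivAt (baseQ hn) ((radD hn x).prod (prCL hn)) x :=
  (hasFDerivAt_rad hn hx).prodMk (prCL hn).hasFDerivAt

lemma contDiffAt_rad {n : ℕ} (hn : 2 ≤ n) {x : Euc n} (hx : pr12 hn x ≠ 0) :
    ContDiffAt ℝ 1 (fun y => ‖pr12 hn y‖) x := by
  have e : (fun y => ‖pr12 hn y‖) = fun y => √((y ⟨0, by omega⟩)^2 + (y ⟨1, by omega⟩)^2) :=
    funext fun y => norm_pr12_sqrt hn y
  rw [e]
  refine ContDiffAt.sqrt (by fun_prop) ?_
  rw [← norm_pr12_sq hn x]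
  exact pow_ne_zero _ (norm_ne_zero_iff.2 hx)

lemma contDiffAt_baseQ {n : ℕ} (hn : 2 ≤ n) {x : Euc n} (hx : pr12 hn x ≠ 0) :
    ContDiffAt ℝ 1 (baseQ hn) x :=
  (contDiffAt_rad hn hx).prodMk (prCL hn).contDiff.contDiffAt

lemma pull_eventually_zero {n : ℕ} (hn : 2 ≤ n) (ψ : Euc n → ℝ) {φ : ℝ × Euc (n-2) → ℝ}
    (hs : tsupport φ ⊆ Ioi (0:ℝ) ×ˢ univ) {x : Euc n} (hx : pr12 hn x = 0) :
    pull hn ψ φ =ᶠ[𝓝 x] fun _ => 0 := by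
  have h0 : baseQ hn x ∉ tsupport φ := fun h => by
    have := (hs h).1
    simp [baseQ, hx] at this
  have : ∀ᶠ y in 𝓝 x, baseQ hn y ∉ tsupport φ :=
    (continuous_baseQ hn).continuousAt.eventually ((isClosed_tsupport φ).isOpen_compl.mem_nhds h0)
  filter_upwards [this] with y hy
  simp [pull, image_eq_zero_of_notMem_tsupport hy]

lemma pull_contDiff {n : ℕ} (hn : 2 ≤ n) {ψ : Euc n → ℝ} {φ : ℝ × Euc (n-2) → ℝ}
    (hψ : ∀ x, pr12 hn x ≠ 0 → ContDiffAt ℝ 1 ψ x) (hφ : ContDiff ℝ 1 φ)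
    (hs : tsupport φ ⊆ Ioi (0:ℝ) ×ˢ univ) : ContDiff ℝ 1 (pull hn ψ φ) := by
  rw [contDiff_iff_contDiffAt]
  intro x
  by_cases hx : pr12 hn x = 0
  · exact contDiffAt_const.congr_of_eventuallyEq (pull_eventually_zero hn ψ hs hx)
  · exact (hψ x hx).mul (hφ.contDiffAt.comp x (contDiffAt_baseQ hn hx))

lemma pull_fderiv {n : ℕ} (hn : 2 ≤ n) {ψ : Euc n → ℝ} {φ : ℝ × Euc (n-2) → ℝ} {x : Euc n}
    (hx : pr12 hn x ≠ 0) {ψ' : Euc n →L[ℝ] ℝ} (hψ : HasFDerivAt ψ ψ' x) (hφ : ContDiff ℝ 1 φ)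
    (v : Euc n) :
    fderiv ℝ (pull hn ψ φ) x v =
      ψ x * fderiv ℝ φ (baseQ hn x) (radD hn x v, prC hn v) + φ (baseQ hn x) * ψ' v := by
  have h1 : HasFDerivAt φ (fderiv ℝ φ (baseQ hn x)) (baseQ hn x) :=
    (hφ.differentiable one_ne_zero _).hasFDerivAt
  have h := hψ.mul (h1.comp x (hasFDerivAt_baseQ hn hx))
  have h' : HasFDerivAt (pull hn ψ φ) _ x := h
  rw [h'.fderiv]
  simp [prCL]

lemma trace_prod {k : ℕ} (L : (ℝ × Euc k) →L[ℝ] (ℝ × Euc k)) :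
    LinearMap.trace ℝ (ℝ × Euc k) L.toLinearMap =
      (L (1, 0)).1 + ∑ i, (L (0, EuclideanSpace.single i 1)).2 i := by
  let b := (Module.Basis.singleton Unit ℝ).prod (EuclideanSpace.basisFun (Fin k) ℝ).toBasis
  rw [LinearMap.trace_eq_matrix_trace ℝ b, Matrix.trace, Fintype.sum_sum_type]
  simp [b, LinearMap.toMatrix_apply, Module.Basis.prod_apply]

lemma fed_bound {m : ℕ} {E : Set (Euc (m+1))}
    (hE : MeasurableSet E) (hfin : μH[(m:ℝ)] (essBoundary E) < ⊤) {φ : Euc (m+1) → ℝ}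
    (hφ : ContDiff ℝ 1 φ) (hc : HasCompactSupport φ) (h1 : ∀ x, |φ x| ≤ 1) (i : Fin (m+1)) :
    |∫ y in E, fderiv ℝ φ y (EuclideanSpace.single i 1)| ≤
      (μH[(m:ℝ)] (essBoundary E)).toReal / cH m := by
  have hpos : (0:ℝ) < cH m := cH_pos m
  have h := federer (EuclideanSpace.single i (1:ℝ)) hE hfin hφ hc
  rw [le_div_iff₀ hpos, mul_comm]
  refine h.trans ?_
  have h2 : ‖∫ x in essBoundary E, |φ x| ∂μH[(m:ℝ)]‖ ≤ 1 * (μH[(m:ℝ)]).real (essBoundary E) :=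
    norm_setIntegral_le_of_norm_le_const hfin (fun x _ => by simpa using h1 x)
  have h3 := (le_abs_self _).trans h2
  simpa [Measure.real] using h3

open MeasureTheory Metric Set Filter
open scoped ENNReal NNReal Topology RealInnerProductSpace

lemma locInt {n : ℕ} {ℓ : ℝ × Euc (n-2) → ℝ} (hl : Measurable ℓ)
    (hl_nonneg : ∀ p ∈ Ioi (0:ℝ) ×ˢ (univ : Set (Euc (n-2))), 0 ≤ ℓ p)
    (hl_le : ∀ᵐ p ∂(volume.restrict (Ioi (0:ℝ) ×ˢ (univ : Set (Euc (n-2))))),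
      ℓ p ≤ 2 * Real.pi * p.1) :
    LocallyIntegrableOn ℓ (Ioi (0:ℝ) ×ˢ (univ : Set (Euc (n-2)))) volume := by
  have hΩ : IsOpen (Ioi (0:ℝ) ×ˢ (univ : Set (Euc (n-2)))) := isOpen_Ioi.prod isOpen_univ
  rw [locallyIntegrableOn_iff hΩ.isLocallyClosed]
  intro k hk hkc
  have h : IntegrableOn (fun p : ℝ × Euc (n-2) => 2 * Real.pi * p.1) k volume :=
    (Continuous.continuousOn (by fun_prop)).integrableOn_compact hkc
  refine Integrable.mono' h hl.aestronglyMeasurable ?_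
  filter_upwards [ae_restrict_of_ae_restrict_of_subset hk hl_le, ae_restrict_mem hkc.measurableSet]
    with p hp hpk
  rw [Real.norm_eq_abs, abs_of_nonneg (hl_nonneg p (hk hpk))]
  exact hp

lemma pr12_single {n : ℕ} (hn : 2 ≤ n) (i : Fin (n-2)) (h : i.1 + 2 < n) (x : Euc n) :
    radD hn x (EuclideanSpace.single ⟨i.1+2, h⟩ 1) = 0 ∧
    prC hn (EuclideanSpace.single ⟨i.1+2, h⟩ 1) = EuclideanSpace.single i 1 := by
  constructor
  · simp [radD, projE_apply]
  · ext j
    simp [prC_apply, Fin.ext_iff]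
    
lemma prC_single {n : ℕ} (hn : 2 ≤ n) (j : ℕ) (hj : j < 2) (h : j < n) :
    prC hn (EuclideanSpace.single ⟨j, h⟩ 1) = 0 := by
  ext i
  simp [prC_apply]
  omega

lemma trace_pull {n : ℕ} (hn : 2 ≤ n) {g : ℝ × Euc (n-2) → ℝ × Euc (n-2)} (hg : ContDiff ℝ 1 g)
    {x : Euc n} (hx : pr12 hn x ≠ 0) :
    LinearMap.trace ℝ (ℝ × Euc (n-2)) (fderiv ℝ g (baseQ hn x)).toLinearMap =
      (fderiv ℝ (pull hn (fun y => y ⟨0, by omega⟩ * ‖pr12 hn y‖⁻¹) fun p => (g p).1) x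
        (EuclideanSpace.single ⟨0, by omega⟩ 1) +
      fderiv ℝ (pull hn (fun y => y ⟨1, by omega⟩ * ‖pr12 hn y‖⁻¹) fun p => (g p).1) x
        (EuclideanSpace.single ⟨1, by omega⟩ 1) -
      pull hn (fun y => ‖pr12 hn y‖⁻¹) (fun p => (g p).1) x) +
      ∑ i : Fin (n-2), fderiv ℝ (pull hn (fun _ => 1) fun p => (g p).2 i) x
        (EuclideanSpace.single ⟨i.1+2, by have := i.2; omega⟩ 1) := by
  have hr : ‖pr12 hn x‖ ≠ 0 := norm_ne_zero_iff.2 hx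
  have hgd : HasFDerivAt g (fderiv ℝ g (baseQ hn x)) (baseQ hn x) :=
    (hg.differentiable one_ne_zero _).hasFDerivAt
  have hg1 : ContDiff ℝ 1 fun p => (g p).1 := hg.fst
  have hg2 : ∀ i, ContDiff ℝ 1 fun p => (g p).2 i := fun i =>
    (projE i).contDiff.comp hg.snd
  have hd1 : fderiv ℝ (fun p => (g p).1) (baseQ hn x) =
      (ContinuousLinearMap.fst ℝ _ _).comp (fderiv ℝ g (baseQ hn x)) := hgd.fst.fderiv
  have hd2 : ∀ i, fderiv ℝ (fun p => (g p).2 i) (baseQ hn x) =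
      (projE i).comp ((ContinuousLinearMap.snd ℝ _ _).comp (fderiv ℝ g (baseQ hn x))) := fun i =>
    ((projE i).hasFDerivAt.comp _ hgd.snd).fderiv
  have hinv := (hasFDerivAt_inv hr).comp x (hasFDerivAt_rad hn hx)
  have hψ : ∀ j : Fin n, HasFDerivAt (fun y : Euc n => y j * ‖pr12 hn y‖⁻¹) _ x := fun j =>
    (hasFDerivAt_coord j x).mul hinv
  rw [pull_fderiv hn hx (hψ _) hg1, pull_fderiv hn hx (hψ _) hg1, trace_prod]
  simp_rw [fun i => pull_fderiv hn hx (hasFDerivAt_const (1:ℝ) x) (hg2 i)]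
  rw [prC_single hn 0 (by norm_num), prC_single hn 1 (by norm_num)]
  congr 1
  · have hs := norm_pr12_sq hn x
    have hlin : ∀ t : ℝ, fderiv ℝ (fun p => (g p).1) (baseQ hn x) (t, 0) =
        t * (fderiv ℝ g (baseQ hn x) (1, 0)).1 := fun t => by
      have : ((t, 0) : ℝ × Euc (n-2)) = t • (1, 0) := by simp
      rw [this, map_smul, hd1]; simp
    rw [hlin, hlin]
    simp [radD, projE_apply, pull]
    generalize (fderiv ℝ g (baseQ hn x) (1, 0)).1 = D
    generalize (g (baseQ hn x)).1 = G
    generalize ‖pr12 hn x‖ = r at *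
    field_simp
    rw [show x.ofLp ⟨0, by omega⟩^2 = r^2 - x.ofLp ⟨1, by omega⟩^2 by rw [hs]; ring]
    ring
  · refine Finset.sum_congr rfl fun i _ => ?_
    obtain ⟨h1, h2⟩ := pr12_single hn i (by have := i.2; omega) x
    rw [h1, h2, hd2]
    simp [projE_apply]

lemma trace_pull' {n : ℕ} (hn : 2 ≤ n) {g : ℝ × Euc (n-2) → ℝ × Euc (n-2)} (hg : ContDiff ℝ 1 g)
    (hs : tsupport g ⊆ Ioi (0:ℝ) ×ˢ univ) (x : Euc n) :
    LinearMap.trace ℝ (ℝ × Euc (n-2)) (fderiv ℝ g (baseQ hn x)).toLinearMap =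
      (fderiv ℝ (pull hn (fun y => y ⟨0, by omega⟩ * ‖pr12 hn y‖⁻¹) fun p => (g p).1) x
        (EuclideanSpace.single ⟨0, by omega⟩ 1) +
      fderiv ℝ (pull hn (fun y => y ⟨1, by omega⟩ * ‖pr12 hn y‖⁻¹) fun p => (g p).1) x
        (EuclideanSpace.single ⟨1, by omega⟩ 1) -
      pull hn (fun y => ‖pr12 hn y‖⁻¹) (fun p => (g p).1) x) +
      ∑ i : Fin (n-2), fderiv ℝ (pull hn (fun _ => 1) fun p => (g p).2 i) x
        (EuclideanSpace.single ⟨i.1+2, by have := i.2; omega⟩ 1) := by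
  by_cases hx : pr12 hn x = 0
  swap
  · exact trace_pull hn hg hx
  have hs1' : tsupport (fun p => (g p).1) ⊆ tsupport g :=
    closure_mono fun p hp h => hp (by simp [h])
  have hs2' : ∀ i, tsupport (fun p => (g p).2 i) ⊆ tsupport g := fun i =>
    closure_mono fun p hp h => hp (by simp [h])
  have hs1 := hs1'.trans hs
  have hs2 := fun i => (hs2' i).trans hs
  have hQ : baseQ hn x ∉ tsupport g := fun h => by
    have := (hs h).1
    simp [baseQ, hx] at this
  have h0 : fderiv ℝ g (baseQ hn x) = 0 := by
    have : baseQ hn x ∉ tsupport (fderiv ℝ g) := fun h => hQ (tsupport_fderiv_subset ℝ h)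
    exact image_eq_zero_of_notMem_tsupport this
  rw [h0, (pull_eventually_zero hn _ hs1 hx).fderiv_eq, (pull_eventually_zero hn _ hs1 hx).fderiv_eq,
    (pull_eventually_zero hn _ hs1 hx).eq_of_nhds]
  rw [Finset.sum_eq_zero fun i _ => by
    rw [(pull_eventually_zero hn _ (hs2 i) hx).fderiv_eq]; simp]
  simp

lemma abs_coord_le {n : ℕ} (hn : 2 ≤ n) (x : Euc n) (j : Fin n) (hj : j.1 < 2) :
    |x j * ‖pr12 hn x‖⁻¹| ≤ 1 := by
  rw [abs_mul, abs_of_nonneg (inv_nonneg.2 (norm_nonneg _)), ← div_eq_mul_inv]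
  refine div_le_one_of_le₀ ?_ (norm_nonneg _)
  exact PiLp.norm_apply_le (pr12 hn x) ⟨j.1, hj⟩

lemma split_int {X ι : Type*} [MeasurableSpace X] [Fintype ι] {μ : Measure X} {a b c : X → ℝ}
    {d : ι → X → ℝ} (ha : Integrable a μ) (hb : Integrable b μ) (hc : Integrable c μ)
    (hd : ∀ i, Integrable (d i) μ) :
    ∫ x, (a x + b x - c x) + ∑ i, d i x ∂μ =
      (∫ x, a x ∂μ + ∫ x, b x ∂μ - ∫ x, c x ∂μ) + ∑ i, ∫ x, d i x ∂μ := by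
  have h1 : Integrable (fun x => a x + b x) μ := ha.add hb
  have h2 : Integrable (fun x => a x + b x - c x) μ := h1.sub hc
  rw [integral_add h2 (integrable_finsetSum _ fun i _ => hd i), integral_sub h1 hc,
    integral_add ha hb, integral_finsetSum _ fun i _ => hd i]

theorem bvloc {m : ℕ} (hn : 2 ≤ m+1) {ℓ : ℝ × Euc (m+1-2) → ℝ} (hl : Measurable ℓ)
    (hl_nonneg : ∀ p ∈ Ioi (0:ℝ) ×ˢ (univ : Set (Euc (m+1-2))), 0 ≤ ℓ p)
    (hl_le : ∀ᵐ p ∂(volume.restrict (Ioi (0:ℝ) ×ˢ (univ : Set (Euc (m+1-2))))),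
      ℓ p ≤ 2 * Real.pi * p.1) {E : Set (Euc (m+1))} (hEm : MeasurableSet E)
    (hE : CircDistrib hn ℓ E) (hv : volume E < ⊤) (hper : μH[(m:ℝ)] (essBoundary E) < ⊤) :
    BVlocOn ℓ (Ioi (0:ℝ) ×ˢ (univ : Set (Euc (m+1-2)))) := by
  refine ⟨locInt hl hl_nonneg hl_le, fun U hU hUc hUs => ?_⟩
  obtain ⟨δ, hδ, hδU⟩ : ∃ δ : ℝ, 0 < δ ∧ ∀ p ∈ closure U, δ ≤ p.1 :=
    hUc.exists_forall_le' continuous_fst.continuousOn (fun p hp => (hUs hp).1)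
  set K := (μH[(m:ℝ)] (essBoundary E)).toReal / cH m with hK
  refine ⟨(K + K + δ⁻¹ * (volume E).toReal) + ∑ i : Fin (m+1-2), K, fun g hg hgc hgs hg1 => ?_⟩
  have hsΩ : tsupport g ⊆ Ioi (0:ℝ) ×ˢ univ := hgs.trans (subset_closure.trans hUs)
  set T : ℝ × Euc (m+1-2) → ℝ := fun p => LinearMap.trace ℝ _ (fderiv ℝ g p).toLinearMap with hT
  have hfc : Continuous (fderiv ℝ g) := hg.continuous_fderiv one_ne_zero
  have hTc : Continuous T := by
    simp only [hT, trace_prod]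
    fun_prop
  have hT0 : ∀ p, p ∉ tsupport g → T p = 0 := fun p hp => by
    have : p ∉ tsupport (fderiv ℝ g) := fun h => hp (tsupport_fderiv_subset ℝ h)
    simp [hT, image_eq_zero_of_notMem_tsupport this]
  have e1 : ∫ p in U, ℓ p * T p = ∫ p in Ioi (0:ℝ) ×ˢ (univ : Set (Euc (m+1-2))), ℓ p * T p := by
    refine (setIntegral_eq_of_subset_of_forall_sdiff_eq_zero
      (measurableSet_Ioi.prod MeasurableSet.univ) (subset_closure.trans hUs) fun p hp => ?_).symm
    rw [hT0 p fun h => hp.2 (hgs h), mul_zero]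
  rw [e1, integral_baseQ hn hl hl_nonneg hEm hE hTc]
  simp only [hT, trace_pull' hn hg hsΩ]
  have hg1' : ContDiff ℝ 1 fun p => (g p).1 := hg.fst
  have hg2' : ∀ i, ContDiff ℝ 1 fun p => (g p).2 i := fun i => (projE i).contDiff.comp hg.snd
  have hs1 : tsupport (fun p => (g p).1) ⊆ tsupport g :=
    closure_mono fun p hp h => hp (by simp [h])
  have hs2 : ∀ i, tsupport (fun p => (g p).2 i) ⊆ tsupport g := fun i =>
    closure_mono fun p hp h => hp (by simp [h])
  have hc1 : HasCompactSupport fun p => (g p).1 := hgc.of_isClosed_subset (isClosed_tsupport _) hs1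
  have hc2 : ∀ i, HasCompactSupport fun p => (g p).2 i := fun i =>
    hgc.of_isClosed_subset (isClosed_tsupport _) (hs2 i)
  have hb1 : ∀ p, |(g p).1| ≤ 1 := fun p => (norm_fst_le (g p)).trans (hg1 p)
  have hb2 : ∀ i p, |(g p).2 i| ≤ 1 := fun i p =>
    ((PiLp.norm_apply_le (g p).2 i).trans (norm_snd_le (g p))).trans (hg1 p)
  have hinv : ∀ x : Euc (m+1), pr12 hn x ≠ 0 → ContDiffAt ℝ 1 (fun y => ‖pr12 hn y‖⁻¹) x :=
    fun x hx => (contDiffAt_rad hn hx).inv (norm_ne_zero_iff.2 hx)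
  have hψ : ∀ (j : Fin (m+1)) (x : Euc (m+1)), pr12 hn x ≠ 0 →
      ContDiffAt ℝ 1 (fun y : Euc (m+1) => y j * ‖pr12 hn y‖⁻¹) x := fun j x hx =>
    ContDiffAt.mul ((projE j).contDiff.contDiffAt) (hinv x hx)
  have hA : ∀ j, ContDiff ℝ 1 (pull hn (fun y => y j * ‖pr12 hn y‖⁻¹) fun p => (g p).1) :=
    fun j => pull_contDiff hn (hψ j) hg1' (hs1.trans hsΩ)
  have hAc : ∀ j, HasCompactSupport (pull hn (fun y => y j * ‖pr12 hn y‖⁻¹) fun p => (g p).1) :=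
    fun j => pull_hcs hn _ hc1
  have hR : ContDiff ℝ 1 (pull hn (fun y => ‖pr12 hn y‖⁻¹) fun p => (g p).1) :=
    pull_contDiff hn hinv hg1' (hs1.trans hsΩ)
  have hRc : HasCompactSupport (pull hn (fun y => ‖pr12 hn y‖⁻¹) fun p => (g p).1) :=
    pull_hcs hn _ hc1
  have hB : ∀ i, ContDiff ℝ 1 (pull hn (fun _ => 1) fun p => (g p).2 i) :=
    fun i => pull_contDiff hn (fun _ _ => contDiffAt_const) (hg2' i) ((hs2 i).trans hsΩ)
  have hBc : ∀ i, HasCompactSupport (pull hn (fun _ => 1) fun p => (g p).2 i) :=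
    fun i => pull_hcs hn _ (hc2 i)
  have iA := fun j v => (integrable_fderiv (hA j) (hAc j) v).integrableOn (s := E)
  have iB := fun i v => (integrable_fderiv (hB i) (hBc i) v).integrableOn (s := E)
  have iR := (hR.continuous.integrable_of_hasCompactSupport hRc (μ := volume)).integrableOn (s := E)
  refine (le_of_eq (split_int (iA _ _) (iA _ _) iR fun i => iB i _)).trans ?_
  have bA : ∀ j : Fin (m+1), j.1 < 2 → |∫ x in E, fderiv ℝ (pull hn (fun y => y j * ‖pr12 hn y‖⁻¹)
      fun p => (g p).1) x (EuclideanSpace.single j 1)| ≤ K := fun j hj =>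
    fed_bound hEm hper (hA j) (hAc j) (fun x => by
      rw [pull, abs_mul]
      exact mul_le_one₀ (abs_coord_le hn x j hj) (abs_nonneg _) (hb1 _)) j
  have bB : ∀ i (j : Fin (m+1)), |∫ x in E, fderiv ℝ (pull hn (fun _ => 1)
      fun p => (g p).2 i) x (EuclideanSpace.single j 1)| ≤ K := fun i j =>
    fed_bound hEm hper (hB i) (hBc i) (fun x => by
      rw [pull, one_mul]
      exact hb2 i _) j
  have bR : |∫ x in E, pull hn (fun y => ‖pr12 hn y‖⁻¹) (fun p => (g p).1) x| ≤
      δ⁻¹ * (volume E).toReal := by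
    rw [← Real.norm_eq_abs]
    refine norm_setIntegral_le_of_norm_le_const (C := δ⁻¹) hv fun x _ => ?_
    rw [pull, Real.norm_eq_abs, abs_mul, abs_of_nonneg (inv_nonneg.2 (norm_nonneg _))]
    by_cases h : baseQ hn x ∈ tsupport g
    · have h1 : δ ≤ ‖pr12 hn x‖ := hδU _ (subset_closure (hgs h))
      calc ‖pr12 hn x‖⁻¹ * |(g (baseQ hn x)).1| ≤ δ⁻¹ * 1 :=
            mul_le_mul (inv_anti₀ hδ h1) (hb1 _) (abs_nonneg _) (inv_nonneg.2 hδ.le)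
        _ = δ⁻¹ := mul_one _
    · simp [image_eq_zero_of_notMem_tsupport h, hδ.le]
  refine add_le_add ?_ (Finset.sum_le_sum fun i _ => (le_abs_self _).trans (bB i _))
  have h0 := (le_abs_self _).trans (bA ⟨0, by omega⟩ (by norm_num))
  have h1 := (le_abs_self _).trans (bA ⟨1, by omega⟩ (by norm_num))
  have h2 := (neg_le_abs _).trans bR
  linarith

/-- **Theorem 1.4, first part.** The circular symmetrisation does not increase the
perimeter: if `E` is circularly `ℓ`-distributed with finite perimeter and finite volume,
then `ℓ ∈ BV_loc((0,∞) × ℝ^{n-2})`, `F^ℓ` has finite perimeter and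
`P(F^ℓ; Φ₁₂(B × S¹)) ≤ P(E; Φ₁₂(B × S¹))` for every Borel `B ⊆ (0,∞) × ℝ^{n-2}`. -/
theorem circular_perimeter_inequality
    (n : ℕ) (hn : 2 ≤ n)
    (ℓ : ℝ × Euc (n - 2) → ℝ) (hl_meas : Measurable ℓ)
    (hl_nonneg : ∀ p ∈ (Ioi (0:ℝ)) ×ˢ (univ : Set (Euc (n - 2))), 0 ≤ ℓ p)
    (hl_le : ∀ᵐ p ∂(volume.restrict ((Ioi (0:ℝ)) ×ˢ (univ : Set (Euc (n - 2))))),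
      ℓ p ≤ 2 * Real.pi * p.1)
    (E : Set (Euc n)) (hE_meas : MeasurableSet E) (hE_dist : CircDistrib hn ℓ E)
    (hE_perim : perim E univ < ⊤) (hE_vol : volume E < ⊤)
 :
    BVlocOn ℓ ((Ioi (0:ℝ)) ×ˢ (univ : Set (Euc (n - 2)))) ∧
      perim (circSymm hn ℓ) univ < ⊤ ∧
      ∀ B : Set (ℝ × Euc (n - 2)), MeasurableSet B → B ⊆ (Ioi (0:ℝ)) ×ˢ (univ : Set (Euc (n - 2))) →
        perim (circSymm hn ℓ) (cylSet hn B) ≤ perim E (cylSet hn B) := by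
  obtain ⟨m, rfl⟩ : ∃ m, n = m + 1 := ⟨n - 1, by omega⟩
  have hcast : (((m + 1 : ℕ) : ℝ) - 1) = (m : ℝ) := by push_cast; ring
  have hper : μH[(m:ℝ)] (essBoundary E) < ⊤ := by
    have h := hE_perim
    rw [perim, inter_univ, hcast] at h
    exact h
  obtain ⟨h1, h2⟩ := perim_main hn (measurableSet_circSymm hn hl_meas) hE_meas hE_vol.ne
    (circSymm_refl hn ℓ) (slice_eq_of_distrib hn hl_nonneg hl_le hE_dist) hper
  refine ⟨bvloc hn hl_meas hl_nonneg hl_le hE_meas hE_dist hE_vol hper, ?_, fun B hB hBs => ?_⟩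
  · rw [perim, inter_univ, hcast]
    exact h1
  · have hc : cylSet hn B = baseQ hn ⁻¹' B := by
      ext x
      refine ⟨fun h => h.2, fun h => ⟨?_, h⟩⟩
      have h3 : (0:ℝ) < ‖pr12 hn x‖ := (hBs h).1
      exact norm_pos_iff.1 h3
    rw [perim, perim, hcast, hc]
    exact h2 B hB
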